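/- arXiv:math/0607007 — 7 statements merged into one kernel-verified Lean document; each statement's English description precedes it below -/
import Mathlib

section
/- Let ν ≥ -1/2 be a real number. There exists a constant C > 0 such that for all r, r' > 0, all y ∈ ℝ with |y| ≤ 4√(r r'), and all t ∈ Ω, one has |e^{-2(r+r')·coth(t/2)} · Ĩ_ν(y/sinh(t/2))| ≤ C·e^{-2α(t)(1-|β(t)|)(r+r')}. -/
/-- The normalized modified Bessel function
`Ĩ_ν(z) = Σ_{k=0}^∞ (z/2)^{2k}/(k!·Γ(ν+k+1))`. -/
noncomputable def ItildeC (ν : ℝ) (z : ℂ) : ℂ :=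
  ∑' k : ℕ, (z / 2) ^ (2 * k) / ((Nat.factorial k : ℂ) * Complex.Gamma ((ν : ℂ) + k + 1))

/-- The domain `Ω = {t ∈ ℂ : Re t ≥ 0} ∖ 2π√(-1)ℤ`. -/
def InOmega (t : ℂ) : Prop :=
  0 ≤ t.re ∧ ∀ n : ℤ, t ≠ 2 * Real.pi * Complex.I * n

/-- `α(t) = sinh(Re t)/(cosh(Re t) − cos(Im t))`. -/
noncomputable def alphaT (t : ℂ) : ℝ :=
  Real.sinh t.re / (Real.cosh t.re - Real.cos t.im)

/-- `β(t) = cos(Im t/2)/cosh(Re t/2)`. -/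
noncomputable def betaT (t : ℂ) : ℝ :=
  Real.cos (t.im / 2) / Real.cosh (t.re / 2)

lemma gamma_half (k : ℕ) : Complex.Gamma ((k : ℂ) + 1 / 2) * 4 ^ k * (k.factorial : ℂ) =
    ((2 * k).factorial : ℂ) * Complex.Gamma (1 / 2) := by
  induction k with
  | zero => simp
  | succ k ih =>
    have h : (k : ℂ) + 1 / 2 ≠ 0 := by
      intro h
      have := congrArg Complex.re h
      simp at this
      have hk : (0 : ℝ) ≤ k := k.cast_nonneg
      linarith
    have e : ((k + 1 : ℕ) : ℂ) + 1 / 2 = ((k : ℂ) + 1 / 2) + 1 := by push_cast; ring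
    rw [e, Complex.Gamma_add_one _ h]
    have e2 : 2 * (k + 1) = (2 * k + 1) + 1 := by ring
    rw [e2, Nat.factorial_succ, Nat.factorial_succ, Nat.factorial_succ]
    push_cast
    linear_combination (4 * ((k : ℂ) + 1 / 2) * (k + 1)) * ih

lemma gamma_half_ne (k : ℕ) : Complex.Gamma ((k : ℂ) + 1 / 2) ≠ 0 := by
  apply Complex.Gamma_ne_zero_of_re_pos
  simp
  positivity

lemma norm_cosh_le (z : ℂ) : ‖Complex.cosh z‖ ≤ Real.exp |z.re| := by
  have h : Complex.cosh z = (Complex.exp z + Complex.exp (-z)) / 2 := rfl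
  rw [h, norm_div]
  have h1 := norm_add_le (Complex.exp z) (Complex.exp (-z))
  rw [Complex.norm_exp, Complex.norm_exp, Complex.neg_re] at h1
  have h2 : Real.exp z.re ≤ Real.exp |z.re| := Real.exp_le_exp.2 (le_abs_self _)
  have h3 : Real.exp (-z.re) ≤ Real.exp |z.re| := Real.exp_le_exp.2 (neg_le_abs _)
  simp only [Complex.norm_ofNat]
  linarith

lemma coeff_half (z : ℂ) (k : ℕ) :
    (z / 2) ^ (2 * k) / ((Nat.factorial k : ℂ) * Complex.Gamma ((k : ℂ) + 1 / 2))
      = (1 / Complex.Gamma (1 / 2)) * (z ^ (2 * k) / ((2 * k).factorial : ℂ)) := by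
  have h := gamma_half k
  have h1 : ((2 * k).factorial : ℂ) ≠ 0 := by exact_mod_cast (Nat.factorial_pos _).ne'
  have h2 : (k.factorial : ℂ) ≠ 0 := by exact_mod_cast (Nat.factorial_pos _).ne'
  have h3 := gamma_half_ne k
  have h4 : Complex.Gamma (1 / 2) ≠ 0 := by simpa using gamma_half_ne 0
  have h5 : (2 : ℂ) ^ (2 * k) = 4 ^ k := by rw [pow_mul]; norm_num
  rw [div_pow, h5, div_div, div_mul_div_comm, one_mul, mul_comm (Complex.Gamma (1/2)), ← h]
  ring

lemma bound_half (z : ℂ) :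
    ‖ItildeC (-1 / 2) z‖ ≤ ‖1 / Complex.Gamma (1 / 2)‖ * Real.exp |z.re| := by
  have : ItildeC (-1 / 2) z = (1 / Complex.Gamma (1 / 2)) * Complex.cosh z := by
    rw [ItildeC, ← ((Complex.hasSum_cosh z).mul_left _).tsum_eq]
    congr 1
    ext k
    rw [← coeff_half]
    congr 3
    push_cast
    ring
  rw [this, norm_mul]
  gcongr
  exact norm_cosh_le z

open MeasureTheory in
lemma bound_gt (ν : ℝ) (hν : -1 / 2 < ν) : ∃ C : ℝ, ∀ z : ℂ,
    ‖ItildeC ν z‖ ≤ C * Real.exp |z.re| := by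
  set W : ℝ → ℂ := fun x => (x : ℂ) ^ ((1 / 2 : ℂ) - 1) * (1 - (x : ℂ)) ^ (((ν : ℂ) + 1 / 2) - 1) with hW
  set μ := volume.restrict (Set.Ioc (0 : ℝ) 1) with hμ
  have hre : 0 < ((ν : ℂ) + 1 / 2).re := by simp; linarith
  have hWi : Integrable W μ := by
    have := Complex.betaIntegral_convergent (u := 1 / 2) (v := (ν : ℂ) + 1 / 2) (by simp) hre
    exact (intervalIntegrable_iff_integrableOn_Ioc_of_le zero_le_one).1 this
  have hmem : ∀ᵐ x ∂μ, x ∈ Set.Ioc (0 : ℝ) 1 := ae_restrict_mem measurableSet_Ioc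
  set G := Complex.Gamma (1 / 2) with hG
  set H := Complex.Gamma ((ν : ℂ) + 1 / 2) with hH
  have hG0 : G ≠ 0 := by
    have h0 := gamma_half_ne 0
    rwa [Nat.cast_zero, zero_add] at h0
  have hH0 : H ≠ 0 := Complex.Gamma_ne_zero_of_re_pos hre
  have hbeta : ∀ k : ℕ, ∫ x, (x : ℂ) ^ k * W x ∂μ =
      Complex.Gamma ((k : ℂ) + 1 / 2) * H / Complex.Gamma ((ν : ℂ) + k + 1) := by
    intro k
    have hk : 0 < ((k : ℂ) + 1 / 2).re := by simp; positivity
    have h := Complex.Gamma_mul_Gamma_eq_betaIntegral hk hre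
    have e : (k : ℂ) + 1 / 2 + ((ν : ℂ) + 1 / 2) = (ν : ℂ) + k + 1 := by ring
    rw [e] at h
    have hne : Complex.Gamma ((ν : ℂ) + k + 1) ≠ 0 := by
      apply Complex.Gamma_ne_zero_of_re_pos
      simp
      have hk : (0 : ℝ) ≤ k := k.cast_nonneg
      linarith
    rw [hH, h, mul_div_cancel_left₀ _ hne, Complex.betaIntegral,
      intervalIntegral.integral_of_le zero_le_one]
    apply integral_congr_ae
    filter_upwards [hmem] with x hx
    have hx0 : (x : ℂ) ≠ 0 := by exact_mod_cast hx.1.ne'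
    rw [hW]
    simp only
    rw [← mul_assoc, ← Complex.cpow_natCast, ← Complex.cpow_add _ _ hx0]
    congr 2
    ring
  refine ⟨‖1 / (G * H)‖ * ∫ x, ‖W x‖ ∂μ, fun z => ?_⟩
  set F : ℕ → ℝ → ℂ := fun k x => z ^ (2 * k) / ((2 * k).factorial : ℂ) * ((x : ℂ) ^ k * W x) with hF
  have hpow : ∀ k : ℕ, ∀ᵐ x : ℝ ∂μ, ‖(x : ℂ) ^ k * W x‖ ≤ ‖W x‖ := by
    intro k
    filter_upwards [hmem] with x hx
    rw [norm_mul, norm_pow, Complex.norm_real, Real.norm_eq_abs, abs_of_pos hx.1]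
    exact mul_le_of_le_one_left (norm_nonneg _) (pow_le_one₀ hx.1.le hx.2)
  have hpi : ∀ k : ℕ, Integrable (fun x : ℝ => (x : ℂ) ^ k * W x) μ := by
    intro k
    refine hWi.norm.mono' ?_ (hpow k)
    exact (by fun_prop : Continuous fun x : ℝ => (x : ℂ) ^ k).aestronglyMeasurable.mul hWi.1
  have hFi : ∀ k, Integrable (F k) μ := fun k => (hpi k).const_mul _
  have hFs : Summable fun k => ∫ x, ‖F k x‖ ∂μ := by
    have hs : Summable fun k : ℕ => ‖z‖ ^ (2 * k) / ((2 * k).factorial : ℝ) * ∫ x, ‖W x‖ ∂μ :=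
      (Real.hasSum_cosh ‖z‖).summable.mul_right _
    refine hs.of_nonneg_of_le (fun k => integral_nonneg fun x => norm_nonneg _) fun k => ?_
    have : ∀ x, ‖F k x‖ = ‖z‖ ^ (2 * k) / ((2 * k).factorial : ℝ) * ‖(x : ℂ) ^ k * W x‖ := by
      intro x
      rw [hF]
      simp only
      rw [norm_mul, norm_div, norm_pow, Complex.norm_natCast]
    simp_rw [this]
    rw [integral_const_mul]
    refine mul_le_mul_of_nonneg_left ?_ (by positivity)
    exact integral_mono_ae (hpi k).norm hWi.norm (hpow k)
  have hsum := hasSum_integral_of_summable_integral_norm hFi hFs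
  have hpt : ∀ᵐ x ∂μ, ∑' k, F k x = Complex.cosh (z * (Real.sqrt x : ℝ)) * W x := by
    filter_upwards [hmem] with x hx
    rw [← ((Complex.hasSum_cosh (z * (Real.sqrt x : ℝ))).mul_right (W x)).tsum_eq]
    congr 1
    ext k
    have : ((Real.sqrt x : ℝ) : ℂ) ^ 2 = x := by
      rw [← Complex.ofReal_pow, Real.sq_sqrt hx.1.le]
    rw [mul_pow, pow_mul _ 2 k, pow_mul _ 2 k, this, hF]
    simp only
    rw [pow_mul]
    ring
  have key : ItildeC ν z = 1 / (G * H) * ∫ x, Complex.cosh (z * (Real.sqrt x : ℝ)) * W x ∂μ := by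
    rw [← integral_congr_ae hpt, ← (hsum.mul_left _).tsum_eq, ItildeC]
    congr 1
    ext k
    rw [hF]
    simp only
    rw [integral_const_mul, hbeta]
    have hc := coeff_half z k
    rw [← hG] at hc
    have h3 := gamma_half_ne k
    generalize Complex.Gamma ((k : ℂ) + 1 / 2) = A at hc h3 ⊢
    calc _ = (z / 2) ^ (2 * k) / ((Nat.factorial k : ℂ) * A) *
          (A / Complex.Gamma ((ν : ℂ) + k + 1)) := by
            field_simp
      _ = _ := by
            rw [hc]; field_simp
  rw [key, norm_mul, mul_assoc]
  gcongr
  rw [← integral_mul_const]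
  refine norm_integral_le_of_norm_le (hWi.norm.mul_const _) ?_
  filter_upwards [hmem] with x hx
  rw [norm_mul, mul_comm]
  gcongr
  refine (norm_cosh_le _).trans (Real.exp_le_exp.2 ?_)
  rw [Complex.re_mul_ofReal, abs_mul, abs_of_nonneg (Real.sqrt_nonneg x)]
  exact mul_le_of_le_one_right (abs_nonneg _) (Real.sqrt_le_one.2 hx.2)

lemma bound_all (ν : ℝ) (hν : -1 / 2 ≤ ν) : ∃ C : ℝ, ∀ z : ℂ,
    ‖ItildeC ν z‖ ≤ C * Real.exp |z.re| := by
  rcases hν.eq_or_lt with h | h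
  · subst h
    exact ⟨_, bound_half⟩
  · exact bound_gt ν h

lemma trig (t : ℂ) (ht : InOmega t) :
    0 ≤ alphaT t ∧ (Complex.cosh (t / 2) / Complex.sinh (t / 2)).re = alphaT t ∧
    (1 / Complex.sinh (t / 2)).re = alphaT t * betaT t := by
  obtain ⟨hx, hn⟩ := ht
  set a := t.re / 2 with ha
  set b := t.im / 2 with hb
  have hre : t.re = 2 * a := by rw [ha]; ring
  have him : t.im = 2 * b := by rw [hb]; ring
  have ht2 : t / 2 = (a : ℂ) + (b : ℂ) * Complex.I := by
    apply Complex.ext <;> simp [ha, hb]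
  have hs : Complex.sinh (t / 2) = ⟨Real.sinh a * Real.cos b, Real.cosh a * Real.sin b⟩ := by
    rw [ht2, Complex.sinh_add, Complex.sinh_mul_I, Complex.cosh_mul_I, ← Complex.ofReal_sinh,
      ← Complex.ofReal_cosh, ← Complex.ofReal_sin, ← Complex.ofReal_cos]
    apply Complex.ext <;> simp [-Complex.ofReal_sinh, -Complex.ofReal_cosh, -Complex.ofReal_sin,
      -Complex.ofReal_cos]
  have hc : Complex.cosh (t / 2) = ⟨Real.cosh a * Real.cos b, Real.sinh a * Real.sin b⟩ := by
    rw [ht2, Complex.cosh_add, Complex.sinh_mul_I, Complex.cosh_mul_I, ← Complex.ofReal_sinh,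
      ← Complex.ofReal_cosh, ← Complex.ofReal_sin, ← Complex.ofReal_cos]
    apply Complex.ext <;> simp [-Complex.ofReal_sinh, -Complex.ofReal_cosh, -Complex.ofReal_sin,
      -Complex.ofReal_cos]
  have h1 := Real.cosh_sq a
  have h2 := Real.sin_sq_add_cos_sq b
  have hca := Real.cosh_pos a
  have hsa : 0 ≤ Real.sinh a := Real.sinh_nonneg_iff.2 (by linarith)
  set N := Real.sinh a ^ 2 + Real.sin b ^ 2 with hN
  have hN0 : 0 < N := by
    rcases hx.eq_or_lt with h | h
    · have : Real.sin b ≠ 0 := by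
        intro h0
        obtain ⟨n, hn'⟩ := Real.sin_eq_zero_iff.1 h0
        apply hn n
        apply Complex.ext
        · simp [← h]
        · simp [him, ← hn']; ring
      positivity
    · have : 0 < Real.sinh a := Real.sinh_pos_iff.2 (by linarith)
      positivity
  have hden : Real.cosh t.re - Real.cos t.im = 2 * N := by
    rw [hre, him, Real.cosh_two_mul, Real.cos_two_mul]
    linear_combination h1 - 2 * h2
  have hnum : Real.sinh t.re = 2 * Real.sinh a * Real.cosh a := by rw [hre, Real.sinh_two_mul]
  have hα : alphaT t = Real.sinh a * Real.cosh a / N := by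
    rw [alphaT, hden, hnum]
    field_simp
  have hβ : betaT t = Real.cos b / Real.cosh a := rfl
  have hns : Complex.normSq (Complex.sinh (t / 2)) = N := by
    rw [hs, Complex.normSq_mk]
    linear_combination Real.sin b ^ 2 * h1 + Real.sinh a ^ 2 * h2
  refine ⟨?_, ?_, ?_⟩
  · rw [hα]; positivity
  · rw [Complex.div_re, hns, hs, hc, hα]
    simp only
    field_simp
    linear_combination Real.sinh a * h2
  · rw [Complex.div_re, hns, hs, hα, hβ]
    simp only [Complex.one_re, Complex.one_im]
    field_simp
    ring

/-- For `ν ≥ -1/2`, there is a constant `C > 0` such that for all `r, r' > 0`,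
all real `y` with `|y| ≤ 4√(r r')`, and all `t ∈ Ω`,
`|e^{-2(r+r')·coth(t/2)} · Ĩ_ν(y/sinh(t/2))| ≤ C·e^{-2α(t)(1-|β(t)|)(r+r')}`. -/
theorem kernel_estimate (ν : ℝ) (hν : -1/2 ≤ ν) :
    ∃ C : ℝ, 0 < C ∧ ∀ r r' : ℝ, 0 < r → 0 < r' → ∀ y : ℝ,
      |y| ≤ 4 * Real.sqrt (r * r') → ∀ t : ℂ, InOmega t →
      ‖Complex.exp (-2 * (r + r') * (Complex.cosh (t/2) / Complex.sinh (t/2))) *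
          ItildeC ν ((y : ℂ) / Complex.sinh (t/2))‖ ≤
        C * Real.exp (-2 * alphaT t * (1 - |betaT t|) * (r + r')) := by
  obtain ⟨C, hC⟩ := bound_all ν hν
  refine ⟨max C 1, by positivity, fun r r' hr hr' y hy t ht => ?_⟩
  obtain ⟨hα, h1, h2⟩ := trig t ht
  have hsq : 4 * Real.sqrt (r * r') ≤ 2 * (r + r') := by
    have : Real.sqrt (r * r') ≤ (r + r') / 2 := by
      apply Real.sqrt_le_iff.2
      constructor
      · positivity
      · nlinarith [sq_nonneg (r - r')]
    linarith
  have hz : |((y : ℂ) / Complex.sinh (t / 2)).re| ≤ 2 * (r + r') * (alphaT t * |betaT t|) := by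
    rw [div_eq_mul_one_div, Complex.re_ofReal_mul, h2, abs_mul, abs_mul, abs_of_nonneg hα]
    gcongr
    exact hy.trans hsq
  have he : (-2 * ((r : ℂ) + r') * (Complex.cosh (t / 2) / Complex.sinh (t / 2))).re =
      -2 * (r + r') * alphaT t := by
    have : (-2 * ((r : ℂ) + r')) = ((-2 * (r + r') : ℝ) : ℂ) := by push_cast; ring
    rw [this, Complex.re_ofReal_mul, h1]
  rw [norm_mul, Complex.norm_exp, he]
  calc _ ≤ Real.exp (-2 * (r + r') * alphaT t) *
        (max C 1 * Real.exp (2 * (r + r') * (alphaT t * |betaT t|))) := by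
        gcongr
        refine (hC _).trans ?_
        gcongr
        exact le_max_left _ _
    _ = max C 1 * Real.exp (-2 * alphaT t * (1 - |betaT t|) * (r + r')) := by
        rw [mul_left_comm, ← Real.exp_add]
        congr 2
        ring
end

section
/- Let m ≥ 2 and l ≥ 0 be integers. (1) There exists a constant C > 0 such that |K_l⁺(r,r';t)| ≤ C·(r r')^l·e^{-2α(t)(1-|β(t)|)(r+r')} / |sinh(t/2)|^{m-1+2l} for all r, r' > 0 and all t ∈ Ω. (2) If Re t > 0, then ∫_0^∞∫_0^∞ |K_l⁺(r,r';t)|² (r r')^{m-2} dr dr' < ∞. -/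
open MeasureTheory

/-- The radial kernel
`K_l⁺(r,r';t) = 2^{m-1+2l}·e^{-2(r+r')coth(t/2)}·(rr')^l·Ĩ_{m-2+2l}(4√(rr')/sinh(t/2))/sinh(t/2)^{m-1+2l}`. -/
noncomputable def Kl (m l : ℕ) (t : ℂ) (r r' : ℝ) : ℂ :=
  2 ^ (m - 1 + 2 * l) *
    Complex.exp (-2 * (r + r') * (Complex.cosh (t/2) / Complex.sinh (t/2))) *
    ((r * r' : ℝ) : ℂ) ^ l *
    ItildeC ((m : ℝ) - 2 + 2 * l) ((4 * Real.sqrt (r * r') : ℝ) / Complex.sinh (t/2)) /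
    (Complex.sinh (t/2)) ^ (m - 1 + 2 * l)

lemma cd_re (t : ℂ) : (Complex.cosh (t/2) / Complex.sinh (t/2)).re = alphaT t ∧
   (1 / Complex.sinh (t/2)).re = alphaT t * betaT t := by
  have hre : (Complex.sinh (t/2)).re = Real.sinh (t.re/2) * Real.cos (t.im/2) := by
    rw [show t/2 = ((t.re/2 : ℝ):ℂ) + ((t.im/2 : ℝ):ℂ) * Complex.I by
      apply Complex.ext <;> simp]
    rw [Complex.sinh_add, Complex.cosh_mul_I, Complex.sinh_mul_I]
    simp [← Complex.ofReal_sinh, ← Complex.ofReal_cosh, ← Complex.ofReal_sin, ← Complex.ofReal_cos, -Complex.ofReal_div]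
  have him : (Complex.sinh (t/2)).im = Real.cosh (t.re/2) * Real.sin (t.im/2) := by
    rw [show t/2 = ((t.re/2 : ℝ):ℂ) + ((t.im/2 : ℝ):ℂ) * Complex.I by
      apply Complex.ext <;> simp]
    rw [Complex.sinh_add, Complex.cosh_mul_I, Complex.sinh_mul_I]
    simp [← Complex.ofReal_sinh, ← Complex.ofReal_cosh, ← Complex.ofReal_sin, ← Complex.ofReal_cos, -Complex.ofReal_div]
  have cre : (Complex.cosh (t/2)).re = Real.cosh (t.re/2) * Real.cos (t.im/2) := by
    rw [show t/2 = ((t.re/2 : ℝ):ℂ) + ((t.im/2 : ℝ):ℂ) * Complex.I by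
      apply Complex.ext <;> simp]
    rw [Complex.cosh_add, Complex.cosh_mul_I, Complex.sinh_mul_I]
    simp [← Complex.ofReal_sinh, ← Complex.ofReal_cosh, ← Complex.ofReal_sin, ← Complex.ofReal_cos, -Complex.ofReal_div]
  have cim : (Complex.cosh (t/2)).im = Real.sinh (t.re/2) * Real.sin (t.im/2) := by
    rw [show t/2 = ((t.re/2 : ℝ):ℂ) + ((t.im/2 : ℝ):ℂ) * Complex.I by
      apply Complex.ext <;> simp]
    rw [Complex.cosh_add, Complex.cosh_mul_I, Complex.sinh_mul_I]
    simp [← Complex.ofReal_sinh, ← Complex.ofReal_cosh, ← Complex.ofReal_sin, ← Complex.ofReal_cos, -Complex.ofReal_div]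
  have h1 : Real.sinh t.re = 2 * Real.sinh (t.re/2) * Real.cosh (t.re/2) := by
    rw [← Real.sinh_two_mul]; ring_nf
  have h2 : Real.cosh t.re = Real.cosh (t.re/2)^2 + Real.sinh (t.re/2)^2 := by
    rw [← Real.cosh_two_mul]; ring_nf
  have h3 : Real.cos t.im = 2 * Real.cos (t.im/2)^2 - 1 := by
    rw [← Real.cos_two_mul]; ring_nf
  have h4 := Real.cosh_sq (t.re/2)
  have h5 := Real.sin_sq_add_cos_sq (t.im/2)
  have hN : Complex.normSq (Complex.sinh (t/2)) = (Real.cosh t.re - Real.cos t.im) / 2 := by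
    rw [Complex.normSq_apply, hre, him, h2, h3]
    have h5' : Real.sin (t.im/2)^2 = 1 - Real.cos (t.im/2)^2 := by linarith
    ring_nf
    ring_nf at h5' h4
    rw [h5', h4]
    ring
  have hc := (Real.cosh_pos (t.re/2)).ne'
  unfold alphaT betaT
  constructor
  · rw [Complex.div_re, hN, hre, him, cre, cim, h1, ← add_div]
    rw [show Real.cosh (t.re / 2) * Real.cos (t.im / 2) * (Real.sinh (t.re / 2) * Real.cos (t.im / 2)) +
      Real.sinh (t.re / 2) * Real.sin (t.im / 2) * (Real.cosh (t.re / 2) * Real.sin (t.im / 2)) =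
      Real.cosh (t.re / 2) * Real.sinh (t.re / 2) * (Real.sin (t.im/2)^2 + Real.cos (t.im/2)^2) by ring, h5]
    rw [div_div_eq_mul_div]; ring
  · rw [Complex.div_re, hN, hre, h1]
    simp only [Complex.one_re, Complex.one_im, zero_mul, zero_div, add_zero, one_mul]
    rw [div_div_eq_mul_div]; field_simp

lemma cosh_bd (z : ℂ) : ‖Complex.cosh z‖ ≤ 1 * Real.exp |z.re| := by
  rw [Complex.cosh, norm_div]
  have := norm_add_le (Complex.exp z) (Complex.exp (-z))
  rw [Complex.norm_exp, Complex.norm_exp] at this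
  have h1 : Real.exp z.re ≤ Real.exp |z.re| := Real.exp_le_exp.2 (le_abs_self _)
  have h2 : Real.exp (-z).re ≤ Real.exp |z.re| := Real.exp_le_exp.2 (by simpa using neg_le_abs _)
  simp only [Complex.norm_ofNat]
  linarith

lemma step (c : ℕ → ℝ) (hc : ∀ R : ℝ, Summable fun k => |c k| * R ^ (2*k)) (C : ℝ) (hC : 0 ≤ C)
    (hF : ∀ z : ℂ, ‖∑' k, (c k : ℂ) * z ^ (2*k)‖ ≤ C * Real.exp |z.re|)
    (f w : ℝ → ℝ) (hf : Continuous f) (hw : Continuous w) (b : ℝ) (hb : 0 ≤ b)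
    (hf1 : ∀ s ∈ Set.Icc 0 b, |f s| ≤ 1) (W : ℝ) (hW : 0 ≤ W) (hw1 : ∀ s ∈ Set.Icc 0 b, |w s| ≤ W) (z : ℂ) :
    ‖∑' k, ((c k * ∫ s in (0:ℝ)..b, w s * f s ^ (2*k) : ℝ) : ℂ) * z ^ (2*k)‖ ≤
      (W * C * b) * Real.exp |z.re| := by
  have key : HasSum (fun k => ∫ s in (0:ℝ)..b, (w s : ℂ) * ((c k : ℂ) * (z * f s) ^ (2*k)))
      (∫ s in (0:ℝ)..b, (w s : ℂ) * ∑' k, (c k : ℂ) * (z * f s) ^ (2*k)) := by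
    apply intervalIntegral.hasSum_integral_of_dominated_convergence
      (fun k _ => W * (|c k| * ‖z‖ ^ (2*k)))
    · intro k
      apply Continuous.aestronglyMeasurable
      fun_prop
    · intro k
      refine .of_forall fun s hs => ?_
      rw [Set.uIoc_of_le hb] at hs
      have hs' := Set.Ioc_subset_Icc_self hs
      rw [norm_mul, norm_mul, norm_pow, norm_mul]
      simp only [Complex.norm_real, Real.norm_eq_abs]
      have := hf1 s hs'
      have := hw1 s hs'
      gcongr
      exact mul_le_of_le_one_right (norm_nonneg _) (hf1 s hs')
    · exact .of_forall fun s _ => (hc _).mul_left _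
    · simp
    · refine .of_forall fun s hs => ?_
      apply HasSum.mul_left
      apply Summable.hasSum
      apply Summable.of_norm
      simpa [norm_mul, mul_pow] using hc (‖z‖ * |f s|)
  have e : (fun k => ∫ s in (0:ℝ)..b, (w s : ℂ) * ((c k : ℂ) * (z * f s) ^ (2*k))) =
     fun k => ((c k * ∫ s in (0:ℝ)..b, w s * f s ^ (2*k) : ℝ) : ℂ) * z ^ (2*k) := by
    ext k
    push_cast
    rw [← intervalIntegral.integral_ofReal, ← intervalIntegral.integral_const_mul,
      ← intervalIntegral.integral_mul_const]
    congr 1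
    ext s
    push_cast
    ring
  rw [← e, key.tsum_eq]
  have := intervalIntegral.norm_integral_le_of_norm_le_const (a := 0) (b := b)
    (f := fun s => (w s : ℂ) * ∑' k, (c k : ℂ) * (z * f s) ^ (2*k)) (C := W * (C * Real.exp |z.re|)) ?_
  · rw [sub_zero, abs_of_nonneg hb] at this
    linarith
  · intro s hs
    rw [Set.uIoc_of_le hb] at hs
    have hs' := Set.Ioc_subset_Icc_self hs
    rw [norm_mul, Complex.norm_real, Real.norm_eq_abs]
    refine mul_le_mul (hw1 s hs') ((hF _).trans ?_) (norm_nonneg _) hW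
    apply mul_le_mul_of_nonneg_left _ hC
    apply Real.exp_le_exp.2
    rw [Complex.re_mul_ofReal, abs_mul]
    exact mul_le_of_le_one_right (abs_nonneg _) (hf1 s hs')

noncomputable def bc (n k : ℕ) : ℝ := 1 / (4^k * (Nat.factorial k) * (Nat.factorial (n+k)))

lemma bc_sum (n : ℕ) (R : ℝ) : Summable fun k => |bc n k| * R ^ (2*k) := by
  have h := Real.summable_pow_div_factorial (R^2)
  refine Summable.of_nonneg_of_le (fun k => ?_) (fun k => ?_) h
  · rw [pow_mul]; positivity
  · have h0 : 0 ≤ bc n k := by unfold bc; positivity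
    rw [abs_of_nonneg h0, pow_mul, bc, one_div_mul_eq_div]
    apply div_le_div_of_nonneg_left (by positivity) (by positivity)
    have h1 : (1:ℝ) ≤ 4^k := one_le_pow₀ (by norm_num)
    have h2 : (1:ℝ) ≤ (Nat.factorial (n+k)) := by exact_mod_cast Nat.factorial_pos _
    have h3 : (0:ℝ) ≤ (Nat.factorial k) := by positivity
    calc (Nat.factorial k : ℝ) = 1 * Nat.factorial k * 1 := by ring
      _ ≤ _ := by gcongr

lemma bc_bd (n : ℕ) : ∃ C : ℝ, 0 < C ∧ ∀ z : ℂ,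
    ‖∑' k, (bc n k : ℂ) * z ^ (2*k)‖ ≤ C * Real.exp |z.re| := by
  induction n with
  | zero =>
    refine ⟨Real.pi⁻¹ * 1 * Real.pi, by positivity, fun z => ?_⟩
    have := step (fun k => 1 / (Nat.factorial (2*k))) ?_ 1 zero_le_one ?_ Real.sin (fun _ => Real.pi⁻¹)
      Real.continuous_sin continuous_const Real.pi Real.pi_pos.le (fun s _ => Real.abs_sin_le_one s)
      Real.pi⁻¹ (by positivity) (fun s _ => by rw [abs_of_pos]; positivity) z
    · convert this using 6 with k
      rw [intervalIntegral.integral_const_mul, integral_sin_pow_even, inv_mul_cancel_left₀ Real.pi_ne_zero]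
      unfold bc
      induction k with
      | zero => simp
      | succ k ih =>
        rw [Finset.prod_range_succ]
        have e1 : 2 * (k+1) = 2 * k + 1 + 1 := by ring
        rw [e1]
        simp only [zero_add] at ih ⊢
        simp only [Nat.factorial_succ]
        push_cast
        have : ∏ i ∈ Finset.range k, (2 * (i:ℝ) + 1) / (2 * i + 2) =
          (Nat.factorial (2*k)) * (1 / (4^k * (Nat.factorial k) * (Nat.factorial k))) := by
          rw [ih]; field_simp
        rw [this]
        field_simp
        ring
    · intro R
      convert (Real.hasSum_cosh R).summable using 2 with k
      rw [abs_of_nonneg (by positivity)]; ring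
    · intro z
      convert cosh_bd z using 2
      rw [← (Complex.hasSum_cosh z).tsum_eq]
      congr 1; ext k; push_cast; ring
  | succ n ih =>
    obtain ⟨C, hC, h⟩ := ih
    refine ⟨2 * C * 1, by positivity, fun z => ?_⟩
    have := step (bc n) (bc_sum n) C hC.le h id (fun s => 2 * s^(2*n+1))
      continuous_id (by fun_prop) 1 zero_le_one (fun s hs => by simpa [abs_of_nonneg hs.1] using hs.2)
      2 (by norm_num) (fun s hs => by
        rw [abs_of_nonneg (mul_nonneg two_pos.le (pow_nonneg hs.1 _))]
        have := pow_le_one₀ (n := 2*n+1) hs.1 hs.2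
        linarith) z
    convert this using 6 with k
    have : ∀ s : ℝ, 2 * s^(2*n+1) * id s ^(2*k) = 2 * s^(2*n+1+2*k) := fun s => by
      simp only [id]; ring
    simp only [this]
    rw [intervalIntegral.integral_const_mul, integral_pow]
    unfold bc
    rw [show n+1+k = (n+k)+1 by ring, Nat.factorial_succ]
    push_cast
    simp only [one_pow, ne_eq, Nat.add_eq_zero_iff, one_ne_zero, and_false, not_false_eq_true, zero_pow, sub_zero]
    field_simp
    ring

lemma It_bd (n : ℕ) : ∃ C : ℝ, 0 < C ∧ ∀ z : ℂ, ‖ItildeC (n:ℝ) z‖ ≤ C * Real.exp |z.re| := by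
  obtain ⟨C, hC, h⟩ := bc_bd n
  refine ⟨C, hC, fun z => ?_⟩
  convert h z using 2
  unfold ItildeC bc
  congr 1; ext k
  rw [show ((n:ℝ):ℂ) + k + 1 = ((n+k : ℕ):ℂ) + 1 by push_cast; ring, Complex.Gamma_nat_eq_factorial]
  rw [div_pow, pow_mul 2 2 k]
  push_cast
  field_simp
  norm_num

lemma part1 (m l : ℕ) (hm : 2 ≤ m) :
    (∃ C : ℝ, 0 < C ∧ ∀ r r' : ℝ, 0 < r → 0 < r' → ∀ t : ℂ, 0 ≤ t.re →
      ‖Kl m l t r r'‖ ≤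
        C * (r * r') ^ l * Real.exp (-2 * alphaT t * (1 - |betaT t|) * (r + r')) /
          ‖Complex.sinh (t/2)‖ ^ (m - 1 + 2 * l)) := by
  obtain ⟨C, hC, h⟩ := It_bd (m - 2 + 2 * l)
  refine ⟨2 ^ (m-1+2*l) * C, by positivity, fun r r' hr hr' t ht => ?_⟩
  have ha : 0 ≤ alphaT t := by
    unfold alphaT
    apply div_nonneg (Real.sinh_nonneg_iff.2 ht)
    have := Real.one_le_cosh t.re
    have := Real.cos_le_one t.im
    linarith
  unfold Kl
  rw [norm_div, norm_pow]
  gcongr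
  rw [norm_mul, norm_mul, norm_mul, norm_pow, norm_pow, Complex.norm_exp, Complex.norm_real,
    Complex.norm_ofNat, Real.norm_eq_abs, abs_of_pos (mul_pos hr hr')]
  have e : ((m:ℝ) - 2 + 2 * l) = ((m - 2 + 2 * l : ℕ) : ℝ) := by
    push_cast [Nat.cast_sub hm]; ring
  rw [e]
  have hz := h ((4 * Real.sqrt (r * r') : ℝ) / Complex.sinh (t/2))
  have hzr : (((4 * Real.sqrt (r * r') : ℝ) : ℂ) / Complex.sinh (t/2)).re =
      4 * Real.sqrt (r * r') * (alphaT t * betaT t) := by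
    rw [← (cd_re t).2, ← Complex.re_ofReal_mul, mul_one_div]
  have her : (-2 * ((r:ℂ) + r') * (Complex.cosh (t/2) / Complex.sinh (t/2))).re =
      -2 * (r + r') * alphaT t := by
    rw [← (cd_re t).1, ← Complex.re_ofReal_mul]; push_cast; rfl
  rw [hzr] at hz
  rw [her]
  have hs : 2 * Real.sqrt (r * r') ≤ r + r' := by
    rw [Real.sqrt_mul hr.le]
    nlinarith [sq_nonneg (Real.sqrt r - Real.sqrt r'), Real.sq_sqrt hr.le, Real.sq_sqrt hr'.le]
  have hexp : -2 * (r + r') * alphaT t + |4 * Real.sqrt (r * r') * (alphaT t * betaT t)| ≤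
      -2 * alphaT t * (1 - |betaT t|) * (r + r') := by
    rw [abs_mul, abs_mul (alphaT t), abs_of_nonneg ha, abs_of_nonneg (by positivity : 0 ≤ 4 * Real.sqrt (r * r'))]
    nlinarith [mul_le_mul_of_nonneg_right hs (mul_nonneg ha (abs_nonneg (betaT t)))]
  calc _ ≤ 2 ^ (m-1+2*l) * Real.exp (-2 * (r + r') * alphaT t) * (r*r')^l *
        (C * Real.exp |4 * Real.sqrt (r * r') * (alphaT t * betaT t)|) := by gcongr
    _ = 2 ^ (m-1+2*l) * C * (r*r')^l * Real.exp (-2 * (r + r') * alphaT t + |4 * Real.sqrt (r * r') * (alphaT t * betaT t)|) := by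
        rw [Real.exp_add]; ring
    _ ≤ _ := by gcongr

/-- Upper estimate and square-integrability of the radial kernel `K_l⁺`. -/
theorem Kl_bound_and_sq_integrable (m l : ℕ) (hm : 2 ≤ m) :
    (∃ C : ℝ, 0 < C ∧ ∀ r r' : ℝ, 0 < r → 0 < r' → ∀ t : ℂ, InOmega t →
      ‖Kl m l t r r'‖ ≤
        C * (r * r') ^ l * Real.exp (-2 * alphaT t * (1 - |betaT t|) * (r + r')) /
          ‖Complex.sinh (t/2)‖ ^ (m - 1 + 2 * l)) ∧
    (∀ t : ℂ, 0 < t.re →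
      ∫⁻ r in Set.Ioi (0:ℝ), ∫⁻ r' in Set.Ioi (0:ℝ),
        ENNReal.ofReal (‖Kl m l t r r'‖ ^ 2 * (r * r') ^ (m - 2)) < ⊤) := by
  obtain ⟨C, hC, h⟩ := part1 m l hm
  refine ⟨⟨C, hC, fun r r' hr hr' t ht => h r r' hr hr' t ht.1⟩, fun t ht => ?_⟩
  have ha : 0 < alphaT t := by
    unfold alphaT
    apply div_pos (Real.sinh_pos_iff.2 ht)
    have := Real.one_lt_cosh.2 ht.ne'
    have := Real.cos_le_one t.im
    linarith
  have hb : |betaT t| < 1 := by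
    unfold betaT
    rw [abs_div, abs_of_pos (Real.cosh_pos _), div_lt_one (Real.cosh_pos _)]
    exact (Real.abs_cos_le_one _).trans_lt (Real.one_lt_cosh.2 (by positivity))
  set a := 4 * alphaT t * (1 - |betaT t|) with had
  have hapos : 0 < a := mul_pos (by positivity) (by linarith)
  set N := 2 * l + (m - 2) with hN
  set g : ℝ → ℝ := fun r => r ^ N * Real.exp (-a * r) with hg
  set D : ℝ := (C / ‖Complex.sinh (t/2)‖ ^ (m - 1 + 2 * l))^2 with hD
  have hDn : 0 ≤ D := sq_nonneg _
  have hgi : ∫⁻ r in Set.Ioi (0:ℝ), ENNReal.ofReal (g r) < ⊤ := by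
    have : IntegrableOn g (Set.Ioi 0) := by
      have := integrableOn_rpow_mul_exp_neg_mul_rpow (s := N) (p := 1) (b := a)
        (by linarith [Nat.cast_nonneg (α := ℝ) N]) one_pos hapos
      simpa [hg] using this
    exact this.lintegral_lt_top
  have hpt : ∀ r ∈ Set.Ioi (0:ℝ), ∀ r' ∈ Set.Ioi (0:ℝ),
      ENNReal.ofReal (‖Kl m l t r r'‖ ^ 2 * (r * r') ^ (m - 2)) ≤
      ENNReal.ofReal (D * g r) * ENNReal.ofReal (g r') := by
    intro r hr r' hr'
    simp only [Set.mem_Ioi] at hr hr'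
    rw [← ENNReal.ofReal_mul (by positivity)]
    apply ENNReal.ofReal_le_ofReal
    have hk := h r r' hr hr' t ht.le
    calc _ ≤ (C * (r * r') ^ l * Real.exp (-2 * alphaT t * (1 - |betaT t|) * (r + r')) /
          ‖Complex.sinh (t/2)‖ ^ (m - 1 + 2 * l))^2 * (r * r') ^ (m - 2) := by gcongr
      _ = D * g r * g r' := by
        have : Real.exp (-2 * alphaT t * (1 - |betaT t|) * (r + r'))^2 =
          Real.exp (-a * r) * Real.exp (-a * r') := by
          rw [← Real.exp_nat_mul, ← Real.exp_add]; congr 1; rw [had]; push_cast; ring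
        rw [div_pow, mul_pow, this]
        simp only [hD, hg, hN]
        rw [div_pow]
        ring
  calc _ ≤ ∫⁻ r in Set.Ioi (0:ℝ), ∫⁻ r' in Set.Ioi (0:ℝ), ENNReal.ofReal (D * g r) * ENNReal.ofReal (g r') := by
        apply setLIntegral_mono' measurableSet_Ioi
        intro r hr
        exact setLIntegral_mono' measurableSet_Ioi (hpt r hr)
    _ = ENNReal.ofReal D * (∫⁻ r in Set.Ioi (0:ℝ), ENNReal.ofReal (g r)) * ∫⁻ r in Set.Ioi (0:ℝ), ENNReal.ofReal (g r) := by
        simp_rw [lintegral_const_mul' _ _ ENNReal.ofReal_ne_top]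
        rw [lintegral_mul_const' _ _ hgi.ne]
        simp_rw [ENNReal.ofReal_mul hDn]
        rw [lintegral_const_mul' _ _ ENNReal.ofReal_ne_top]
    _ < ⊤ := ENNReal.mul_lt_top (ENNReal.mul_lt_top ENNReal.ofReal_lt_top hgi) hgi
end

section
/- Let m ≥ 2 and 0 ≤ l ≤ a be integers, and let t ∈ Ω. Then for every r > 0 the integral ∫_0^∞ K_l⁺(r,r';t)·f_{a,l}(r')·r'^{m-2} dr' converges absolutely, and it equals e^{-(a+(m-1)/2)t}·f_{a,l}(r). -/
open MeasureTheory

/-- The Laguerre polynomial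
`L_n^α(x) = Σ_{k=0}^n (-1)^k (Γ(n+α+1)/(Γ(k+α+1)(n-k)! k!)) x^k`. -/
noncomputable def laguerre (n : ℕ) (α : ℝ) (x : ℝ) : ℝ :=
  ∑ k ∈ Finset.range (n + 1),
    (-1 : ℝ) ^ k *
      (Real.Gamma (n + α + 1) /
        (Real.Gamma (k + α + 1) * (Nat.factorial (n - k)) * (Nat.factorial k))) * x ^ k

/-- `f_{a,l}(r) = L_{a-l}^{m-2+2l}(4r)·r^l·e^{-2r}`. -/
noncomputable def fal (m l a : ℕ) (r : ℝ) : ℝ :=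
  laguerre (a - l) ((m : ℝ) - 2 + 2 * l) (4 * r) * r ^ l * Real.exp (-2 * r)

lemma aux_int_pow (p : ℂ) (hp : 0 < p.re) (n : ℕ) :
    IntegrableOn (fun x : ℝ => (x : ℂ) ^ n * Complex.exp (-p * x)) (Set.Ioi 0) := by
  have h := integrableOn_rpow_mul_exp_neg_mul_rpow (p := 1) (s := n) (b := p.re)
    (by have : (0:ℝ) ≤ n := n.cast_nonneg
        linarith) one_pos hp
  refine (integrable_norm_iff ?_).1 ?_
  · exact (by fun_prop : Continuous fun x : ℝ => (x : ℂ) ^ n * Complex.exp (-p * x)).aestronglyMeasurable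
  · refine IntegrableOn.congr_fun h ?_ measurableSet_Ioi
    intro x hx
    have hx : 0 < x := hx
    simp [Complex.norm_exp, abs_of_pos hx]

lemma aux_norm_pow (p : ℂ) (n : ℕ) (x : ℝ) (hx : 0 < x) :
    ‖(x : ℂ) ^ n * Complex.exp (-p * x)‖ = x ^ n * Real.exp (-p.re * x) := by
  simp [Complex.norm_exp, abs_of_pos hx]

lemma aux_integral_pow (p : ℂ) (hp : 0 < p.re) (n : ℕ) :
    ∫ x in Set.Ioi (0:ℝ), (x : ℂ) ^ n * Complex.exp (-p * x) = (n.factorial : ℂ) / p ^ (n + 1) := by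
  have hp0 : p ≠ 0 := by rintro rfl; simp at hp
  induction n with
  | zero =>
    have := integral_exp_mul_complex_Ioi (a := -p) (by simpa using hp) 0
    simpa using this
  | succ n ih =>
    have hd : ∀ x ∈ Set.Ici (0:ℝ), HasDerivAt (fun x : ℝ => -((x : ℂ) ^ (n+1) * Complex.exp (-p * x)) / p)
        ((x : ℂ) ^ (n+1) * Complex.exp (-p * x) - ((n + 1 : ℂ) / p) * ((x : ℂ) ^ n * Complex.exp (-p * x))) x := by
      intro x _
      have h1 : HasDerivAt (fun z : ℂ => -(z ^ (n+1) * Complex.exp (-p * z)) / p)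
        ((x : ℂ) ^ (n+1) * Complex.exp (-p * x) - ((n + 1 : ℂ) / p) * ((x : ℂ) ^ n * Complex.exp (-p * x))) (x : ℂ) := by
        have h2 := (((hasDerivAt_pow (n+1) (x:ℂ)).mul
          (((hasDerivAt_id (x:ℂ)).const_mul (-p)).cexp)).neg).div_const p
        refine h2.congr_deriv ?_
        simp
        field_simp
        ring
      exact h1.comp_ofReal
    have hi : IntegrableOn (fun x : ℝ => (x : ℂ) ^ (n+1) * Complex.exp (-p * x) - ((n + 1 : ℂ) / p) * ((x : ℂ) ^ n * Complex.exp (-p * x))) (Set.Ioi 0) :=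
      (aux_int_pow p hp (n+1)).sub ((aux_int_pow p hp n).const_mul _)
    have ht : Filter.Tendsto (fun x : ℝ => -((x : ℂ) ^ (n+1) * Complex.exp (-p * x)) / p) Filter.atTop (nhds 0) := by
      have h0 : Filter.Tendsto (fun x : ℝ => (x : ℂ) ^ (n+1) * Complex.exp (-p * x)) Filter.atTop (nhds 0) := by
        rw [tendsto_zero_iff_norm_tendsto_zero]
        have := tendsto_rpow_mul_exp_neg_mul_atTop_nhds_zero ((n+1 : ℕ) : ℝ) p.re hp
        refine this.congr' ?_
        filter_upwards [Filter.eventually_gt_atTop 0] with x hx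
        rw [aux_norm_pow p _ x hx, Real.rpow_natCast]
      simpa using h0.neg.div_const p
    have := integral_Ioi_of_hasDerivAt_of_tendsto' hd hi ht
    rw [integral_sub (aux_int_pow p hp (n+1)) ((aux_int_pow p hp n).const_mul _), integral_const_mul, ih] at this
    have h3 := sub_eq_iff_eq_add.1 this
    rw [h3]
    simp [Nat.factorial_succ]
    field_simp
    ring

lemma aux_integrable_tsum {μ : Measure ℝ} {F : ℕ → ℝ → ℂ} (hF : ∀ i, Integrable (F i) μ)
    (hs : Summable fun i => ∫ a, ‖F i a‖ ∂μ) (hp : ∀ᵐ x ∂μ, Summable fun i => F i x) :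
    Integrable (fun x => ∑' i, F i x) μ := by
  refine ⟨?_, ?_⟩
  · refine aestronglyMeasurable_of_tendsto_ae Filter.atTop
      (f := fun n x => ∑ i ∈ Finset.range n, F i x) ?_ ?_
    · intro n
      exact Finset.aestronglyMeasurable_fun_sum _ (fun i _ => (hF i).1)
    · filter_upwards [hp] with x hx
      exact hx.hasSum.tendsto_sum_nat
  · rw [hasFiniteIntegral_iff_enorm]
    calc ∫⁻ x, ‖∑' i, F i x‖ₑ ∂μ ≤ ∫⁻ x, ∑' i, ‖F i x‖ₑ ∂μ :=
          lintegral_mono (fun x => enorm_tsum_le_tsum_enorm)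
      _ = ∑' i, ∫⁻ x, ‖F i x‖ₑ ∂μ := lintegral_tsum (fun i => (hF i).1.enorm)
      _ = ∑' i, ENNReal.ofReal (∫ x, ‖F i x‖ ∂μ) := by
          congr 1; ext i; rw [ofReal_integral_norm_eq_lintegral_enorm (hF i)]
      _ = ENNReal.ofReal (∑' i, ∫ x, ‖F i x‖ ∂μ) := by
          rw [ENNReal.ofReal_tsum_of_nonneg (fun i => integral_nonneg (fun _ => norm_nonneg _)) hs]
      _ < ⊤ := ENNReal.ofReal_lt_top

lemma aux_hasSum_choose (y : ℂ) (i : ℕ) :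
    HasSum (fun k : ℕ => (k.choose i : ℂ) * (y ^ k / (k.factorial : ℂ)))
      (y ^ i / (i.factorial : ℂ) * Complex.exp y) := by
  have h := (NormedSpace.expSeries_div_hasSum_exp (𝔸 := ℂ) y).mul_left (y ^ i / (i.factorial : ℂ))
  rw [← Complex.exp_eq_exp_ℂ] at h
  have hinj : Function.Injective (fun k : ℕ => k + i) := add_left_injective i
  rw [← hinj.hasSum_iff]
  · refine h.congr_fun ?_ |> fun h => h
    intro k
    simp only [Function.comp]
    have := Nat.add_choose_mul_factorial_mul_factorial k i
    have h2 : (((k+i).choose i : ℕ) : ℂ) * i.factorial * k.factorial = (k+i).factorial := by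
      rw [← this]; push_cast; ring
    have a1 : (i.factorial : ℂ) ≠ 0 := by exact_mod_cast i.factorial_ne_zero
    have a2 : (k.factorial : ℂ) ≠ 0 := by exact_mod_cast k.factorial_ne_zero
    have a3 : ((k+i).factorial : ℂ) ≠ 0 := by exact_mod_cast (k+i).factorial_ne_zero
    field_simp
    rw [← h2]; ring
  · intro x hx
    have : x < i := by
      by_contra hc
      exact hx ⟨x - i, by simp; omega⟩
    simp [Nat.choose_eq_zero_of_lt this]

lemma aux_vander (N j k : ℕ) :
    (N + j + k).factorial = (N + k).factorial * (j.factorial *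
      ∑ i ∈ Finset.range (j+1), k.choose i * (N + j).choose (N + i)) := by
  have h := Nat.add_choose_eq k (N + j) j
  rw [Finset.Nat.sum_antidiagonal_eq_sum_range_succ_mk] at h
  have h2 : ∑ i ∈ Finset.range (j+1), k.choose i * (N + j).choose (N + i) = (k + (N+j)).choose j := by
    rw [h]
    refine Finset.sum_congr rfl fun i hi => ?_
    have : i ≤ j := by simpa [Nat.lt_succ_iff] using hi
    simp only
    congr 1
    rw [← Nat.choose_symm (by omega)]
    congr 1; omega
  rw [h2]
  have h3 := Nat.add_choose_mul_factorial_mul_factorial (N + k) j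
  rw [show N + j + k = N + k + j by ring, show k + (N+j) = N + k + j by ring, ← h3]; ring

noncomputable def auxS (N j : ℕ) (y : ℂ) : ℂ :=
  (j.factorial : ℂ) * (Complex.exp y * ∑ i ∈ Finset.range (j+1), y ^ i / (i.factorial : ℂ) * ((N + j).choose (N + i) : ℂ))

lemma aux_hasSum (N j : ℕ) (y : ℂ) :
    HasSum (fun k : ℕ => ((N + j + k).factorial : ℂ) / ((k.factorial : ℂ) * (N+k).factorial) * y ^ k)
      (auxS N j y) := by
  have h := (hasSum_sum (s := Finset.range (j+1)) (fun i _ =>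
    (aux_hasSum_choose y i).mul_right ((N + j).choose (N + i) : ℂ))).mul_left (j.factorial : ℂ)
  have e : auxS N j y = (j.factorial : ℂ) * ∑ i ∈ Finset.range (j+1), y ^ i / (i.factorial : ℂ) * Complex.exp y * ((N + j).choose (N + i) : ℂ) := by
    unfold auxS
    rw [Finset.mul_sum]
    congr 1
    exact Finset.sum_congr rfl fun i _ => by ring
  rw [e]
  refine h.congr_fun ?_ |> fun h => h
  intro k
  rw [aux_vander]
  have a2 : (k.factorial : ℂ) ≠ 0 := by exact_mod_cast k.factorial_ne_zero
  have a3 : ((N+k).factorial : ℂ) ≠ 0 := by exact_mod_cast (N+k).factorial_ne_zero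
  push_cast
  simp only [Finset.mul_sum, Finset.sum_mul, Finset.sum_div]
  refine Finset.sum_congr rfl fun i _ => ?_
  field_simp

lemma aux_poly (N n : ℕ) (q y X : ℂ) (hq : q ≠ 1) (hy : y * (1 - q) = X * q) :
    ∑ j ∈ Finset.range (n+1), ((-1 : ℂ) ^ j * (((n + N).factorial : ℂ) /
        ((j + N).factorial * (n - j).factorial * j.factorial))) * (1 - q) ^ j * auxS N j y
      = Complex.exp y * q ^ n * ∑ j ∈ Finset.range (n+1), ((-1 : ℂ) ^ j * (((n + N).factorial : ℂ) /
        ((j + N).factorial * (n - j).factorial * j.factorial))) * X ^ j := by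
  have hq' : (1 - q) ≠ 0 := sub_ne_zero.2 hq.symm
  have fz : ∀ a : ℕ, (a.factorial : ℂ) ≠ 0 := fun a => by exact_mod_cast a.factorial_ne_zero
  have h1 : ∀ j ∈ Finset.range (n+1), auxS N j y = (j.factorial : ℂ) * (Complex.exp y *
      ∑ i ∈ Finset.range (n+1), y ^ i / (i.factorial : ℂ) * ((N + j).choose (N + i) : ℂ)) := by
    intro j hj
    unfold auxS
    congr 2
    refine Finset.sum_subset (fun i hi => by simp at *; omega) fun i _ hi => ?_
    rw [Nat.choose_eq_zero_of_lt (by simp at hi; omega)]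
    simp
  rw [Finset.sum_congr rfl (fun j hj => by rw [h1 j hj])]
  simp only [Finset.mul_sum]
  rw [Finset.sum_comm]
  refine Finset.sum_congr rfl fun i hi => ?_
  have hi : i ≤ n := by simpa [Nat.lt_succ_iff] using hi
  obtain ⟨d, rfl⟩ := Nat.exists_eq_add_of_le hi
  rw [show i + d + 1 = i + (d + 1) by ring, Finset.sum_range_add,
    Finset.sum_eq_zero (s := Finset.range i), zero_add]
  swap
  · intro j hj
    rw [Nat.choose_eq_zero_of_lt (by simp at hj; omega)]
    simp
  have hb : q ^ d = ∑ k ∈ Finset.range (d+1), (q - 1) ^ k * (d.choose k : ℂ) := by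
    have := add_pow (q - 1) 1 d
    simpa using this
  have hyi : y ^ i * (1 - q) ^ i = X ^ i * q ^ i := by rw [← mul_pow, hy, mul_pow]
  have e : Complex.exp y * q ^ (i + d) * ((-1 : ℂ) ^ i * (((i + d + N).factorial : ℂ) /
        ((i + N).factorial * (i + d - i).factorial * i.factorial)) * X ^ i)
      = Complex.exp y * (y ^ i * (1 - q) ^ i) * ((-1 : ℂ) ^ i * (((i + d + N).factorial : ℂ) /
        ((i + N).factorial * d.factorial * i.factorial))) * q ^ d := by
    rw [hyi, Nat.add_sub_cancel_left]; ring
  rw [e, hb, Finset.mul_sum]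
  refine Finset.sum_congr rfl fun k hk => ?_
  have hk : k ≤ d := by simpa [Nat.lt_succ_iff] using hk
  obtain ⟨b, rfl⟩ := Nat.exists_eq_add_of_le hk
  rw [show i + (k + b) - (i + k) = b by omega]
  have c1 : (((N + (i + k)).choose (N + i) : ℕ) : ℂ) * k.factorial * (i + N).factorial = (i + k + N).factorial := by
    have := Nat.add_choose_mul_factorial_mul_factorial (N + i) k
    rw [← Nat.choose_symm_add] at this
    rw [show i + k + N = N + i + k by ring, ← this, show N + (i + k) = N + i + k by ring, add_comm i N]
    push_cast; ring
  have c2 : (((k + b).choose k : ℕ) : ℂ) * k.factorial * b.factorial = (k + b).factorial := by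
    have := Nat.add_choose_mul_factorial_mul_factorial k b
    rw [← Nat.choose_symm_add] at this
    exact_mod_cast this
  have c1' : (((N + (i + k)).choose (N + i) : ℕ) : ℂ) = (i + k + N).factorial / (k.factorial * (i + N).factorial) := by
    have := fz k; have := fz (i+N)
    rw [← c1]; field_simp
  have c2' : (((k + b).choose k : ℕ) : ℂ) = (k + b).factorial / (k.factorial * b.factorial) := by
    have := fz k; have := fz b
    rw [← c2]; field_simp
  rw [c1', c2', show q - 1 = (-1) * (1 - q) by ring, mul_pow]
  have := fz k; have := fz b; have := fz i; have := fz (i+N); have := fz (k + b); have := fz (i + k); have := fz (i+k+N)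
  field_simp
  ring

lemma aux_bessel_summable (N : ℕ) (z : ℂ) :
    Summable (fun k : ℕ => z ^ k / ((k.factorial : ℂ) * (N+k).factorial)) := by
  refine Summable.of_norm_bounded (NormedSpace.norm_expSeries_div_summable (𝔸 := ℂ) z) ?_
  intro k
  rw [norm_div, norm_div, norm_mul]
  have h1 : (0:ℝ) < ‖(k.factorial : ℂ)‖ := by
    simpa using Nat.factorial_pos k
  have h2 : (1:ℝ) ≤ ‖((N+k).factorial : ℂ)‖ := by
    rw [Complex.norm_natCast]; exact_mod_cast Nat.factorial_pos (N+k)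
  gcongr
  nlinarith

lemma aux_bessel (p w : ℂ) (hp : 0 < p.re) (N j : ℕ) :
    IntegrableOn (fun x : ℝ => Complex.exp (-p * x) * (x : ℂ) ^ (N + j) *
      ∑' k : ℕ, (w * x) ^ k / ((k.factorial : ℂ) * (N+k).factorial)) (Set.Ioi 0) ∧
    ∫ x in Set.Ioi (0:ℝ), Complex.exp (-p * x) * (x : ℂ) ^ (N + j) *
      ∑' k : ℕ, (w * x) ^ k / ((k.factorial : ℂ) * (N+k).factorial) =
      auxS N j (w / p) / p ^ (N + j + 1) := by
  have hp0 : p ≠ 0 := by rintro rfl; simp at hp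
  set F : ℕ → ℝ → ℂ := fun k x => (w ^ k / ((k.factorial : ℂ) * (N+k).factorial)) *
    ((x : ℂ) ^ (N + j + k) * Complex.exp (-p * x)) with hF
  have hG : (fun x : ℝ => Complex.exp (-p * x) * (x : ℂ) ^ (N + j) *
      ∑' k : ℕ, (w * x) ^ k / ((k.factorial : ℂ) * (N+k).factorial)) = fun x => ∑' k, F k x := by
    ext x
    rw [← tsum_mul_left]
    congr 1; ext k
    simp only [hF]
    rw [mul_pow, pow_add _ (N + j) k]; ring
  have hint : ∀ k, IntegrableOn (F k) (Set.Ioi 0) := fun k => (aux_int_pow p hp _).const_mul _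
  have hptw : ∀ x : ℝ, Summable fun k => F k x := by
    intro x
    refine ((aux_bessel_summable N (w * x)).mul_left (Complex.exp (-p * x) * (x : ℂ) ^ (N + j))).congr ?_
    intro k
    simp only [hF]
    rw [mul_pow, pow_add _ (N + j) k]; ring
  have hI : ∀ k, ∫ x in Set.Ioi (0:ℝ), F k x =
      (((N + j + k).factorial : ℂ) / ((k.factorial : ℂ) * (N+k).factorial) * (w / p) ^ k) / p ^ (N + j + 1) := by
    intro k
    simp only [hF]
    rw [integral_const_mul, aux_integral_pow p hp]
    rw [div_pow, show N + j + k + 1 = k + (N + j + 1) by ring, pow_add p k]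
    field_simp
  have hN : ∀ k, ∫ x in Set.Ioi (0:ℝ), ‖F k x‖ =
      ‖(((N + j + k).factorial : ℂ) / ((k.factorial : ℂ) * (N+k).factorial) * ((‖w‖ : ℂ) / (p.re : ℂ)) ^ k) / (p.re : ℂ) ^ (N + j + 1)‖ := by
    intro k
    have hn : ∫ x in Set.Ioi (0:ℝ), x ^ (N + j + k) * Real.exp (-p.re * x) =
        (N+j+k).factorial / p.re ^ (N + j + k + 1) := by
      have h := aux_integral_pow (p.re : ℂ) (by simpa using hp) (N+j+k)
      have h' : (∫ x in Set.Ioi (0:ℝ), (((x ^ (N + j + k) * Real.exp (-p.re * x) : ℝ)) : ℂ)) =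
        (((N+j+k).factorial / p.re ^ (N + j + k + 1) : ℝ) : ℂ) := by
        push_cast
        exact h
      rw [integral_complex_ofReal] at h'
      exact_mod_cast h'
    have e : ∫ x in Set.Ioi (0:ℝ), ‖F k x‖ = ∫ x in Set.Ioi (0:ℝ), ‖w ^ k / ((k.factorial : ℂ) * (N+k).factorial)‖ *
        (x ^ (N + j + k) * Real.exp (-p.re * x)) := by
      refine setIntegral_congr_fun measurableSet_Ioi fun x hx => ?_
      simp only [hF]
      rw [norm_mul, aux_norm_pow p _ x hx]
    rw [e, integral_const_mul, hn]
    simp only [norm_mul, norm_div, norm_pow, Complex.norm_real, Complex.norm_natCast, norm_norm, Real.norm_of_nonneg hp.le]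
    rw [div_pow, show N + j + k + 1 = k + (N + j + 1) by ring, pow_add p.re k]
    field_simp
  have hsum : Summable fun k => ∫ x in Set.Ioi (0:ℝ), ‖F k x‖ := by
    simp only [hN]
    exact ((aux_hasSum N j ((‖w‖ : ℂ) / (p.re : ℂ))).summable.div_const _).norm
  rw [hG]
  refine ⟨aux_integrable_tsum hint hsum (Filter.Eventually.of_forall hptw), ?_⟩
  have h1 := hasSum_integral_of_summable_integral_norm hint hsum
  have h2 := (aux_hasSum N j (w / p)).div_const (p ^ (N + j + 1))
  simp only [hI] at h1
  exact h1.unique h2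

noncomputable def auxC (N n j : ℕ) : ℂ := (-1 : ℂ) ^ j * (((n + N).factorial : ℂ) /
        ((j + N).factorial * (n - j).factorial * j.factorial))

lemma aux_laguerre (N n : ℕ) (x : ℝ) :
    ((laguerre n (N : ℝ) x : ℝ) : ℂ) = ∑ j ∈ Finset.range (n+1), auxC N n j * (x : ℂ) ^ j := by
  unfold laguerre auxC
  have h : ∀ b : ℕ, Real.Gamma ((b : ℝ) + N + 1) = (b + N).factorial := fun b => by
    rw [← Real.Gamma_nat_eq_factorial]; push_cast; rfl
  simp only [h]
  push_cast
  rfl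

lemma aux_Itilde (N : ℕ) (s : ℂ) (r x : ℝ) (hr : 0 < r) (hx : 0 < x) :
    ItildeC (N : ℝ) ((4 * Real.sqrt (r * x) : ℝ) / s) =
      ∑' k : ℕ, ((4 * r / s ^ 2) * x) ^ k / ((k.factorial : ℂ) * (N+k).factorial) := by
  unfold ItildeC
  congr 1; ext k
  have h : Complex.Gamma (((N : ℝ) : ℂ) + k + 1) = (N + k).factorial := by
    rw [← Complex.Gamma_nat_eq_factorial]; push_cast; rfl
  rw [h, pow_mul]
  congr 2
  have h2 : ((Real.sqrt (r * x) : ℝ) : ℂ) ^ 2 = r * x := by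
    rw [← Complex.ofReal_pow, Real.sq_sqrt (by positivity)]; push_cast; rfl
  push_cast
  rw [div_pow, div_pow, mul_pow, h2]
  ring

/-- For `m ≥ 2`, `0 ≤ l ≤ a`, `t ∈ Ω`, and `r > 0`, the integral
`∫_0^∞ K_l⁺(r,r';t)·f_{a,l}(r')·r'^{m-2} dr'` converges absolutely and equals
`e^{-(a+(m-1)/2)t}·f_{a,l}(r)`. -/
theorem Kl_eigenfunction (m l a : ℕ) (hm : 2 ≤ m) (hla : l ≤ a)
    (t : ℂ) (ht : InOmega t) (r : ℝ) (hr : 0 < r) :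
    IntegrableOn (fun r' : ℝ => Kl m l t r r' * (fal m l a r' : ℂ) * (r' : ℂ) ^ (m - 2))
      (Set.Ioi 0) ∧
    ∫ r' in Set.Ioi (0:ℝ), Kl m l t r r' * (fal m l a r' : ℂ) * (r' : ℂ) ^ (m - 2) =
      Complex.exp (-((a : ℂ) + ((m : ℂ) - 1) / 2) * t) * (fal m l a r : ℂ) := by
  
  obtain ⟨M, rfl⟩ : ∃ M, m = M + 2 := ⟨m - 2, by omega⟩
  obtain ⟨n, rfl⟩ := Nat.exists_eq_add_of_le hla
  obtain ⟨ht0, ht1⟩ := ht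
  set E := Complex.exp (t / 2) with hE
  have hE0 : E ≠ 0 := Complex.exp_ne_zero _
  set q := Complex.exp (-t) with hq
  have hqE : q * E ^ 2 = 1 := by
    rw [hq, hE, ← Complex.exp_nat_mul, ← Complex.exp_add]
    simp only [Nat.cast_ofNat]
    rw [show -t + 2 * (t / 2) = 0 by ring, Complex.exp_zero]
  have hq1 : q ≠ 1 := by
    intro h
    obtain ⟨k, hk⟩ := Complex.exp_eq_one_iff.1 h
    refine ht1 (-k) ?_
    push_cast
    linear_combination -hk
  have hq1' : 1 - q ≠ 0 := sub_ne_zero.2 hq1.symm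
  have hqre : q.re < 1 := by
    have h1 : ‖q‖ ≤ 1 := by
      rw [hq, Complex.norm_exp]; simpa using ht0
    rcases lt_or_ge q.re 1 with h | h
    · exact h
    · exfalso
      apply hq1
      have h2 : q.re ^ 2 + q.im ^ 2 ≤ 1 := by
        have := Complex.sq_norm q
        rw [Complex.normSq_apply] at this
        nlinarith [norm_nonneg q]
      have h3 : q.im = 0 := by nlinarith [sq_nonneg q.im]
      have h4 : q.re = 1 := by nlinarith
      exact Complex.ext (by simpa using h4) (by simpa using h3)
  set s := Complex.sinh (t / 2) with hs
  have hsE : s = (1 - q) * E / 2 := by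
    have : Complex.exp (-(t/2)) = q * E := by rw [hq, hE, ← Complex.exp_add]; congr 1; ring
    rw [hs, Complex.sinh, this]; ring
  have hcE : Complex.cosh (t / 2) = (1 + q) * E / 2 := by
    have : Complex.exp (-(t/2)) = q * E := by rw [hq, hE, ← Complex.exp_add]; congr 1; ring
    rw [Complex.cosh, this]; ring
  have hs0 : s ≠ 0 := by
    rw [hsE]; exact div_ne_zero (mul_ne_zero hq1' hE0) two_ne_zero
  set c := Complex.cosh (t / 2) / s with hc
  have hcq : c = (1 + q) / (1 - q) := by
    rw [hc, hcE, hsE]; field_simp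
  obtain ⟨p, hpdef⟩ : ∃ p, p = 2 * (c + 1) := ⟨_, rfl⟩
  have hpq : p = 4 / (1 - q) := by rw [hpdef, hcq]; field_simp; ring
  have hp : 0 < p.re := by
    rw [hpq, Complex.div_re]
    have : 0 < Complex.normSq (1 - q) := Complex.normSq_pos.2 hq1'
    simp
    apply div_pos _ this
    linarith
  have hp0 : p ≠ 0 := by rintro h; simp [h] at hp
  set N := M + 2 * l with hN
  have hNr : (((M + 2 : ℕ) : ℝ) - 2 + 2 * (l : ℝ)) = (N : ℝ) := by rw [hN]; push_cast; ring
  obtain ⟨w, hw⟩ : ∃ w : ℂ, w = 4 * r / s ^ 2 := ⟨_, rfl⟩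
  obtain ⟨C, hC⟩ : ∃ C : ℂ, C = 2 ^ (N + 1) * Complex.exp (-2 * r * c) * (r : ℂ) ^ l / s ^ (N + 1) := ⟨_, rfl⟩
  have hint : Set.EqOn (fun r' : ℝ => Kl (M+2) l t r r' * (fal (M+2) l (l+n) r' : ℂ) * (r' : ℂ) ^ (M + 2 - 2))
      (fun x : ℝ => ∑ j ∈ Finset.range (n+1), C * (auxC N n j * 4 ^ j) *
        (Complex.exp (-p * x) * (x : ℂ) ^ (N + j) *
      ∑' k : ℕ, (w * x) ^ k / ((k.factorial : ℂ) * (N+k).factorial))) (Set.Ioi 0) := by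
    intro x hx
    have hx : 0 < x := hx
    simp only [Kl, fal]
    rw [hNr, ← hs, ← hc, aux_Itilde N s r x hr hx, ← hw]
    push_cast
    rw [Nat.add_sub_cancel_left, aux_laguerre, show M + 1 + 2 * l = N + 1 by omega]
    generalize (∑' k : ℕ, (w * (x:ℂ)) ^ k / ((k.factorial : ℂ) * (N+k).factorial)) = T
    have he : Complex.exp (-2 * (r + x) * c) * Complex.exp (-2 * x) =
        Complex.exp (-2 * r * c) * Complex.exp (-p * x) := by
      rw [← Complex.exp_add, ← Complex.exp_add, hpdef]; congr 1; ring
    simp only [Finset.mul_sum, Finset.sum_mul]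
    refine Finset.sum_congr rfl fun j _ => ?_
    rw [hC]
    push_cast
    rw [hN, pow_add (x:ℂ), pow_add (x:ℂ), pow_mul', mul_pow, mul_pow, ← hN]
    linear_combination (2 ^ (N + 1) * (r:ℂ) ^ l * (x:ℂ) ^ l * T / s ^ (N+1) * auxC N n j * 4 ^ j * (x:ℂ)^j * (x:ℂ) ^ l * (x:ℂ) ^ M) * he
  have hI : ∀ j ∈ Finset.range (n+1), IntegrableOn (fun x : ℝ => C * (auxC N n j * 4 ^ j) *
        (Complex.exp (-p * x) * (x : ℂ) ^ (N + j) *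
      ∑' k : ℕ, (w * x) ^ k / ((k.factorial : ℂ) * (N+k).factorial))) (Set.Ioi 0) :=
    fun j _ => (aux_bessel p w hp N j).1.const_mul _
  refine ⟨IntegrableOn.congr_fun (integrable_finsetSum _ hI) hint.symm measurableSet_Ioi, ?_⟩
  rw [setIntegral_congr_fun measurableSet_Ioi hint, integral_finsetSum _ hI]
  simp only [integral_const_mul, (aux_bessel p w hp N _).2]
  have hy : w / p * (1 - q) = ((4 * r : ℝ) : ℂ) * q := by
    rw [hw, hpq, hsE]
    push_cast
    field_simp
    linear_combination (-4 * (r:ℂ)) * hqE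
  have hpoly := aux_poly N n q (w / p) ((4 * r : ℝ) : ℂ) hq1 hy
  have hsum : ∑ j ∈ Finset.range (n+1), C * (auxC N n j * 4 ^ j) * (auxS N j (w / p) / p ^ (N + j + 1)) =
      C / p ^ (N + 1) * ∑ j ∈ Finset.range (n+1), auxC N n j * (1 - q) ^ j * auxS N j (w / p) := by
    rw [Finset.mul_sum]
    refine Finset.sum_congr rfl fun j _ => ?_
    have h1 : (1 - q) ^ j = 4 ^ j / p ^ j := by rw [← div_pow, hpq]; congr 1; field_simp
    rw [h1, show N + j + 1 = N + 1 + j by ring, pow_add p (N+1) j]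
    field_simp
  simp only [auxC] at hsum
  simp only [auxC]
  rw [hsum, hpoly]
  simp only [fal]
  rw [hNr, Nat.add_sub_cancel_left]
  push_cast
  rw [aux_laguerre]
  simp only [auxC]
  push_cast
  have hexp1 : Complex.exp (-2 * r * c) * Complex.exp (w / p) = Complex.exp (-2 * r) := by
    rw [← Complex.exp_add]
    congr 1
    have : w / p = 4 * r * q / (1 - q) := by
      rw [eq_div_iff hq1', hy]; push_cast; rfl
    rw [this, hcq]
    field_simp
    ring
  have hsp : (2:ℂ) ^ (N+1) / (s ^ (N+1) * p ^ (N+1)) = Complex.exp (-(t/2)) ^ (N+1) := by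
    rw [← mul_pow, ← div_pow]
    congr 1
    rw [hsE, hpq, Complex.exp_neg, ← hE]
    field_simp
    norm_num
  have hexp2 : Complex.exp (-(t/2)) ^ (N+1) * q ^ n =
      Complex.exp (-((l : ℂ) + n + ((M : ℂ) + 2 - 1) / 2) * t) := by
    rw [hq, ← Complex.exp_nat_mul, ← Complex.exp_nat_mul, ← Complex.exp_add]
    congr 1
    rw [hN]; push_cast; ring
  rw [← hexp2, ← hexp1, ← hsp, hC]
  ring
end

section
/- Let m ≥ 2 and l ≥ 0 be integers, and let t₁, t₂ ∈ ℂ with Re t₁ > 0 and Re t₂ > 0. Then for all r, r' > 0, ∫_0^∞ K_l⁺(r,s;t₁)·K_l⁺(s,r';t₂)·s^{m-2} ds = K_l⁺(r,r';t₁+t₂). -/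
open MeasureTheory

open scoped Nat

lemma aux_integrable (p : ℂ) (hp : 0 < p.re) (N : ℕ) :
    IntegrableOn (fun s : ℝ => (s : ℂ) ^ N * Complex.exp (-p * s)) (Set.Ioi 0) := by
  have h := integrableOn_rpow_mul_exp_neg_mul_rpow (p := 1) (s := N) (b := p.re)
    (by have : (0:ℝ) ≤ N := Nat.cast_nonneg N
        linarith) one_pos hp
  refine Integrable.mono' h ?_ ?_
  · exact (Continuous.aestronglyMeasurable (by fun_prop))
  · refine (ae_restrict_iff' measurableSet_Ioi).2 (Filter.Eventually.of_forall ?_)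
    intro s hs
    have hs' : (0:ℝ) < s := hs
    rw [norm_mul, norm_pow, Complex.norm_exp, Complex.norm_real, Real.norm_of_nonneg hs'.le]
    simp

lemma aux_norm_integral (p : ℂ) (hp : 0 < p.re) (N : ℕ) :
    ∫ s in Set.Ioi (0:ℝ), ‖(s : ℂ) ^ N * Complex.exp (-p * s)‖ = N ! / p.re ^ (N + 1) := by
  have h := Real.integral_rpow_mul_exp_neg_mul_Ioi (a := N + 1) (r := p.re) (by positivity) hp
  rw [Real.Gamma_nat_eq_factorial] at h
  have e : (1 / p.re) ^ ((N:ℝ) + 1) = 1 / p.re ^ (N + 1) := by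
    rw [show ((N:ℝ) + 1) = ((N + 1 : ℕ) : ℝ) by push_cast; ring, Real.rpow_natCast, one_div_pow]
  rw [e] at h
  rw [div_eq_mul_one_div, mul_comm, ← h]
  refine setIntegral_congr_fun measurableSet_Ioi ?_
  intro s hs
  have hs' : (0:ℝ) < s := hs
  simp only
  rw [norm_mul, norm_pow, Complex.norm_exp, Complex.norm_real, Real.norm_of_nonneg hs'.le]
  simp

lemma aux_integral (p : ℂ) (hp : 0 < p.re) (N : ℕ) :
    ∫ s in Set.Ioi (0:ℝ), (s : ℂ) ^ N * Complex.exp (-p * s) = N ! / p ^ (N + 1) := by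
  have hp0 : p ≠ 0 := by
    rintro rfl
    simp at hp
  induction N with
  | zero =>
    have := integral_exp_mul_complex_Ioi (a := -p) (by simpa using hp) 0
    simp only [pow_zero, one_mul, this]
    simp
  | succ N ih =>
    have hd : ∀ s ∈ Set.Ici (0:ℝ), HasDerivAt
        (fun s : ℝ => (s : ℂ) ^ (N + 1) * Complex.exp (-p * s))
        (((N + 1 : ℕ) : ℂ) * ((s : ℂ) ^ N * Complex.exp (-p * s)) -
          p * ((s : ℂ) ^ (N + 1) * Complex.exp (-p * s))) s := by
      intro s _
      have h1 : HasDerivAt (fun s : ℂ => s ^ (N + 1) * Complex.exp (-p * s))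
          (((N + 1 : ℕ) : ℂ) * ((s : ℂ) ^ N * Complex.exp (-p * s)) -
          p * ((s : ℂ) ^ (N + 1) * Complex.exp (-p * s))) (s : ℂ) := by
        have h2 := (hasDerivAt_pow (N + 1) (s : ℂ)).mul
          (((hasDerivAt_id (s : ℂ)).const_mul (-p)).cexp)
        convert! h2 using 1
        simp
        ring
      exact h1.comp_ofReal
    have hi1 := (aux_integrable p hp N).const_mul ((N + 1 : ℕ) : ℂ)
    have hi2 := (aux_integrable p hp (N + 1)).const_mul p
    have ht : Filter.Tendsto (fun s : ℝ => (s : ℂ) ^ (N + 1) * Complex.exp (-p * s))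
        Filter.atTop (nhds 0) := by
      rw [tendsto_zero_iff_norm_tendsto_zero]
      have h := tendsto_rpow_mul_exp_neg_mul_atTop_nhds_zero ((N + 1 : ℕ) : ℝ) p.re hp
      refine h.congr' ?_
      filter_upwards [Filter.eventually_gt_atTop 0] with s hs
      rw [norm_mul, norm_pow, Complex.norm_exp, Complex.norm_real, Real.norm_of_nonneg hs.le,
        Real.rpow_natCast]
      simp
    have h := integral_Ioi_of_hasDerivAt_of_tendsto' hd (hi1.sub hi2) ht
    rw [integral_sub hi1 hi2, integral_const_mul, integral_const_mul, ih] at h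
    simp only [Complex.ofReal_zero, ne_eq, Nat.add_eq_zero_iff, one_ne_zero, and_false,
      not_false_eq_true, zero_pow, zero_mul, sub_zero] at h
    have h' := sub_eq_zero.1 h
    have : p * (((N + 1)! : ℂ) / p ^ (N + 1 + 1)) = ((N + 1 : ℕ) : ℂ) * (N ! / p ^ (N + 1)) := by
      rw [Nat.factorial_succ]
      push_cast
      field_simp
      ring
    exact mul_left_cancel₀ hp0 (h'.symm.trans this.symm)

/-- The coefficients of the double series. -/
noncomputable def aux_c (n j : ℕ) : ℂ := 1 / ((j ! : ℂ) * ((n + j)! : ℂ))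

lemma aux_vand (n j k : ℕ) :
    ∑ i ∈ Finset.range (k + 1), (if i ≤ j then
      (1 : ℂ) / ((i ! : ℂ) * ((n + i)! : ℂ) * ((j - i)! : ℂ) * ((k - i)! : ℂ)) else 0) =
    ((n + j + k)! : ℂ) * (aux_c n j * aux_c n k) := by
  have hv := Nat.add_choose_eq j (n + k) k
  rw [Finset.Nat.sum_antidiagonal_eq_sum_range_succ (fun a b => j.choose a * (n + k).choose b)] at hv
  have hv' := congrArg (Nat.cast : ℕ → ℂ) hv
  have e0 : ((j + (n + k)).choose k : ℂ) = ((n + j + k)! : ℂ) / ((k ! : ℂ) * ((n + j)! : ℂ)) := by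
    rw [Nat.cast_choose ℂ (by omega), show j + (n + k) = n + j + k by omega,
      show n + j + k - k = n + j by omega]
  rw [e0] at hv'
  have hjf : (j ! : ℂ) ≠ 0 := by exact_mod_cast Nat.factorial_ne_zero _
  have hkf : ((n + k)! : ℂ) ≠ 0 := by exact_mod_cast Nat.factorial_ne_zero _
  have : ((n + j + k)! : ℂ) * (aux_c n j * aux_c n k) =
      (((n + j + k)! : ℂ) / ((k ! : ℂ) * ((n + j)! : ℂ))) * (1 / ((j ! : ℂ) * ((n + k)! : ℂ))) := by
    unfold aux_c
    field_simp
  rw [this, hv']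
  push_cast
  rw [Finset.sum_mul]
  refine Finset.sum_congr rfl ?_
  intro i hi
  have hik : i ≤ k := by
    have := Finset.mem_range.1 hi
    omega
  split_ifs with hij
  · rw [Nat.cast_choose ℂ hij, Nat.cast_choose ℂ (show k - i ≤ n + k by omega),
      show n + k - (k - i) = n + i by omega]
    field_simp
  · rw [Nat.choose_eq_zero_of_lt (by omega)]
    simp

lemma aux_c_norm_le (n j : ℕ) : ‖aux_c n j‖ ≤ 1 / (j ! : ℝ) := by
  unfold aux_c
  rw [norm_div, norm_mul, Complex.norm_natCast, Complex.norm_natCast, norm_one]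
  have h1 : (1:ℝ) ≤ ((n + j)! : ℝ) := by exact_mod_cast Nat.factorial_pos _
  have h2 : (0:ℝ) < (j ! : ℝ) := by exact_mod_cast Nat.factorial_pos _
  apply one_div_le_one_div_of_le h2
  nlinarith

lemma aux_exp_norm (x : ℂ) : Summable (fun j : ℕ => ‖x ^ j / (j ! : ℂ)‖) := by
  refine (Real.summable_pow_div_factorial ‖x‖).congr ?_
  intro j
  rw [norm_div, norm_pow, Complex.norm_natCast]

lemma aux_c_summable (n : ℕ) (x : ℂ) : Summable (fun j : ℕ => ‖x ^ j * aux_c n j‖) := by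
  refine Summable.of_nonneg_of_le (fun _ => norm_nonneg _) ?_ (Real.summable_pow_div_factorial ‖x‖)
  intro j
  rw [norm_mul, norm_pow, div_eq_mul_one_div]
  exact mul_le_mul_of_nonneg_left (aux_c_norm_le n j) (by positivity)

lemma aux_exp_hasSum (x : ℂ) : HasSum (fun j : ℕ => x ^ j / (j ! : ℂ)) (Complex.exp x) := by
  rw [Complex.exp_eq_exp_ℂ]
  exact NormedSpace.expSeries_div_hasSum_exp x

/-- Triple-indexed terms used to rearrange the double series. -/
noncomputable def aux_G (n : ℕ) (x y : ℂ) (z : (ℕ × ℕ) × ℕ) : ℂ :=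
  if z.2 ≤ z.1.1 ∧ z.2 ≤ z.1.2 then
    ((x * y) ^ z.2 * aux_c n z.2) * (x ^ (z.1.1 - z.2) / ((z.1.1 - z.2)! : ℂ) *
      (y ^ (z.1.2 - z.2) / ((z.1.2 - z.2)! : ℂ))) else 0

/-- The reindexing map. -/
def aux_g (w : ℕ × (ℕ × ℕ)) : (ℕ × ℕ) × ℕ := ((w.1 + w.2.1, w.1 + w.2.2), w.1)

lemma aux_g_inj : Function.Injective aux_g := by
  rintro ⟨a, b, c⟩ ⟨a₂, b₂, c₂⟩ h
  unfold aux_g at h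
  simp only [Prod.mk.injEq] at h
  obtain ⟨⟨h1, h2⟩, h3⟩ := h
  subst h3
  have h4 := Nat.add_left_cancel h1
  have h5 := Nat.add_left_cancel h2
  rw [h4, h5]

lemma aux_G_zero (n : ℕ) (x y : ℂ) (z : (ℕ × ℕ) × ℕ) (hz : z ∉ Set.range aux_g) :
    aux_G n x y z = 0 := by
  unfold aux_G
  rw [if_neg]
  rintro ⟨h1, h2⟩
  apply hz
  refine ⟨(z.2, (z.1.1 - z.2, z.1.2 - z.2)), ?_⟩
  unfold aux_g
  simp only [Nat.add_sub_cancel' h1, Nat.add_sub_cancel' h2]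

lemma aux_G_comp (n : ℕ) (x y : ℂ) (i u v : ℕ) :
    aux_G n x y (aux_g (i, (u, v))) = ((x * y) ^ i * aux_c n i) *
      (x ^ u / (u ! : ℂ) * (y ^ v / (v ! : ℂ))) := by
  unfold aux_G aux_g
  simp only [Nat.le_add_right, and_self, if_true, Nat.add_sub_cancel_left]

lemma aux_G_fiber (n : ℕ) (x y : ℂ) (j k : ℕ) :
    ((n + j + k)! : ℂ) * ((x ^ j * aux_c n j) * (y ^ k * aux_c n k)) =
      ∑ i ∈ Finset.range (k + 1), aux_G n x y ((j, k), i) := by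
  rw [show ((n + j + k)! : ℂ) * ((x ^ j * aux_c n j) * (y ^ k * aux_c n k)) =
    (((n + j + k)! : ℂ) * (aux_c n j * aux_c n k)) * (x ^ j * y ^ k) by ring, ← aux_vand n j k,
    Finset.sum_mul]
  refine Finset.sum_congr rfl ?_
  intro i hi
  have hik : i ≤ k := by
    have := Finset.mem_range.1 hi
    omega
  unfold aux_G
  by_cases hij : i ≤ j
  · simp only [hij, hik, and_self, if_true]
    have e1 : x ^ j = x ^ i * x ^ (j - i) := by rw [← pow_add]; congr 1; omega
    have e2 : y ^ k = y ^ i * y ^ (k - i) := by rw [← pow_add]; congr 1; omega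
    rw [e1, e2, mul_pow]
    unfold aux_c
    field_simp
  · simp [hij]

lemma aux_mul {ι ι' : Type} (f : ι → ℂ) (g : ι' → ℂ) (a b : ℂ) (hf : HasSum f a)
    (hg : HasSum g b) (nf : Summable fun i => ‖f i‖) (ng : Summable fun i => ‖g i‖) :
    HasSum (fun q : ι × ι' => f q.1 * g q.2) (a * b) := by
  have hs : Summable (fun q : ι × ι' => f q.1 * g q.2) := summable_mul_of_summable_norm nf ng
  have h := hs.hasSum
  rw [← tsum_mul_tsum_of_summable_norm nf ng, hf.tsum_eq, hg.tsum_eq] at h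
  exact h

lemma aux_G_hasSum (n : ℕ) (x y : ℂ) : HasSum (aux_G n x y)
    ((∑' i : ℕ, (x * y) ^ i * aux_c n i) * (Complex.exp x * Complex.exp y)) := by
  have hA : HasSum (fun i : ℕ => (x * y) ^ i * aux_c n i) (∑' i : ℕ, (x * y) ^ i * aux_c n i) :=
    (aux_c_summable n (x * y)).of_norm.hasSum
  have hxy := aux_mul _ _ _ _ (aux_exp_hasSum x) (aux_exp_hasSum y) (aux_exp_norm x)
    (aux_exp_norm y)
  have hxyn := Summable.mul_norm (aux_exp_norm x) (aux_exp_norm y)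
  have hT := aux_mul _ _ _ _ hA hxy (aux_c_summable n (x * y)) hxyn
  have e : aux_G n x y ∘ aux_g = fun w : ℕ × (ℕ × ℕ) => ((x * y) ^ w.1 * aux_c n w.1) *
      (x ^ w.2.1 / (w.2.1 ! : ℂ) * (y ^ w.2.2 / (w.2.2 ! : ℂ))) := by
    funext w
    exact aux_G_comp n x y w.1 w.2.1 w.2.2
  rw [← aux_g_inj.hasSum_iff (aux_G_zero n x y), e]
  exact hT

lemma aux_double (n : ℕ) (x y : ℂ) :
    HasSum (fun q : ℕ × ℕ => ((n + q.1 + q.2)! : ℂ) *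
        ((x ^ q.1 * aux_c n q.1) * (y ^ q.2 * aux_c n q.2)))
      ((∑' i : ℕ, (x * y) ^ i * aux_c n i) * (Complex.exp x * Complex.exp y)) := by
  have hfib : ∀ q : ℕ × ℕ, HasSum (fun i => aux_G n x y (q, i))
      (∑ i ∈ Finset.range (q.2 + 1), aux_G n x y (q, i)) := by
    intro q
    apply hasSum_sum_of_ne_finset_zero
    intro i hi
    have : ¬ i ≤ q.2 := by
      intro h
      exact hi (Finset.mem_range.2 (Nat.lt_succ_of_le h))
    unfold aux_G
    rw [if_neg]
    rintro ⟨_, h⟩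
    exact this h
  have h := (aux_G_hasSum n x y).prod_fiberwise hfib
  have e : (fun q : ℕ × ℕ => ((n + q.1 + q.2)! : ℂ) *
        ((x ^ q.1 * aux_c n q.1) * (y ^ q.2 * aux_c n q.2))) =
      fun q : ℕ × ℕ => ∑ i ∈ Finset.range (q.2 + 1), aux_G n x y (q, i) := by
    funext q
    exact aux_G_fiber n x y q.1 q.2
  rw [e]
  exact h

lemma aux_sum_norm (n : ℕ) (x y : ℝ) (hx : 0 ≤ x) (hy : 0 ≤ y) :
    Summable (fun q : ℕ × ℕ => ((n + q.1 + q.2)! : ℝ) *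
        ((x ^ q.1 * ‖aux_c n q.1‖) * (y ^ q.2 * ‖aux_c n q.2‖))) := by
  have h := (aux_double n x y).summable.norm
  refine h.congr ?_
  intro q
  simp only [norm_mul, norm_pow, Complex.norm_natCast, Complex.norm_real, Real.norm_of_nonneg hx,
    Real.norm_of_nonneg hy]

lemma aux_main (n : ℕ) (a b p : ℂ) (hp : 0 < p.re) :
    ∫ s in Set.Ioi (0:ℝ), (s : ℂ) ^ n * Complex.exp (-p * s) *
      ((∑' j : ℕ, (a * s) ^ j * aux_c n j) * (∑' k : ℕ, (b * s) ^ k * aux_c n k)) =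
    1 / p ^ (n + 1) * ((∑' i : ℕ, (a / p * (b / p)) ^ i * aux_c n i) *
      (Complex.exp (a / p) * Complex.exp (b / p))) := by
  have hp0 : p ≠ 0 := by
    rintro rfl
    simp at hp
  let C : ℕ × ℕ → ℂ := fun q => a ^ q.1 * b ^ q.2 * (aux_c n q.1 * aux_c n q.2)
  let F : ℕ × ℕ → ℝ → ℂ := fun q s =>
    C q * ((s : ℂ) ^ (n + q.1 + q.2) * Complex.exp (-p * s))
  have hF : ∀ q, Integrable (F q) (volume.restrict (Set.Ioi 0)) := fun q =>
    (aux_integrable p hp _).const_mul _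
  have hS : Summable fun q => ∫ s in Set.Ioi (0:ℝ), ‖F q s‖ := by
    refine ((aux_sum_norm n (‖a‖ / p.re) (‖b‖ / p.re) (by positivity) (by positivity)).mul_left
      (1 / p.re ^ (n + 1))).congr ?_
    intro q
    have : ∀ s : ℝ, ‖F q s‖ = ‖C q‖ * ‖(s : ℂ) ^ (n + q.1 + q.2) * Complex.exp (-p * s)‖ :=
      fun s => norm_mul _ _
    simp only [this]
    rw [integral_const_mul, aux_norm_integral p hp]
    simp only [C, norm_mul, norm_pow, div_pow]
    field_simp
    ring
  have h := hasSum_integral_of_summable_integral_norm hF hS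
  have hI : ∀ q, ∫ s in Set.Ioi (0:ℝ), F q s = 1 / p ^ (n + 1) * (((n + q.1 + q.2)! : ℂ) *
        (((a / p) ^ q.1 * aux_c n q.1) * ((b / p) ^ q.2 * aux_c n q.2))) := by
    intro q
    simp only [F]
    rw [integral_const_mul, aux_integral p hp]
    simp only [C, div_pow]
    field_simp
    ring
  simp only [hI] at h
  have h2 := (aux_double n (a / p) (b / p)).mul_left (1 / p ^ (n + 1))
  rw [← h.unique h2]
  refine setIntegral_congr_fun measurableSet_Ioi ?_
  intro s _
  simp only
  rw [tsum_mul_tsum_of_summable_norm (aux_c_summable n _) (aux_c_summable n _), ← tsum_mul_left]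
  refine tsum_congr ?_
  intro q
  simp only [F, C, mul_pow, pow_add]
  ring

lemma aux_Itilde_s4 (n : ℕ) (z : ℂ) :
    ItildeC n z = ∑' k : ℕ, ((z / 2) ^ 2) ^ k * aux_c n k := by
  unfold ItildeC
  refine tsum_congr ?_
  intro k
  rw [← pow_mul, show (((n : ℝ) : ℂ) + k + 1) = ((n + k : ℕ) : ℂ) + 1 by push_cast; ring,
    Complex.Gamma_nat_eq_factorial, aux_c, div_eq_mul_one_div]

lemma aux_coth (t : ℂ) (ht : 0 < t.re) : Complex.sinh t ≠ 0 ∧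
    0 < (Complex.cosh t / Complex.sinh t).re := by
  have hx : 0 < Real.sinh t.re := Real.sinh_pos_iff.2 ht
  have hc : 0 < Real.cosh t.re := Real.cosh_pos _
  have es : Complex.sinh t = ⟨Real.sinh t.re * Real.cos t.im, Real.cosh t.re * Real.sin t.im⟩ := by
    conv_lhs => rw [← Complex.re_add_im t]
    rw [Complex.sinh_add, Complex.cosh_mul_I, Complex.sinh_mul_I]
    apply Complex.ext <;>
    simp [← Complex.ofReal_sinh, ← Complex.ofReal_cosh, ← Complex.ofReal_sin, ← Complex.ofReal_cos]
  have ec : Complex.cosh t = ⟨Real.cosh t.re * Real.cos t.im, Real.sinh t.re * Real.sin t.im⟩ := by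
    conv_lhs => rw [← Complex.re_add_im t]
    rw [Complex.cosh_add, Complex.cosh_mul_I, Complex.sinh_mul_I]
    apply Complex.ext <;>
    simp [← Complex.ofReal_sinh, ← Complex.ofReal_cosh, ← Complex.ofReal_sin, ← Complex.ofReal_cos]
  have key : (Complex.cosh t).re * (Complex.sinh t).re + (Complex.cosh t).im * (Complex.sinh t).im
      = Real.sinh t.re * Real.cosh t.re := by
    rw [es, ec]
    simp only
    linear_combination Real.sinh t.re * Real.cosh t.re * Real.sin_sq_add_cos_sq t.im
  have hpos : 0 < Real.sinh t.re * Real.cosh t.re := mul_pos hx hc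
  have h0 : Complex.sinh t ≠ 0 := by
    intro h
    rw [h] at key
    simp at key
    rcases key with h | h <;> linarith
  refine ⟨h0, ?_⟩
  have hn : 0 < Complex.normSq (Complex.sinh t) := Complex.normSq_pos.2 h0
  rw [Complex.div_re, ← add_div, key]
  positivity

lemma aux_Kl (m l : ℕ) (hm : 2 ≤ m) (t : ℂ) (r s : ℝ) (hr : 0 < r) (hs : 0 < s) :
    Kl m l t r s = 2 ^ (m - 1 + 2 * l) *
      Complex.exp (-2 * (r + s) * (Complex.cosh (t/2) / Complex.sinh (t/2))) * ((r : ℂ) * s) ^ l *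
      (∑' k : ℕ, (4 * r * s / Complex.sinh (t/2) ^ 2) ^ k * aux_c (m - 2 + 2 * l) k) /
      (Complex.sinh (t/2)) ^ (m - 1 + 2 * l) := by
  unfold Kl
  have e : (m : ℝ) - 2 + 2 * l = ((m - 2 + 2 * l : ℕ) : ℝ) := by
    push_cast [Nat.cast_sub hm]
    ring
  have e2 : (((4 * Real.sqrt (r * s) : ℝ) : ℂ) / Complex.sinh (t/2) / 2) ^ 2 =
      4 * r * s / Complex.sinh (t/2) ^ 2 := by
    have : ((Real.sqrt (r * s) : ℝ) : ℂ) ^ 2 = r * s := by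
      rw [← Complex.ofReal_pow, Real.sq_sqrt (by positivity)]
      push_cast
      rfl
    push_cast
    rw [div_pow, div_pow, mul_pow, this]
    ring
  rw [e, aux_Itilde_s4, e2]
  push_cast
  rfl

theorem Kl_semigroup (m l : ℕ) (hm : 2 ≤ m) (t₁ t₂ : ℂ)
    (ht₁ : 0 < t₁.re) (ht₂ : 0 < t₂.re) (r r' : ℝ) (hr : 0 < r) (hr' : 0 < r') :
    ∫ s in Set.Ioi (0:ℝ), Kl m l t₁ r s * Kl m l t₂ s r' * (s : ℂ) ^ (m - 2) =
      Kl m l (t₁ + t₂) r r' := by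
  obtain ⟨h1, h1p⟩ := aux_coth (t₁ / 2) (by simpa using ht₁)
  obtain ⟨h2, h2p⟩ := aux_coth (t₂ / 2) (by simpa using ht₂)
  obtain ⟨h3, h3p⟩ := aux_coth ((t₁ + t₂) / 2) (by simpa using add_pos ht₁ ht₂)
  have hS : Complex.sinh ((t₁ + t₂) / 2) = Complex.sinh (t₁ / 2) * Complex.cosh (t₂ / 2) +
      Complex.cosh (t₁ / 2) * Complex.sinh (t₂ / 2) := by
    rw [add_div, Complex.sinh_add]
  have hC1 : Complex.sinh (t₂ / 2) = Complex.sinh ((t₁ + t₂) / 2) * Complex.cosh (t₁ / 2) -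
      Complex.cosh ((t₁ + t₂) / 2) * Complex.sinh (t₁ / 2) := by
    rw [← Complex.sinh_sub]
    congr 1
    ring
  have hC2 : Complex.sinh (t₁ / 2) = Complex.sinh ((t₁ + t₂) / 2) * Complex.cosh (t₂ / 2) -
      Complex.cosh ((t₁ + t₂) / 2) * Complex.sinh (t₂ / 2) := by
    rw [← Complex.sinh_sub]
    congr 1
    ring
  obtain ⟨n, hn⟩ : ∃ n, n = m - 2 + 2 * l := ⟨_, rfl⟩
  have hn1 : m - 1 + 2 * l = n + 1 := by omega
  rw [aux_Kl m l hm _ r r' hr hr', ← hn, hn1]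
  have hmain := aux_main n (4 * r / Complex.sinh (t₁ / 2) ^ 2) (4 * r' / Complex.sinh (t₂ / 2) ^ 2)
    (2 * (Complex.cosh (t₁ / 2) / Complex.sinh (t₁ / 2) +
      Complex.cosh (t₂ / 2) / Complex.sinh (t₂ / 2))) (by
      rw [Complex.mul_re, Complex.add_re]
      simp
      linarith)
  have hpt : ∀ s ∈ Set.Ioi (0:ℝ), Kl m l t₁ r s * Kl m l t₂ s r' * (s : ℂ) ^ (m - 2) =
      (2 ^ (2 * (n + 1)) * Complex.exp (-2 * r * (Complex.cosh (t₁ / 2) / Complex.sinh (t₁ / 2)) +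
        -2 * r' * (Complex.cosh (t₂ / 2) / Complex.sinh (t₂ / 2))) * ((r : ℂ) * r') ^ l /
        (Complex.sinh (t₁ / 2) ^ (n + 1) * Complex.sinh (t₂ / 2) ^ (n + 1))) *
      ((s : ℂ) ^ n * Complex.exp (-(2 * (Complex.cosh (t₁ / 2) / Complex.sinh (t₁ / 2) +
        Complex.cosh (t₂ / 2) / Complex.sinh (t₂ / 2))) * s) *
      ((∑' j : ℕ, (4 * r / Complex.sinh (t₁ / 2) ^ 2 * s) ^ j * aux_c n j) *
        (∑' k : ℕ, (4 * r' / Complex.sinh (t₂ / 2) ^ 2 * s) ^ k * aux_c n k))) := by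
    intro s hs
    rw [aux_Kl m l hm _ r s hr hs, aux_Kl m l hm _ s r' hs hr', ← hn, hn1]
    rw [show 4 * (r : ℂ) * s / Complex.sinh (t₁ / 2) ^ 2 = 4 * r / Complex.sinh (t₁ / 2) ^ 2 * s
      by ring, show 4 * (s : ℂ) * r' / Complex.sinh (t₂ / 2) ^ 2 =
        4 * r' / Complex.sinh (t₂ / 2) ^ 2 * s by ring]
    generalize (∑' j : ℕ, (4 * r / Complex.sinh (t₁ / 2) ^ 2 * s) ^ j * aux_c n j) = A
    generalize (∑' j : ℕ, (4 * r' / Complex.sinh (t₂ / 2) ^ 2 * s) ^ j * aux_c n j) = B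
    have hE : Complex.exp (-2 * (r + s) * (Complex.cosh (t₁/2) / Complex.sinh (t₁/2))) *
        Complex.exp (-2 * (s + r') * (Complex.cosh (t₂/2) / Complex.sinh (t₂/2))) =
        Complex.exp (-2 * r * (Complex.cosh (t₁ / 2) / Complex.sinh (t₁ / 2)) +
          -2 * r' * (Complex.cosh (t₂ / 2) / Complex.sinh (t₂ / 2))) *
        Complex.exp (-(2 * (Complex.cosh (t₁ / 2) / Complex.sinh (t₁ / 2) +
          Complex.cosh (t₂ / 2) / Complex.sinh (t₂ / 2))) * s) := by
      rw [← Complex.exp_add, ← Complex.exp_add]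
      congr 1
      ring
    have hsn : (s : ℂ) ^ n = s ^ (m - 2) * (s ^ l * s ^ l) := by
      rw [← pow_add, ← pow_add, hn]
      congr 1
      omega
    rw [hsn, mul_pow, mul_pow, mul_pow]
    linear_combination (2 ^ (2 * (n + 1)) * (r : ℂ) ^ l * r' ^ l * s ^ l * s ^ l * s ^ (m - 2) *
      A * B / (Complex.sinh (t₁ / 2) ^ (n + 1) * Complex.sinh (t₂ / 2) ^ (n + 1))) * hE
  rw [setIntegral_congr_fun measurableSet_Ioi hpt, integral_const_mul, hmain]
  clear hmain hpt h1p h2p h3p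
  have hp : 2 * (Complex.cosh (t₁ / 2) / Complex.sinh (t₁ / 2) +
      Complex.cosh (t₂ / 2) / Complex.sinh (t₂ / 2)) =
      2 * Complex.sinh ((t₁ + t₂) / 2) / (Complex.sinh (t₁ / 2) * Complex.sinh (t₂ / 2)) := by
    rw [hS]
    field_simp
    ring
  rw [hp]
  have hE : Complex.exp (-2 * r * (Complex.cosh (t₁ / 2) / Complex.sinh (t₁ / 2)) +
        -2 * r' * (Complex.cosh (t₂ / 2) / Complex.sinh (t₂ / 2))) *
      (Complex.exp (4 * r / Complex.sinh (t₁ / 2) ^ 2 /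
        (2 * Complex.sinh ((t₁ + t₂) / 2) / (Complex.sinh (t₁ / 2) * Complex.sinh (t₂ / 2)))) *
       Complex.exp (4 * r' / Complex.sinh (t₂ / 2) ^ 2 /
        (2 * Complex.sinh ((t₁ + t₂) / 2) / (Complex.sinh (t₁ / 2) * Complex.sinh (t₂ / 2))))) =
      Complex.exp (-2 * (r + r') *
        (Complex.cosh ((t₁ + t₂) / 2) / Complex.sinh ((t₁ + t₂) / 2))) := by
    rw [← Complex.exp_add, ← Complex.exp_add]
    congr 1
    generalize Complex.sinh ((t₁ + t₂) / 2) = σ at *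
    generalize Complex.cosh ((t₁ + t₂) / 2) = c at *
    generalize Complex.sinh (t₁ / 2) = σ₁ at *
    generalize Complex.sinh (t₂ / 2) = σ₂ at *
    generalize Complex.cosh (t₁ / 2) = c₁ at *
    generalize Complex.cosh (t₂ / 2) = c₂ at *
    have g1 : -2 * (r : ℂ) * (c₁ / σ₁) + 4 * r / σ₁ ^ 2 / (2 * σ / (σ₁ * σ₂)) =
        -2 * r * (c / σ) := by
      field_simp
      linear_combination 4 * r * hC1
    have g2 : -2 * (r' : ℂ) * (c₂ / σ₂) + 4 * r' / σ₂ ^ 2 / (2 * σ / (σ₁ * σ₂)) =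
        -2 * r' * (c / σ) := by
      field_simp
      linear_combination 4 * r' * hC2
    linear_combination g1 + g2
  have hX : 4 * (r : ℂ) / Complex.sinh (t₁ / 2) ^ 2 /
        (2 * Complex.sinh ((t₁ + t₂) / 2) / (Complex.sinh (t₁ / 2) * Complex.sinh (t₂ / 2))) *
      (4 * r' / Complex.sinh (t₂ / 2) ^ 2 /
        (2 * Complex.sinh ((t₁ + t₂) / 2) / (Complex.sinh (t₁ / 2) * Complex.sinh (t₂ / 2)))) =
      4 * r * r' / Complex.sinh ((t₁ + t₂) / 2) ^ 2 := by
    field_simp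
    ring
  rw [hX, ← hE]
  generalize (∑' i : ℕ, (4 * (r : ℂ) * r' / Complex.sinh ((t₁ + t₂) / 2) ^ 2) ^ i * aux_c n i) = A
  rw [div_pow, mul_pow, mul_pow, pow_mul']
  field_simp
  ring
end

section
/- (Weber's second exponential integral) Let ν be a positive integer and let ρ, α, β > 0 be real numbers. Then ∫_0^∞ e^{-ρx²}·J_ν(αx)·J_ν(βx)·x dx = (1/(2ρ))·exp(-(α²+β²)/(4ρ))·I_ν(αβ/(2ρ)). -/
open MeasureTheory

/-- `J̃_ν(x) = Σ_{k=0}^∞ (-1)^k (x/2)^{2k}/(k!·Γ(ν+k+1))`. -/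
noncomputable def JtildeR (ν : ℝ) (x : ℝ) : ℝ :=
  ∑' k : ℕ, (-1 : ℝ) ^ k * (x / 2) ^ (2 * k) /
    ((Nat.factorial k : ℝ) * Real.Gamma (ν + k + 1))

/-- The Bessel function `J_ν(x) = (x/2)^ν J̃_ν(x)` (for `x > 0`). -/
noncomputable def besselJ (ν : ℝ) (x : ℝ) : ℝ :=
  (x / 2) ^ ν * JtildeR ν x

/-- `Ĩ_ν(x) = Σ_{k=0}^∞ (x/2)^{2k}/(k!·Γ(ν+k+1))`. -/
noncomputable def ItildeR (ν : ℝ) (x : ℝ) : ℝ :=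
  ∑' k : ℕ, (x / 2) ^ (2 * k) / ((Nat.factorial k : ℝ) * Real.Gamma (ν + k + 1))

/-- The modified Bessel function `I_ν(x) = (x/2)^ν Ĩ_ν(x)` (for `x > 0`). -/
noncomputable def besselI (ν : ℝ) (x : ℝ) : ℝ :=
  (x / 2) ^ ν * ItildeR ν x

lemma weber_coeff (ν j k : ℕ) :
    ((ν + j + k).factorial : ℝ) / (j.factorial * k.factorial * (ν + j).factorial * (ν + k).factorial)
      = ∑ m ∈ Finset.range (k + 1), if m ≤ j then
        1 / ((m.factorial : ℝ) * (ν + m).factorial * (j - m).factorial * (k - m).factorial) else 0 := by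
  have h1 : ((ν + j + k).factorial : ℝ) /
      (j.factorial * k.factorial * (ν + j).factorial * (ν + k).factorial)
      = ((j + (ν + k)).choose k : ℝ) / (j.factorial * (ν + k).factorial) := by
    rw [Nat.cast_choose ℝ (by omega : k ≤ j + (ν + k))]
    rw [show j + (ν + k) - k = ν + j by omega, show j + (ν + k) = ν + j + k by omega]
    field_simp
  rw [h1, Nat.add_choose_eq, Finset.Nat.sum_antidiagonal_eq_sum_range_succ_mk]
  push_cast
  rw [Finset.sum_div]
  refine Finset.sum_congr rfl fun m hm => ?_
  have hmk : m ≤ k := by simpa [Nat.lt_succ_iff] using hm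
  split_ifs with hmj
  · rw [Nat.cast_choose ℝ hmj, Nat.cast_choose ℝ (by omega : k - m ≤ ν + k)]
    rw [show ν + k - (k - m) = ν + m by omega]
    field_simp
  · rw [Nat.choose_eq_zero_of_lt (by omega)]
    simp

lemma weber_summable_I (ν : ℕ) (c : ℝ) :
    Summable fun m : ℕ => ‖c ^ m / ((m.factorial : ℝ) * (ν + m).factorial)‖ := by
  refine Summable.of_nonneg_of_le (fun _ => norm_nonneg _) (fun m => ?_)
    (Real.summable_pow_div_factorial |c|)
  rw [Real.norm_eq_abs, abs_div, abs_pow]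
  have h1 : (1 : ℝ) ≤ (ν + m).factorial := by exact_mod_cast Nat.factorial_pos _
  have h2 : (0 : ℝ) < m.factorial := by exact_mod_cast Nat.factorial_pos _
  rw [abs_of_nonneg (by positivity : (0 : ℝ) ≤ (m.factorial : ℝ) * (ν + m).factorial)]
  gcongr
  nlinarith

set_option maxHeartbeats 2000000 in
lemma weber_double (ν : ℕ) (a b : ℝ) :
    HasSum (fun p : ℕ × ℕ => a ^ p.1 * b ^ p.2 * (((ν + p.1 + p.2).factorial : ℝ) /
      (p.1.factorial * p.2.factorial * (ν + p.1).factorial * (ν + p.2).factorial)))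
      ((∑' m : ℕ, (a * b) ^ m / ((m.factorial : ℝ) * (ν + m).factorial)) *
        (Real.exp a * Real.exp b)) := by
  have he : ∀ x : ℝ, HasSum (fun n : ℕ => x ^ n / (n.factorial : ℝ)) (Real.exp x) := by
    intro x
    rw [Real.exp_eq_exp_ℝ]
    exact NormedSpace.expSeries_div_hasSum_exp x
  have hn : ∀ x : ℝ, Summable (fun n : ℕ => ‖x ^ n / (n.factorial : ℝ)‖) := fun x =>
    (Real.summable_pow_div_factorial x).norm
  have h2 := (he a).mul (he b) (summable_mul_of_summable_norm (hn a) (hn b))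
  have h3 := (weber_summable_I ν (a * b)).of_norm.hasSum.mul h2
    (summable_mul_of_summable_norm (weber_summable_I ν (a * b)) h2.summable.norm)
  let G : (ℕ × ℕ) × ℕ → ℝ := fun t => if t.2 ≤ t.1.1 ∧ t.2 ≤ t.1.2 then
    a ^ t.1.1 * b ^ t.1.2 * (1 / ((t.2.factorial : ℝ) * (ν + t.2).factorial *
      (t.1.1 - t.2).factorial * (t.1.2 - t.2).factorial)) else 0
  let e : ℕ × (ℕ × ℕ) → (ℕ × ℕ) × ℕ := fun s => ((s.1 + s.2.1, s.1 + s.2.2), s.1)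
  have hinj : Function.Injective e := by
    rintro ⟨m, p, q⟩ ⟨m', p', q'⟩ h
    simp only [e, Prod.mk.injEq] at h ⊢
    omega
  have h4 : HasSum G ((∑' m : ℕ, (a * b) ^ m / ((m.factorial : ℝ) * (ν + m).factorial)) *
        (Real.exp a * Real.exp b)) := by
    rw [← hinj.hasSum_iff]
    · suffices hfun : G ∘ e = fun x : ℕ × (ℕ × ℕ) => (a * b) ^ x.1 / ((x.1.factorial : ℝ) * (ν + x.1).factorial) *
          (a ^ x.2.1 / (x.2.1.factorial : ℝ) * (b ^ x.2.2 / (x.2.2.factorial : ℝ))) by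
        rw [hfun]
        exact h3
      funext ⟨m, p, q⟩
      simp only [G, e, Function.comp]
      rw [if_pos (by omega)]
      simp only [Nat.add_sub_cancel_left]
      rw [pow_add, pow_add, mul_pow]
      field_simp
    · rintro ⟨⟨j, k⟩, m⟩ h
      simp only [G]
      rw [if_neg]
      rintro ⟨h1, h2⟩
      exact h ⟨(m, j - m, k - m), by
        show ((m + (j - m), m + (k - m)), m) = ((j, k), m)
        rw [Nat.add_sub_cancel' h1, Nat.add_sub_cancel' h2]⟩
  refine h4.prod_fiberwise ?_
  rintro ⟨j, k⟩
  dsimp only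
  rw [weber_coeff, Finset.mul_sum]
  convert hasSum_sum_of_ne_finset_zero (s := Finset.range (k + 1)) (L := SummationFilter.unconditional ℕ) ?_ using 1
  · refine Finset.sum_congr rfl fun m hm => ?_
    have hmk : m ≤ k := by simpa [Nat.lt_succ_iff] using hm
    simp only [G]
    simp [hmk]
  · intro m hm
    simp only [G]
    rw [if_neg]
    simp at hm ⊢
    omega

lemma weber_moment (n : ℕ) (ρ : ℝ) (hρ : 0 < ρ) :
    ∫ x in Set.Ioi (0:ℝ), x ^ (2 * n + 1) * Real.exp (-ρ * x ^ 2) =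
      n.factorial / (2 * ρ ^ (n + 1)) := by
  have h := integral_rpow_mul_exp_neg_mul_rpow (p := 2) (q := ((2 * n + 1 : ℕ) : ℝ)) (b := ρ)
    two_pos (by have : (0:ℝ) ≤ ((2 * n + 1 : ℕ) : ℝ) := Nat.cast_nonneg _
                linarith) hρ
  simp only [Real.rpow_natCast, Real.rpow_two] at h
  rw [h, show (((2 * n + 1 : ℕ) : ℝ) + 1) / 2 = (n : ℝ) + 1 by push_cast; ring,
    show -(((2 * n + 1 : ℕ) : ℝ) + 1) / 2 = -((n + 1 : ℕ) : ℝ) by push_cast; ring,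
    Real.Gamma_nat_eq_factorial, Real.rpow_neg hρ.le, Real.rpow_natCast]
  field_simp

lemma weber_moment_int (n : ℕ) (ρ : ℝ) (hρ : 0 < ρ) :
    IntegrableOn (fun x : ℝ => x ^ (2 * n + 1) * Real.exp (-ρ * x ^ 2)) (Set.Ioi 0) := by
  by_contra h
  have h1 := integral_undef h
  rw [weber_moment n ρ hρ] at h1
  have : (0:ℝ) < n.factorial / (2 * ρ ^ (n + 1)) := by positivity
  exact this.ne' h1

lemma weber_gamma (ν k : ℕ) : Real.Gamma ((ν : ℝ) + k + 1) = (ν + k).factorial := by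
  rw [← Nat.cast_add, Real.Gamma_nat_eq_factorial]

lemma weber_J (ν : ℕ) (x : ℝ) : JtildeR ν x =
    ∑' k : ℕ, (-(x / 2) ^ 2) ^ k / ((k.factorial : ℝ) * (ν + k).factorial) := by
  unfold JtildeR
  congr 1
  funext k
  rw [weber_gamma, pow_mul, ← mul_pow]
  ring

lemma weber_I (ν : ℕ) (x : ℝ) : ItildeR ν x =
    ∑' k : ℕ, ((x / 2) ^ 2) ^ k / ((k.factorial : ℝ) * (ν + k).factorial) := by
  unfold ItildeR
  congr 1
  funext k
  rw [weber_gamma, pow_mul]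

/-- Weber's second exponential integral:
`∫_0^∞ e^{-ρx²} J_ν(αx) J_ν(βx) x dx = (1/(2ρ)) exp(-(α²+β²)/(4ρ)) I_ν(αβ/(2ρ))`. -/
theorem weber_second_exponential_integral (ν : ℕ) (hν : 0 < ν)
    (ρ α β : ℝ) (hρ : 0 < ρ) (hα : 0 < α) (hβ : 0 < β) :
    ∫ x in Set.Ioi (0:ℝ), Real.exp (-ρ * x ^ 2) * besselJ ν (α * x) * besselJ ν (β * x) * x =
      (1 / (2 * ρ)) * Real.exp (-(α ^ 2 + β ^ 2) / (4 * ρ)) * besselI ν (α * β / (2 * ρ)) := by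
  let C : ℕ × ℕ → ℝ := fun p => (α / 2) ^ ν * (β / 2) ^ ν * ((-(α / 2) ^ 2) ^ p.1 * (-(β / 2) ^ 2) ^ p.2
    / (p.1.factorial * p.2.factorial * (ν + p.1).factorial * (ν + p.2).factorial))
  let F : ℕ × ℕ → ℝ → ℝ := fun p x =>
    C p * (x ^ (2 * (ν + p.1 + p.2) + 1) * Real.exp (-ρ * x ^ 2))
  have hF : ∀ x : ℝ, Real.exp (-ρ * x ^ 2) * besselJ ν (α * x) * besselJ ν (β * x) * x
      = ∑' p, F p x := by
    intro x
    simp only [besselJ, weber_J, Real.rpow_natCast]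
    have := tsum_mul_tsum_of_summable_norm (weber_summable_I ν (-(α * x / 2) ^ 2))
      (weber_summable_I ν (-(β * x / 2) ^ 2))
    calc _ = Real.exp (-ρ * x ^ 2) * (α * x / 2) ^ ν * (β * x / 2) ^ ν * x * (
          (∑' k : ℕ, (-(α * x / 2) ^ 2) ^ k / ((k.factorial : ℝ) * (ν + k).factorial)) *
          (∑' k : ℕ, (-(β * x / 2) ^ 2) ^ k / ((k.factorial : ℝ) * (ν + k).factorial))) := by ring
      _ = _ := by
        rw [this, ← tsum_mul_left]
        congr 1
        funext ⟨j, k⟩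
        simp only [F, C]
        rw [show -(α * x / 2) ^ 2 = -(α / 2) ^ 2 * x ^ 2 by ring,
          show -(β * x / 2) ^ 2 = -(β / 2) ^ 2 * x ^ 2 by ring,
          show α * x / 2 = α / 2 * x by ring, show β * x / 2 = β / 2 * x by ring,
          mul_pow _ (x ^ 2), mul_pow _ (x ^ 2), mul_pow, mul_pow]
        have : x ^ (2 * (ν + j + k) + 1) = x ^ ν * x ^ ν * (x ^ 2) ^ j * (x ^ 2) ^ k * x := by
          ring
        rw [this]
        field_simp
  have hint : ∀ p, ∫ x in Set.Ioi (0:ℝ), F p x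
      = C p * ((ν + p.1 + p.2).factorial / (2 * ρ ^ (ν + p.1 + p.2 + 1))) := by
    intro p
    simp only [F]
    rw [integral_const_mul, weber_moment _ _ hρ]
  have hnorm : ∀ p, ∫ x in Set.Ioi (0:ℝ), ‖F p x‖
      = |C p| * ((ν + p.1 + p.2).factorial / (2 * ρ ^ (ν + p.1 + p.2 + 1))) := by
    intro p
    rw [← weber_moment _ _ hρ, ← integral_const_mul]
    refine setIntegral_congr_fun measurableSet_Ioi fun x hx => ?_
    have hx : 0 < x := hx
    simp only [F]
    rw [Real.norm_eq_abs, abs_mul]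
    congr 1
    exact abs_of_nonneg (by positivity)
  have heq : ∀ p : ℕ × ℕ, C p * ((ν + p.1 + p.2).factorial / (2 * ρ ^ (ν + p.1 + p.2 + 1)))
      = (1 / (2 * ρ) * (α * β / (4 * ρ)) ^ ν) * ((-(α ^ 2 / (4 * ρ))) ^ p.1 * (-(β ^ 2 / (4 * ρ))) ^ p.2
        * (((ν + p.1 + p.2).factorial : ℝ) /
      (p.1.factorial * p.2.factorial * (ν + p.1).factorial * (ν + p.2).factorial))) := by
    rintro ⟨j, k⟩
    simp only [C]
    rw [show α * β / (4 * ρ) = (α / 2) * (β / 2) * ρ⁻¹ by field_simp; norm_num,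
      show -(α ^ 2 / (4 * ρ)) = -(α / 2) ^ 2 * ρ⁻¹ by field_simp; norm_num,
      show -(β ^ 2 / (4 * ρ)) = -(β / 2) ^ 2 * ρ⁻¹ by field_simp; norm_num]
    simp only [mul_pow _ ρ⁻¹, mul_pow (α / 2) (β / 2), pow_add, inv_pow]
    field_simp
  have hS := (weber_double ν (-(α ^ 2 / (4 * ρ))) (-(β ^ 2 / (4 * ρ)))).mul_left
    (1 / (2 * ρ) * (α * β / (4 * ρ)) ^ ν)
  have hI := hasSum_integral_of_summable_integral_norm (μ := volume.restrict (Set.Ioi (0:ℝ))) (F := F)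
    (fun p => (weber_moment_int _ ρ hρ).const_mul (C p)) (by
      refine hS.summable.norm.congr fun p => ?_
      rw [hnorm, ← heq, Real.norm_eq_abs, abs_mul]
      congr 1
      exact abs_of_nonneg (by positivity))
  simp only [hint, heq] at hI
  simp only [hF]
  rw [hI.unique hS]
  simp only [besselI, weber_I, Real.rpow_natCast]
  rw [← Real.exp_add, show -(α ^ 2 / (4 * ρ)) + -(β ^ 2 / (4 * ρ)) = -(α ^ 2 + β ^ 2) / (4 * ρ) by ring,
    show -(α ^ 2 / (4 * ρ)) * -(β ^ 2 / (4 * ρ)) = (α * β / (2 * ρ) / 2) ^ 2 by field_simp; norm_num,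
    show α * β / (2 * ρ) / 2 = α * β / (4 * ρ) by field_simp; norm_num]
  ring
end

section
/- Let ν ≥ -1/2 be real, l ∈ ℕ, and α ∈ ℂ. Then ∫_0^π Ĩ_ν(α√(1+cos θ))·C̃_l^{ν+1/2}(cos θ)·sin^{2ν+1}θ dθ = (2^{1-l}·√π·Γ(2ν+l+1)/l!)·α^{2l}·Ĩ_{2ν+2l+1}(√2·α). (For α > 0 this is equivalent to ∫_0^π I_ν(α√(1+cosθ))·C̃_l^{ν+1/2}(cosθ)·(1+cosθ)^{-ν/2}·sin^{2ν+1}θ dθ = 2^{3/2}√π·Γ(2ν+l+1)·I_{2ν+2l+1}(√2 α)/(α^{ν+1}·l!).) -/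
open MeasureTheory

/-- The Gegenbauer polynomial `C_l^μ(x)` given by the Rodrigues formula. -/
noncomputable def gegenC (μ : ℝ) (l : ℕ) (x : ℝ) : ℝ :=
  (-1/2 : ℝ) ^ l *
    ((ascPochhammer ℝ l).eval (2 * μ) /
      ((Nat.factorial l : ℝ) * (ascPochhammer ℝ l).eval (μ + 1/2))) *
    (1 - x ^ 2) ^ (-μ + 1/2) *
    iteratedDeriv l (fun y : ℝ => (1 - y ^ 2) ^ ((l : ℝ) + μ - 1/2)) x

/-- The normalized Gegenbauer polynomial `C̃_l^μ(x) = Γ(μ)·C_l^μ(x)` for `μ ≠ 0`,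
with the limit value `C̃_l^0(cos θ) = 2cos(lθ)/l` at `μ = 0`. -/
noncomputable def gegenTilde (μ : ℝ) (l : ℕ) (x : ℝ) : ℝ :=
  if μ = 0 then (2 / l) * Real.cos (l * Real.arccos x)
  else Real.Gamma μ * gegenC μ l x

lemma aux_beta (a b : ℝ) (ha : 0 < a) (hb : 0 < b) :
    ∫ x in (0:ℝ)..1, x ^ (a - 1) * (1 - x) ^ (b - 1) =
      Real.Gamma a * Real.Gamma b / Real.Gamma (a + b) := by
  have h := Complex.betaIntegral_eq_Gamma_mul_div (a : ℂ) (b : ℂ) (by simpa) (by simpa)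
  rw [Complex.betaIntegral] at h
  have h2 : ∫ x in (0:ℝ)..1, ((x:ℂ) ^ ((a:ℂ) - 1) * (1 - (x:ℂ)) ^ ((b:ℂ) - 1)) =
      ∫ x in (0:ℝ)..1, ((x ^ (a - 1) * (1 - x) ^ (b - 1) : ℝ) : ℂ) := by
    apply intervalIntegral.integral_congr
    intro x hx
    rw [Set.uIcc_of_le zero_le_one] at hx
    simp only
    rw [Complex.ofReal_mul, Complex.ofReal_cpow hx.1, Complex.ofReal_cpow (by linarith [hx.2])]
    push_cast
    rfl
  rw [h2, intervalIntegral.integral_ofReal, ← Complex.ofReal_add, Complex.Gamma_ofReal,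
    Complex.Gamma_ofReal, Complex.Gamma_ofReal] at h
  exact_mod_cast h

lemma aux_moment (m : ℕ) (t : ℝ) (ht : -1 < t) :
    ∫ θ in (0:ℝ)..Real.pi, (1 + Real.cos θ) ^ m * Real.sin θ ^ (2 * t + 1) =
      2 ^ m * 2 ^ (2 * t + 1) * (Real.Gamma (m + t + 1) * Real.Gamma (t + 1) /
        Real.Gamma (m + 2 * t + 2)) := by
  have hm : (0:ℝ) ≤ m := Nat.cast_nonneg m
  have hb := aux_beta (m + t + 1) (t + 1) (by linarith) (by linarith)
  have hs := integral_Icc_deriv_smul_of_deriv_nonpos (a := 0) (b := Real.pi)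
    (f := fun θ => (1 + Real.cos θ) / 2) (f' := fun θ => - Real.sin θ / 2)
    (g := fun x => x ^ ((m + t + 1) - 1 : ℝ) * (1 - x) ^ ((t + 1) - 1))
    (by fun_prop)
    (fun x _ => by
      have := ((Real.hasDerivAt_cos x).const_add 1).div_const 2
      simpa using this)
    (fun x hx => by
      have := Real.sin_pos_of_pos_of_lt_pi hx.1 hx.2
      linarith) Real.pi_pos.le
  simp only [Real.cos_zero, Real.cos_pi] at hs
  norm_num at hs
  rw [integral_Icc_eq_integral_Ioc, integral_Icc_eq_integral_Ioc,
    ← intervalIntegral.integral_of_le zero_le_one,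
    ← intervalIntegral.integral_of_le Real.pi_pos.le] at hs
  norm_num at hb
  rw [hb] at hs
  rw [show (m:ℝ) + 2 * t + 2 = m + t + 1 + (t + 1) by ring, ← neg_neg (_ / _), ← hs,
    ← intervalIntegral.integral_neg, ← intervalIntegral.integral_const_mul]
  apply intervalIntegral.integral_congr_Ioo_of_le Real.pi_pos.le
  intro θ hθ
  simp only
  have hsin := Real.sin_pos_of_pos_of_lt_pi hθ.1 hθ.2
  have h1 : 0 < 1 + Real.cos θ := by nlinarith [Real.sin_sq_add_cos_sq θ, Real.cos_le_one θ]
  have h2 : 0 < 1 - Real.cos θ := by nlinarith [Real.sin_sq_add_cos_sq θ, Real.neg_one_le_cos θ]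
  have h3 : (1 + Real.cos θ) * (1 - Real.cos θ) = Real.sin θ ^ 2 := by
    nlinarith [Real.sin_sq_add_cos_sq θ]
  have e1 : 1 - (1 + Real.cos θ) / 2 = (1 - Real.cos θ) / 2 := by ring
  have e2 : Real.sin θ ^ (2 * t + 1) =
      (1 + Real.cos θ) ^ t * (1 - Real.cos θ) ^ t * Real.sin θ := by
    rw [← Real.mul_rpow h1.le h2.le, h3, Real.rpow_add hsin, Real.rpow_mul hsin.le,
      Real.rpow_one]
    norm_num
  rw [e1, e2, Real.div_rpow h1.le (by norm_num), Real.div_rpow h2.le (by norm_num),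
    Real.rpow_add h1, Real.rpow_add two_pos (m:ℝ), Real.rpow_natCast, Real.rpow_natCast,
    Real.rpow_add two_pos, two_mul t, Real.rpow_add two_pos, Real.rpow_one]
  have := Real.rpow_pos_of_pos (two_pos (α := ℝ)) t
  field_simp

open Polynomial in
/-- Polynomials with `D^n (1-x²)^s = P_n(x) (1-x²)^{s-n}`. -/
noncomputable def auxP (s : ℝ) : ℕ → Polynomial ℝ
  | 0 => 1
  | n + 1 => derivative (auxP s n) * (1 - X ^ 2) - C (2 * (s - n)) * X * auxP s n

lemma aux_iter (s : ℝ) (n : ℕ) : ∀ x ∈ Set.Ioo (-1:ℝ) 1,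
    iteratedDeriv n (fun y : ℝ => (1 - y ^ 2) ^ s) x =
      (auxP s n).eval x * (1 - x ^ 2) ^ (s - n) := by
  induction n with
  | zero => intro x hx; simp [auxP]
  | succ n ih =>
    intro x hx
    have hpos : 0 < 1 - x ^ 2 := by nlinarith [hx.1, hx.2]
    rw [iteratedDeriv_succ]
    have hev : iteratedDeriv n (fun y : ℝ => (1 - y ^ 2) ^ s) =ᶠ[nhds x]
        fun y => (auxP s n).eval y * (1 - y ^ 2) ^ (s - n) := by
      filter_upwards [isOpen_Ioo.mem_nhds hx] with y hy using ih y hy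
    rw [hev.deriv_eq]
    have hd : HasDerivAt (fun y : ℝ => 1 - y ^ 2) (-(2 * x)) x := by
      simpa using (hasDerivAt_pow 2 x).const_sub 1
    have hd2 := ((auxP s n).hasDerivAt x).mul (hd.rpow_const (p := s - n) (Or.inl hpos.ne'))
    refine hd2.deriv.trans ?_
    have e : (1 - x ^ 2) ^ (s - n) = (1 - x ^ 2) ^ (s - n - 1) * (1 - x ^ 2) := by
      rw [Real.rpow_sub_one hpos.ne']; field_simp
    rw [e, Nat.cast_add_one, show s - ((n:ℝ) + 1) = s - n - 1 by ring]
    simp [auxP]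
    ring

lemma aux_ibp (s : ℝ) (n : ℕ) (hn : 0 ≤ 2 * (s - n) + 1) : ∀ Q : Polynomial ℝ,
    ∫ θ in (0:ℝ)..Real.pi, Q.eval (Real.cos θ) *
        ((auxP s n).eval (Real.cos θ) * Real.sin θ ^ (2 * (s - n) + 1)) =
      (-1) ^ n * ∫ θ in (0:ℝ)..Real.pi,
        (Polynomial.derivative^[n] Q).eval (Real.cos θ) * Real.sin θ ^ (2 * s + 1) := by
  induction n with
  | zero => intro Q; simp [auxP]
  | succ n ih =>
    intro Q
    push_cast at hn ⊢
    have hp : 0 < 2 * (s - n) := by linarith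
    have ih' := ih (by linarith) (Polynomial.derivative Q)
    rw [Function.iterate_succ_apply, pow_succ, mul_assoc, mul_comm (-1:ℝ), ← mul_assoc, ← ih']
    have c1 : Continuous fun θ : ℝ => Real.sin θ ^ (2 * (s - (n + 1)) + 1) :=
      Real.continuous_sin.rpow_const fun _ => Or.inr hn
    have c2 : Continuous fun θ : ℝ => Real.sin θ ^ (2 * (s - n) + 1) :=
      Real.continuous_sin.rpow_const fun _ => Or.inr (by linarith)
    have c3 : Continuous fun θ : ℝ => Real.sin θ ^ (2 * (s - n)) :=
      Real.continuous_sin.rpow_const fun _ => Or.inr hp.le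
    have cp : ∀ R : Polynomial ℝ, Continuous fun θ : ℝ => R.eval (Real.cos θ) :=
      fun R => R.continuous.comp Real.continuous_cos
    have k1 : Continuous fun θ : ℝ => Q.eval (Real.cos θ) *
        ((auxP s (n+1)).eval (Real.cos θ) * Real.sin θ ^ (2 * (s - (n + 1)) + 1)) := (cp Q).mul ((cp (auxP s (n+1))).mul c1)
    have k2 : Continuous fun θ : ℝ => (Polynomial.derivative Q).eval (Real.cos θ) *
        ((auxP s n).eval (Real.cos θ) * Real.sin θ ^ (2 * (s - n) + 1)) := (cp (Polynomial.derivative Q)).mul ((cp (auxP s n)).mul c2)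
    have hftc := intervalIntegral.integral_eq_sub_of_hasDerivAt_of_le Real.pi_pos.le
      (f := fun θ => Q.eval (Real.cos θ) *
        ((auxP s n).eval (Real.cos θ) * Real.sin θ ^ (2 * (s - n))))
      (f' := fun θ => -(Q.eval (Real.cos θ) *
        ((auxP s (n+1)).eval (Real.cos θ) * Real.sin θ ^ (2 * (s - (n + 1)) + 1)) +
        (Polynomial.derivative Q).eval (Real.cos θ) *
        ((auxP s n).eval (Real.cos θ) * Real.sin θ ^ (2 * (s - n) + 1))))
      ((cp Q).mul ((cp (auxP s n)).mul c3)).continuousOn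
      (fun x hx => by
        have hsin := Real.sin_pos_of_pos_of_lt_pi hx.1 hx.2
        have d1 := (Q.hasDerivAt (Real.cos x)).comp x (Real.hasDerivAt_cos x)
        have d2 := ((auxP s n).hasDerivAt (Real.cos x)).comp x (Real.hasDerivAt_cos x)
        have d3 := (Real.hasDerivAt_sin x).rpow_const (p := 2 * (s - n)) (Or.inl hsin.ne')
        refine (d1.mul (d2.mul d3)).congr_deriv ?_
        have e1 : Real.sin x ^ (2 * (s - (n + 1)) + 1) = Real.sin x ^ (2 * (s - n) - 1) := by
          congr 1; ring
        have e2 : Real.sin x ^ (2 * (s - n)) = Real.sin x ^ (2 * (s - n) - 1) * Real.sin x := by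
          rw [Real.rpow_sub_one hsin.ne']; field_simp
        have e3 : Real.sin x ^ (2 * (s - n) + 1) =
            Real.sin x ^ (2 * (s - n) - 1) * Real.sin x * Real.sin x := by
          rw [Real.rpow_add_one hsin.ne', e2]
        have e4 : 1 - Real.cos x ^ 2 = Real.sin x * Real.sin x := by
          nlinarith [Real.sin_sq_add_cos_sq x]
        simp only [Function.comp_apply, Pi.mul_apply]
        rw [e1, e3, e2]
        simp only [auxP, Polynomial.eval_sub, Polynomial.eval_mul, Polynomial.eval_one,
          Polynomial.eval_pow, Polynomial.eval_X, Polynomial.eval_C, e4]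
        ring)
      ((k1.add k2).neg.intervalIntegrable _ _)
    rw [intervalIntegral.integral_neg, intervalIntegral.integral_add
      (k1.intervalIntegrable _ _) (k2.intervalIntegrable _ _)] at hftc
    simp only [Real.sin_pi, Real.sin_zero, Real.zero_rpow hp.ne', mul_zero, sub_zero] at hftc
    linarith

lemma aux_J (ν : ℝ) (hν : -1/2 < ν) (l k : ℕ) :
    ∫ θ in (0:ℝ)..Real.pi, (1 + Real.cos θ) ^ k *
        ((auxP (l + ν) l).eval (Real.cos θ) * Real.sin θ ^ (2 * ν + 1)) =
      (-1) ^ l * (k.descFactorial l * (2 ^ (k - l) * 2 ^ (2 * (l + ν) + 1) *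
        (Real.Gamma ((k - l : ℕ) + (l + ν) + 1) * Real.Gamma (l + ν + 1) /
        Real.Gamma ((k - l : ℕ) + 2 * (l + ν) + 2)))) := by
  have hl : (0:ℝ) ≤ l := Nat.cast_nonneg l
  have h := aux_ibp (l + ν) l (by ring_nf; linarith)
    ((Polynomial.X + Polynomial.C 1) ^ k)
  rw [Polynomial.iterate_derivative_X_add_pow] at h
  rw [← aux_moment (k - l) (l + ν) (by linarith), ← intervalIntegral.integral_const_mul]
  simp only [add_sub_cancel_left, Polynomial.eval_pow, Polynomial.eval_add, Polynomial.eval_X,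
    Polynomial.eval_C, nsmul_eq_mul, Polynomial.eval_mul,
    Polynomial.eval_natCast, add_comm (Real.cos _) 1, mul_assoc] at h
  exact h

lemma aux_cos (k : ℕ) : ∀ l : ℕ,
    ∫ θ in (0:ℝ)..Real.pi, (1 + Real.cos θ) ^ k * Real.cos (l * θ) =
      Real.pi * (1/2) ^ k * ((2 * k).choose (k + l) : ℕ) := by
  induction k with
  | zero =>
    intro l
    rcases Nat.eq_zero_or_pos l with rfl | hl
    · simp
    · have hl' : (l:ℝ) ≠ 0 := by positivity
      simp [intervalIntegral.integral_comp_mul_left (fun x => Real.cos x) hl',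
        Real.sin_nat_mul_pi, Nat.choose_eq_zero_of_lt hl]
  | succ k ih =>
    intro l
    have ii : ∀ j : ℕ, IntervalIntegrable
        (fun θ : ℝ => (1 + Real.cos θ) ^ k * Real.cos (j * θ)) volume 0 Real.pi := fun j =>
      Continuous.intervalIntegrable (by fun_prop) _ _
    rcases l with _ | l
    · have e : (fun θ : ℝ => (1 + Real.cos θ) ^ (k+1) * Real.cos ((0:ℕ) * θ)) = fun θ =>
        (1 + Real.cos θ) ^ k * Real.cos ((0:ℕ) * θ) +
        (1 + Real.cos θ) ^ k * Real.cos ((1:ℕ) * θ) := by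
        funext θ; simp; ring
      rw [e, intervalIntegral.integral_add (ii 0) (ii 1), ih, ih]
      have hc : (2 * (k+1)).choose (k + 1 + 0) =
          2 * ((2*k).choose (k+0) + (2*k).choose (k+1)) := by
        have h1 : (2*k+1).choose k = (2*k+1).choose (k+1) := by
          rw [← Nat.choose_symm_of_eq_add]; omega
        rw [show 2 * (k+1) = 2*k+1+1 by ring, add_zero, Nat.choose_succ_succ, h1,
          Nat.choose_succ_succ]; simp; ring
      rw [hc]; push_cast; ring
    · have e : (fun θ : ℝ => (1 + Real.cos θ) ^ (k+1) * Real.cos ((l+1:ℕ) * θ)) = fun θ =>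
        (1 + Real.cos θ) ^ k * Real.cos ((l+1:ℕ) * θ) +
        (1/2) * ((1 + Real.cos θ) ^ k * Real.cos ((l+2:ℕ) * θ) +
        (1 + Real.cos θ) ^ k * Real.cos ((l:ℕ) * θ)) := by
        funext θ
        have e1 : ((l+2:ℕ):ℝ) * θ = (l+1:ℕ) * θ + θ := by push_cast; ring
        have e2 : ((l:ℕ):ℝ) * θ = (l+1:ℕ) * θ - θ := by push_cast; ring
        rw [e1, e2, Real.cos_add, Real.cos_sub]; ring
      rw [e, intervalIntegral.integral_add (ii _) (((ii _).add (ii _)).const_mul _),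
        intervalIntegral.integral_const_mul, intervalIntegral.integral_add (ii _) (ii _),
        ih, ih, ih]
      have hc : (2 * (k+1)).choose (k + 1 + (l+1)) =
          (2*k).choose (k+l) + 2 * (2*k).choose (k+(l+1)) + (2*k).choose (k+(l+2)) := by
        rw [show 2 * (k+1) = 2*k+1+1 by ring, show k + 1 + (l+1) = k+l+1+1 by ring,
          Nat.choose_succ_succ, Nat.choose_succ_succ, Nat.choose_succ_succ]
        simp only [Nat.succ_eq_add_one, ← add_assoc]; ring
      rw [hc]; push_cast; ring

lemma aux_gamma_asc (x : ℝ) (hx : 0 < x) (n : ℕ) :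
    Real.Gamma (x + n) = (ascPochhammer ℝ n).eval x * Real.Gamma x := by
  induction n with
  | zero => simp
  | succ n ih =>
    have hn : (0:ℝ) ≤ n := Nat.cast_nonneg n
    rw [Nat.cast_add_one, ← add_assoc, Real.Gamma_add_one (by linarith), ih,
      ascPochhammer_succ_eval]
    ring

lemma aux_gamma_low (ν : ℝ) (hν : -1/2 ≤ ν) (k : ℕ) :
    Real.Gamma (ν + 1) ≤ 2 ^ k * Real.Gamma (ν + k + 1) := by
  induction k with
  | zero => simp
  | succ k ih =>
    have hk : (0:ℝ) ≤ k := Nat.cast_nonneg k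
    have hg : 0 < Real.Gamma (ν + k + 1) := Real.Gamma_pos_of_pos (by linarith)
    rw [Nat.cast_add_one, ← add_assoc, Real.Gamma_add_one (s := ν + k + 1) (by linarith), pow_succ]
    have : 2 ^ k * Real.Gamma (ν + k + 1) * 1 ≤
        2 ^ k * Real.Gamma (ν + k + 1) * (2 * (ν + k + 1)) := by
      apply mul_le_mul_of_nonneg_left _ (by positivity)
      linarith
    linarith

lemma aux_summable (ν : ℝ) (hν : -1/2 ≤ ν) (c : ℝ) (hc : 0 ≤ c) :
    Summable fun k : ℕ => c ^ k / (k.factorial * Real.Gamma (ν + k + 1)) := by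
  have hg0 : 0 < Real.Gamma (ν + 1) := Real.Gamma_pos_of_pos (by linarith)
  have hs := (Real.summable_pow_div_factorial (2 * c)).mul_right (Real.Gamma (ν + 1))⁻¹
  have hg : ∀ k : ℕ, 0 < Real.Gamma (ν + k + 1) := fun k => by
    have hk : (0:ℝ) ≤ k := Nat.cast_nonneg k
    exact Real.Gamma_pos_of_pos (by linarith)
  refine Summable.of_nonneg_of_le (fun k => ?_) (fun k => ?_) hs
  · have := hg k
    positivity
  · have h1 := hg k
    have h2 := aux_gamma_low ν hν k
    rw [mul_pow, ← div_eq_mul_inv, div_div, div_le_div_iff₀ (by positivity) (by positivity)]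
    have : c ^ k * k.factorial * Real.Gamma (ν + 1) ≤
        c ^ k * k.factorial * (2 ^ k * Real.Gamma (ν + k + 1)) :=
      mul_le_mul_of_nonneg_left h2 (by positivity)
    linarith

lemma aux_term (ν : ℝ) (α : ℂ) (c : ℝ) (hc : 0 ≤ c) (k : ℕ) :
    (α * (Real.sqrt c : ℝ) / 2) ^ (2 * k) /
      ((Nat.factorial k : ℂ) * Complex.Gamma ((ν : ℂ) + k + 1)) =
    (α ^ 2) ^ k * (((1/4) ^ k / (k.factorial * Real.Gamma (ν + k + 1)) * c ^ k : ℝ) : ℂ) := by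
  have h1 : (ν : ℂ) + k + 1 = ((ν + k + 1 : ℝ) : ℂ) := by push_cast; ring
  have h2 : ((Real.sqrt c : ℝ) : ℂ) ^ 2 = c := by
    rw [← Complex.ofReal_pow, Real.sq_sqrt hc]
  rw [h1, Complex.Gamma_ofReal, pow_mul, div_pow, mul_pow, h2, div_pow, mul_pow]
  push_cast
  rw [div_pow]
  norm_num
  ring

lemma aux_core (ν : ℝ) (hν : -1/2 ≤ ν) (l : ℕ) (α : ℂ) (W : ℝ → ℝ) (hW : Continuous W)
    (J : ℕ → ℝ) (hJ : ∀ k, ∫ θ in (0:ℝ)..Real.pi, (1 + Real.cos θ) ^ k * W θ = J k)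
    (A : ℝ) (h0 : ∀ k < l, J k = 0)
    (h1 : ∀ m : ℕ, (1/4) ^ (m + l) / ((m + l).factorial * Real.Gamma (ν + (m + l : ℕ) + 1)) *
      J (m + l) = A * ((1/2) ^ m / (m.factorial * Real.Gamma (2 * ν + 2 * l + 1 + m + 1)))) :
    ∫ θ in (0:ℝ)..Real.pi, ItildeC ν (α * (Real.sqrt (1 + Real.cos θ) : ℝ)) * (W θ : ℂ) =
      (A : ℂ) * α ^ (2 * l) * ItildeC (2 * ν + 2 * l + 1) ((Real.sqrt 2 : ℝ) * α) := by
  have hcos : ∀ θ : ℝ, 0 ≤ 1 + Real.cos θ := fun θ => by linarith [Real.neg_one_le_cos θ]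
  obtain ⟨M, hM⟩ := (isCompact_Icc (a := (0:ℝ)) (b := Real.pi)).exists_bound_of_continuousOn
    hW.continuousOn
  set a : ℕ → ℝ := fun k => (1/4) ^ k / (k.factorial * Real.Gamma (ν + k + 1)) with ha
  have hapos : ∀ k, 0 ≤ a k := fun k => by
    have hk : (0:ℝ) ≤ k := Nat.cast_nonneg k
    have := Real.Gamma_pos_of_pos (show 0 < ν + k + 1 by linarith)
    simp only [ha]
    positivity
  have hbs : Summable fun k : ℕ => (‖α‖ ^ 2) ^ k * (a k * 2 ^ k) * M := by
    have := (aux_summable ν hν (‖α‖ ^ 2 * (1/4) * 2) (by positivity)).mul_right M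
    refine this.congr fun k => ?_
    simp only [ha, mul_pow]
    ring
  have hnorm : ∀ (k : ℕ) (θ : ℝ), ‖(α ^ 2) ^ k * ((a k * (1 + Real.cos θ) ^ k : ℝ) : ℂ)‖ ≤
      (‖α‖ ^ 2) ^ k * (a k * 2 ^ k) := by
    intro k θ
    rw [norm_mul, norm_pow, norm_pow, Complex.norm_real, Real.norm_of_nonneg
      (mul_nonneg (hapos k) (pow_nonneg (hcos θ) k))]
    have : (1 + Real.cos θ) ^ k ≤ 2 ^ k :=
      pow_le_pow_left₀ (hcos θ) (by linarith [Real.cos_le_one θ]) k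
    have := hapos k
    gcongr
  have hsum : HasSum (fun k : ℕ => ∫ θ in (0:ℝ)..Real.pi,
      (α ^ 2) ^ k * ((a k * (1 + Real.cos θ) ^ k : ℝ) : ℂ) * (W θ : ℂ))
      (∫ θ in (0:ℝ)..Real.pi, ItildeC ν (α * (Real.sqrt (1 + Real.cos θ) : ℝ)) * (W θ : ℂ)) := by
    apply intervalIntegral.hasSum_integral_of_dominated_convergence
      (fun k _ => (‖α‖ ^ 2) ^ k * (a k * 2 ^ k) * M)
    · intro k
      apply Continuous.aestronglyMeasurable
      fun_prop
    · intro k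
      refine Filter.Eventually.of_forall fun θ hθ => ?_
      rw [Set.uIoc_of_le Real.pi_pos.le] at hθ
      rw [norm_mul, Complex.norm_real]
      exact mul_le_mul (hnorm k θ) (hM θ ⟨hθ.1.le, hθ.2⟩) (norm_nonneg _)
        (mul_nonneg (by positivity) (mul_nonneg (hapos k) (by positivity)))
    · exact Filter.Eventually.of_forall fun θ _ => hbs
    · exact intervalIntegrable_const
    · refine Filter.Eventually.of_forall fun θ hθ => ?_
      apply HasSum.mul_right
      have hs : Summable fun k : ℕ => (α ^ 2) ^ k * ((a k * (1 + Real.cos θ) ^ k : ℝ) : ℂ) := by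
        refine Summable.of_norm_bounded ?_ (fun k => hnorm k θ)
        have := aux_summable ν hν (‖α‖ ^ 2 * (1/4) * 2) (by positivity)
        refine this.congr fun k => ?_
        simp only [ha, mul_pow]
        ring
      have := hs.hasSum
      rw [ItildeC]
      simp_rw [aux_term ν α _ (hcos θ)]
      exact this
  have hval : ∀ k : ℕ, ∫ θ in (0:ℝ)..Real.pi,
      (α ^ 2) ^ k * ((a k * (1 + Real.cos θ) ^ k : ℝ) : ℂ) * (W θ : ℂ) =
      (α ^ 2) ^ k * ((a k * J k : ℝ) : ℂ) := by
    intro k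
    rw [← hJ k, ← intervalIntegral.integral_const_mul, ← intervalIntegral.integral_ofReal,
      ← intervalIntegral.integral_const_mul]
    apply intervalIntegral.integral_congr
    intro θ _
    simp only
    push_cast
    ring
  simp_rw [hval] at hsum
  rw [← hsum.tsum_eq, ← hsum.summable.sum_add_tsum_nat_add l, Finset.sum_eq_zero, zero_add,
    ItildeC, ← tsum_mul_left]
  · apply tsum_congr
    intro m
    rw [mul_comm ((Real.sqrt 2 : ℝ) : ℂ) α]
    have := aux_term (2 * ν + 2 * l + 1) α 2 (by norm_num) m
    rw [this]
    simp only [ha]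
    rw [h1 m, show (1/2 : ℝ) = 1/4*2 by norm_num, mul_pow (1/4 : ℝ) 2 m]
    push_cast
    ring
  · intro k hk
    rw [h0 k (Finset.mem_range.mp hk)]
    simp

lemma aux_main_pos (ν : ℝ) (hν : -1/2 < ν) (l : ℕ) (α : ℂ) :
    ∫ θ in (0:ℝ)..Real.pi,
        ItildeC ν (α * (Real.sqrt (1 + Real.cos θ) : ℝ)) *
          (gegenTilde (ν + 1/2) l (Real.cos θ) : ℂ) *
          ((Real.sin θ ^ (2 * ν + 1) : ℝ) : ℂ) =
      (((2 : ℝ) ^ ((1 : ℝ) - l) * Real.sqrt Real.pi *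
          Real.Gamma (2 * ν + l + 1) / Nat.factorial l : ℝ) : ℂ) *
        α ^ (2 * l) * ItildeC (2 * ν + 2 * l + 1) ((Real.sqrt 2 : ℝ) * α) := by
  set K : ℝ := Real.Gamma (ν + 1/2) * ((-1/2 : ℝ) ^ l *
    ((ascPochhammer ℝ l).eval (2 * ν + 1) /
      ((Nat.factorial l : ℝ) * (ascPochhammer ℝ l).eval (ν + 1)))) with hK
  set W : ℝ → ℝ := fun θ => K * ((auxP (l + ν) l).eval (Real.cos θ) *
    Real.sin θ ^ (2 * ν + 1)) with hWdef
  have hW : Continuous W := by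
    have c1 : Continuous fun θ : ℝ => Real.sin θ ^ (2 * ν + 1) :=
      Real.continuous_sin.rpow_const fun _ => Or.inr (by linarith)
    have c2 : Continuous fun θ : ℝ => (auxP (l + ν) l).eval (Real.cos θ) :=
      (auxP (l + ν) l).continuous.comp Real.continuous_cos
    exact continuous_const.mul (c2.mul c1)
  have hcore := aux_core ν hν.le l α W hW (fun k => K * ((-1) ^ l *
      (k.descFactorial l * (2 ^ (k - l) * 2 ^ (2 * (l + ν) + 1) *
        (Real.Gamma ((k - l : ℕ) + (l + ν) + 1) * Real.Gamma (l + ν + 1) /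
        Real.Gamma ((k - l : ℕ) + 2 * (l + ν) + 2))))))
    (fun k => by
      rw [← aux_J ν hν l k, ← intervalIntegral.integral_const_mul]
      apply intervalIntegral.integral_congr
      intro θ _
      simp only [hWdef]
      ring)
    ((2 : ℝ) ^ ((1 : ℝ) - l) * Real.sqrt Real.pi *
          Real.Gamma (2 * ν + l + 1) / Nat.factorial l)
    (fun k hk => by
      simp [Nat.descFactorial_eq_zero_iff_lt.mpr hk])
    (fun m => by
      have hl : (0:ℝ) ≤ l := Nat.cast_nonneg l
      have hm : (0:ℝ) ≤ m := Nat.cast_nonneg m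
      rw [Nat.add_sub_cancel]
      have g1 := Real.Gamma_pos_of_pos (show 0 < (m:ℝ) + (l + ν) + 1 by linarith)
      have g2 := Real.Gamma_pos_of_pos (show 0 < (m:ℝ) + 2 * (l + ν) + 2 by linarith)
      have g3 := Real.Gamma_pos_of_pos (show 0 < ν + 1 by linarith)
      have hdf : ((m + l).factorial : ℝ) = m.factorial * (m + l).descFactorial l := by
        have := Nat.factorial_mul_descFactorial (show l ≤ m + l by omega)
        rw [Nat.add_sub_cancel] at this
        exact_mod_cast this.symm
      have hdup := Real.Gamma_mul_Gamma_add_half (ν + 1/2)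
      rw [show ν + 1/2 + 1/2 = ν + 1 by ring, show 2 * (ν + 1/2) = 2 * ν + 1 by ring,
        show 1 - (2 * ν + 1) = -(2 * ν) by ring, Real.rpow_neg two_pos.le] at hdup
      have ha1 := aux_gamma_asc (2 * ν + 1) (by linarith) l
      have ha2 := aux_gamma_asc (ν + 1) (by linarith) l
      have hasc : 0 < (ascPochhammer ℝ l).eval (ν + 1) := ascPochhammer_pos _ _ (by linarith)
      have hd : 0 < ((m + l).descFactorial l : ℝ) := by
        exact_mod_cast Nat.descFactorial_pos.mpr (show l ≤ m + l by omega)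
      rw [show ν + ((m + l : ℕ):ℝ) + 1 = m + (l + ν) + 1 by push_cast; ring,
        show 2 * ν + 2 * (l:ℝ) + 1 + m + 1 = m + 2 * (l + ν) + 2 by ring,
        show 2 * ν + (l:ℝ) + 1 = 2 * ν + 1 + l by ring,
        show (l:ℝ) + ν + 1 = ν + 1 + l by ring, ha1, ha2, hdf, hK,
        show 2 * ((l:ℝ) + ν) + 1 = l + l + 2 * ν + 1 by ring]
      rw [Real.rpow_add two_pos, Real.rpow_add two_pos, Real.rpow_add two_pos, Real.rpow_one,
        Real.rpow_natCast, Real.rpow_sub two_pos, Real.rpow_one, Real.rpow_natCast]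
      have ht : (0:ℝ) < 2 ^ (2 * ν) := Real.rpow_pos_of_pos two_pos _
      have hG : Real.Gamma (ν + 1/2) =
        Real.Gamma (2 * ν + 1) * (2 ^ (2 * ν))⁻¹ * Real.sqrt Real.pi / Real.Gamma (ν + 1) := by
        rw [← hdup]; field_simp
      have hs : (-1/2 : ℝ) ^ l * (-1) ^ l = (1/2) ^ l := by
        rw [← mul_pow]; norm_num
      have h4 : (1/4 : ℝ) ^ (m + l) = 1 / (2 ^ m * 2 ^ m * (2 ^ l * 2 ^ l)) := by
        rw [show (1/4:ℝ) = 1/(2*2) by norm_num, div_pow, one_pow, mul_pow, pow_add]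
        congr 1; ring
      have hs' : (-1/2 : ℝ) ^ l = (1/2) ^ l * (-1) ^ l := by
        rw [← mul_pow]; norm_num
      have hs1 : ((-1 : ℝ) ^ l) * (-1) ^ l = 1 := by
        rw [← mul_pow]; norm_num
      rw [hG, h4, hs', one_div_pow, one_div_pow]
      field_simp
      rw [sq, hs1, mul_one])
  rw [← hcore]
  apply intervalIntegral.integral_congr_Ioo_of_le Real.pi_pos.le
  intro θ hθ
  have hsin := Real.sin_pos_of_pos_of_lt_pi hθ.1 hθ.2
  have hx : Real.cos θ ∈ Set.Ioo (-1:ℝ) 1 := by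
    constructor <;> nlinarith [Real.sin_sq_add_cos_sq θ, Real.cos_le_one θ, Real.neg_one_le_cos θ]
  have hpos : 0 < 1 - Real.cos θ ^ 2 := by nlinarith [hx.1, hx.2]
  simp only
  rw [mul_assoc, ← Complex.ofReal_mul]
  congr 2
  rw [gegenTilde, if_neg (by linarith), gegenC,
    show (l:ℝ) + (ν + 1/2) - 1/2 = l + ν by ring, aux_iter _ _ _ hx,
    show -(ν + 1/2) + 1/2 = -ν by ring, show (l:ℝ) + ν - l = ν by ring,
    show 2 * (ν + 1/2) = 2 * ν + 1 by ring, show ν + 1/2 + 1/2 = ν + 1 by ring,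
    Real.rpow_neg hpos.le]
  have := Real.rpow_pos_of_pos hpos ν
  simp only [hWdef, hK]
  field_simp

lemma aux_gamma_half (k : ℕ) :
    Real.Gamma (k + 1/2) * (4 ^ k * k.factorial) = (2 * k).factorial * Real.sqrt Real.pi := by
  induction k with
  | zero => have := Real.Gamma_one_half_eq; simpa using this
  | succ k ih =>
    rw [Nat.cast_add_one, show (k:ℝ) + 1 + 1/2 = k + 1/2 + 1 by ring,
      Real.Gamma_add_one (by positivity), show 2 * (k+1) = 2*k+1+1 by ring, Nat.factorial_succ,
      Nat.factorial_succ, Nat.factorial_succ]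
    push_cast
    linear_combination (2 * (2 * (k:ℝ) + 1) * (k + 1)) * ih

lemma aux_main_half (l : ℕ) (α : ℂ) :
    ∫ θ in (0:ℝ)..Real.pi,
        ItildeC (-1/2) (α * (Real.sqrt (1 + Real.cos θ) : ℝ)) *
          (gegenTilde (-1/2 + 1/2) l (Real.cos θ) : ℂ) *
          ((Real.sin θ ^ (2 * (-1/2 : ℝ) + 1) : ℝ) : ℂ) =
      (((2 : ℝ) ^ ((1 : ℝ) - l) * Real.sqrt Real.pi *
          Real.Gamma (2 * (-1/2) + l + 1) / Nat.factorial l : ℝ) : ℂ) *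
        α ^ (2 * l) * ItildeC (2 * (-1/2) + 2 * l + 1) ((Real.sqrt 2 : ℝ) * α) := by
  rcases Nat.eq_zero_or_pos l with rfl | hl
  · simp [gegenTilde]
    norm_num
  have hcore := aux_core (-1/2) le_rfl l α (fun θ => (2 / l) * Real.cos (l * θ)) (by fun_prop)
    (fun k => (2 / l) * (Real.pi * (1/2) ^ k * ((2 * k).choose (k + l) : ℕ)))
    (fun k => by
      rw [← aux_cos k l, ← intervalIntegral.integral_const_mul]
      apply intervalIntegral.integral_congr
      intro θ _
      simp only
      ring)
    ((2 : ℝ) ^ ((1 : ℝ) - l) * Real.sqrt Real.pi *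
          Real.Gamma (2 * (-1/2) + l + 1) / Nat.factorial l)
    (fun k hk => by
      simp [Nat.choose_eq_zero_of_lt (show 2 * k < k + l by omega)])
    (fun m => by
      obtain ⟨n, rfl⟩ : ∃ n, l = n + 1 := ⟨l - 1, by omega⟩
      have hch := Nat.choose_mul_factorial_mul_factorial
        (show (m + (n+1)) + (n+1) ≤ 2 * (m + (n+1)) by omega)
      rw [show 2 * (m + (n+1)) - ((m + (n+1)) + (n+1)) = m by omega] at hch
      have hch' : (((2 * (m + (n+1))).choose ((m + (n+1)) + (n+1)) : ℕ) : ℝ) =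
          (2 * (m + (n+1))).factorial / ((m + (n+1) + (n+1)).factorial * m.factorial) := by
        rw [← hch]; push_cast; field_simp
      have hg := aux_gamma_half (m + (n+1))
      have e1 : Real.Gamma (-1/2 + ((m + (n+1) : ℕ):ℝ) + 1) =
          (2 * (m + (n+1))).factorial * Real.sqrt Real.pi /
            (4 ^ (m + (n+1)) * (m + (n+1)).factorial) := by
        rw [← hg, show -1/2 + ((m + (n+1) : ℕ):ℝ) + 1 = ((m + (n+1) : ℕ):ℝ) + 1/2 by ring]
        field_simp
      have e2 : Real.Gamma (2 * (-1/2) + 2 * ((n + 1 : ℕ):ℝ) + 1 + m + 1) =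
          (m + (n+1) + (n+1)).factorial := by
        rw [← Real.Gamma_nat_eq_factorial]; congr 1; push_cast; ring
      have e3 : Real.Gamma (2 * (-1/2) + ((n + 1 : ℕ):ℝ) + 1) = n.factorial := by
        rw [← Real.Gamma_nat_eq_factorial]; congr 1; push_cast; ring
      rw [hch', e1, e2, e3, Real.rpow_sub two_pos, Real.rpow_one, Real.rpow_natCast,
        Nat.factorial_succ n]
      have hpi : Real.sqrt Real.pi * Real.sqrt Real.pi = Real.pi :=
        Real.mul_self_sqrt Real.pi_pos.le
      have hpi0 : 0 < Real.sqrt Real.pi := Real.sqrt_pos.mpr Real.pi_pos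
      rw [show (2:ℝ) / ((n + 1 : ℕ) : ℝ) * (Real.pi * (1/2) ^ (m + (n+1)) *
        ((2 * (m + (n+1))).factorial / ((m + (n+1) + (n+1)).factorial * m.factorial))) =
        2 / ((n + 1 : ℕ) : ℝ) * (Real.sqrt Real.pi * Real.sqrt Real.pi * (1/2) ^ (m + (n+1)) *
        ((2 * (m + (n+1))).factorial / ((m + (n+1) + (n+1)).factorial * m.factorial))) by
          rw [hpi]]
      simp only [one_div_pow]
      push_cast
      field_simp
      try ring)
  rw [← hcore]
  apply intervalIntegral.integral_congr
  intro θ hθ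
  rw [Set.uIcc_of_le Real.pi_pos.le] at hθ
  simp only
  rw [gegenTilde, if_pos (by norm_num), Real.arccos_cos hθ.1 hθ.2,
    show 2 * (-1/2 : ℝ) + 1 = 0 by norm_num, Real.rpow_zero]
  simp
/-- For `ν ≥ -1/2`, `l ∈ ℕ` and `α ∈ ℂ`,
`∫_0^π Ĩ_ν(α√(1+cosθ))·C̃_l^{ν+1/2}(cosθ)·sin^{2ν+1}θ dθ
  = (2^{1-l}·√π·Γ(2ν+l+1)/l!)·α^{2l}·Ĩ_{2ν+2l+1}(√2·α)`. -/
theorem gegenbauer_bessel_integral (ν : ℝ) (hν : -1/2 ≤ ν) (l : ℕ) (α : ℂ) :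
    ∫ θ in (0:ℝ)..Real.pi,
        ItildeC ν (α * (Real.sqrt (1 + Real.cos θ) : ℝ)) *
          (gegenTilde (ν + 1/2) l (Real.cos θ) : ℂ) *
          ((Real.sin θ ^ (2 * ν + 1) : ℝ) : ℂ) =
      (((2 : ℝ) ^ ((1 : ℝ) - l) * Real.sqrt Real.pi *
          Real.Gamma (2 * ν + l + 1) / Nat.factorial l : ℝ) : ℂ) *
        α ^ (2 * l) * ItildeC (2 * ν + 2 * l + 1) ((Real.sqrt 2 : ℝ) * α) := by
  rcases hν.lt_or_eq with h | h
  · exact aux_main_pos ν h l α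
  · subst h
    exact aux_main_half l α
end

section
/- Let m ≥ 3, let 0 ≤ l, let t ∈ Ω, and let p : ℝ^m → ℝ be a harmonic polynomial homogeneous of degree l. Then for all r, r' > 0 and every ω ∈ S^{m-1}, (1/2)·∫_{S^{m-1}} K⁺(rω, r'ω'; t)·p(ω') dω' = K_l⁺(r, r'; t)·p(ω), where dω' is the surface measure on the unit sphere S^{m-1} ⊂ ℝ^m. -/
open MeasureTheory
open scoped RealInnerProductSpace

/-- `ψ(x,x') = 2√(2(|x||x'| + ⟨x,x'⟩))`. -/
noncomputable def psiK {m : ℕ} (x x' : EuclideanSpace ℝ (Fin m)) : ℝ :=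
  2 * Real.sqrt (2 * (‖x‖ * ‖x'‖ + ⟪x, x'⟫))

/-- The kernel
`K⁺(x,x';t) = 2·e^{-2(|x|+|x'|)coth(t/2)}·Ĩ_{(m-3)/2}(ψ(x,x')/sinh(t/2))/(π^{(m-1)/2}·sinh(t/2)^{m-1})`. -/
noncomputable def Kplus (m : ℕ) (t : ℂ) (x x' : EuclideanSpace ℝ (Fin m)) : ℂ :=
  2 * Complex.exp (-2 * (‖x‖ + ‖x'‖ : ℝ) * (Complex.cosh (t/2) / Complex.sinh (t/2))) *
    ItildeC (((m : ℝ) - 3) / 2) ((psiK x x' : ℝ) / Complex.sinh (t/2)) /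
    (((Real.pi ^ (((m : ℝ) - 1) / 2) : ℝ) : ℂ) * (Complex.sinh (t/2)) ^ (m - 1))

lemma gint {m : ℕ} (q : MvPolynomial (Fin m) ℝ) :
    Integrable (fun x : EuclideanSpace ℝ (Fin m) =>
      MvPolynomial.eval (fun i => x i) q * Real.exp (-(‖x‖^2/2))) := by
  induction q using MvPolynomial.induction_on' with
  | monomial d a =>
    have h1 : ∀ n : ℕ, Integrable (fun x : ℝ => x ^ n * Real.exp (-(x^2/2))) := by
      intro n
      have := integrable_rpow_mul_exp_neg_mul_sq (b := 1/2) (by norm_num) (s := n)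
        (by have : (0:ℝ) ≤ n := n.cast_nonneg
            linarith)
      refine this.congr (Filter.Eventually.of_forall fun x => ?_)
      simp only [Real.rpow_natCast]
      congr 2; ring
    have h2 : Integrable (fun x : Fin m → ℝ => ∏ i, (x i ^ d i * Real.exp (-(x i^2/2)))) :=
      Integrable.fintype_prod (fun i => h1 (d i))
    have h3 := ((PiLp.volume_preserving_ofLp (Fin m)).integrable_comp_emb
      (MeasurableEquiv.toLp 2 (Fin m → ℝ)).symm.measurableEmbedding).2 (h2.const_mul a)
    refine h3.congr (Filter.Eventually.of_forall fun x => ?_)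
    simp only [Function.comp, MvPolynomial.eval_monomial, Finset.prod_mul_distrib]
    rw [← Real.exp_sum, EuclideanSpace.norm_sq_eq, Finset.sum_neg_distrib, Finset.sum_div,
      Finsupp.prod_fintype _ _ (by simp)]
    simp [mul_assoc]
  | add p q hp hq =>
    refine (hp.add hq).congr (Filter.Eventually.of_forall fun x => ?_)
    simp [add_mul]

/-- Gaussian functional -/
noncomputable def GG (m : ℕ) : MvPolynomial (Fin m) ℝ →ₗ[ℝ] ℝ where
  toFun q := ∫ x : EuclideanSpace ℝ (Fin m),
    MvPolynomial.eval (fun i => x i) q * Real.exp (-(‖x‖^2/2))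
  map_add' p q := by
    rw [← integral_add (gint p) (gint q)]
    simp [add_mul]
  map_smul' a q := by
    simp [mul_assoc, integral_const_mul]

lemma GG_apply {m : ℕ} (q : MvPolynomial (Fin m) ℝ) : GG m q = ∫ x : EuclideanSpace ℝ (Fin m),
    MvPolynomial.eval (fun i => x i) q * Real.exp (-(‖x‖^2/2)) := rfl

lemma GG_one {m : ℕ} : GG m 1 = (Real.sqrt (2 * Real.pi)) ^ m := by
  rw [GG_apply]
  have h2 : ∫ x : Fin m → ℝ, ∏ i, Real.exp (-(x i^2/2)) = (Real.sqrt (2 * Real.pi)) ^ m := by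
    rw [integral_fintype_prod_volume_eq_pow (fun x : ℝ => Real.exp (-(x^2/2)))]
    have := integral_gaussian (1/2)
    simp only [Fintype.card_fin]
    congr 1
    have e1 : (fun x : ℝ => Real.exp (-(x^2/2))) = fun x : ℝ => Real.exp (-(1/2) * x^2) := by
      ext x; congr 1; ring
    rw [e1, this]
    congr 1; ring
  rw [← h2, ← (PiLp.volume_preserving_ofLp (Fin m)).integral_comp
      (MeasurableEquiv.toLp 2 (Fin m → ℝ)).symm.measurableEmbedding]
  congr 1
  ext x
  rw [← Real.exp_sum, EuclideanSpace.norm_sq_eq, Finset.sum_neg_distrib, Finset.sum_div]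
  simp

lemma eval_hasLineDeriv {m : ℕ} (q : MvPolynomial (Fin m) ℝ) (i : Fin m)
    (x : EuclideanSpace ℝ (Fin m)) :
    HasLineDerivAt ℝ (fun x : EuclideanSpace ℝ (Fin m) => MvPolynomial.eval (fun i => x i) q)
      (MvPolynomial.eval (fun i => x i) (MvPolynomial.pderiv i q)) x
      (EuclideanSpace.single i 1) := by
  unfold HasLineDerivAt
  induction q using MvPolynomial.induction_on with
  | C a => simpa using hasDerivAt_const _ _
  | add p q hp hq => 
    have := hp.add hq
    simp only [map_add]
    exact this
  | mul_X p j hp =>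
    have h : HasDerivAt (fun t : ℝ => (x + t • EuclideanSpace.single i (1:ℝ)) j)
        (if j = i then 1 else 0) 0 := by
      by_cases hij : j = i
      · simp [hij]
        simpa using (hasDerivAt_id (0:ℝ)).const_add (x i)
      · simp [hij]
        simpa using hasDerivAt_const _ _
    have := hp.mul h
    simp only [zero_smul, add_zero] at this
    have e : MvPolynomial.eval (fun i => x i) (MvPolynomial.pderiv i (p * MvPolynomial.X j)) =
      MvPolynomial.eval (fun i => x i) (MvPolynomial.pderiv i p) * x j +
        MvPolynomial.eval (fun i => x i) p * (if j = i then 1 else 0) := by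
      rw [Derivation.leibniz, MvPolynomial.pderiv_X]
      by_cases hij : j = i
      · subst hij; simp; ring
      · simp [hij]; ring
    rw [e]
    simp only [map_mul, MvPolynomial.eval_X]
    exact this

lemma stein {m : ℕ} (q : MvPolynomial (Fin m) ℝ) (i : Fin m) :
    GG m (MvPolynomial.X i * q) = GG m (MvPolynomial.pderiv i q) := by
  have hg : ∀ x : EuclideanSpace ℝ (Fin m), HasLineDerivAt ℝ
      (fun x : EuclideanSpace ℝ (Fin m) => Real.exp (-(‖x‖^2/2)))
      (- (x i * Real.exp (-(‖x‖^2/2)))) x (EuclideanSpace.single i 1) := by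
    intro x
    have h1 : HasFDerivAt (fun x : EuclideanSpace ℝ (Fin m) => ‖x‖^2) _ x :=
      (hasStrictFDerivAt_norm_sq x).hasFDerivAt
    have h2 := ((h1.hasLineDerivAt (EuclideanSpace.single i 1)))
    unfold HasLineDerivAt at h2 ⊢
    refine HasDerivAt.congr_deriv ((h2.div_const 2).neg).exp ?_
    simp [EuclideanSpace.inner_single_right]
    ring
  have := integral_bilinear_hasLineDerivAt_right_eq_neg_left_of_integrable (μ := volume)
    (B := ContinuousLinearMap.mul ℝ ℝ) (v := EuclideanSpace.single i 1)
    (f := fun x : EuclideanSpace ℝ (Fin m) => MvPolynomial.eval (fun i => x i) q)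
    (f' := fun x : EuclideanSpace ℝ (Fin m) => MvPolynomial.eval (fun i => x i) (MvPolynomial.pderiv i q))
    (g := fun x : EuclideanSpace ℝ (Fin m) => Real.exp (-(‖x‖^2/2)))
    (g' := fun x : EuclideanSpace ℝ (Fin m) => - (x i * Real.exp (-(‖x‖^2/2))))
    (gint _) ?_ (gint _) (fun x _ => eval_hasLineDeriv q i x) (fun x _ => hg x)
  · rw [GG_apply, GG_apply]
    simp only [ContinuousLinearMap.mul_apply'] at this
    rw [← neg_eq_iff_eq_neg, ← integral_neg] at this
    rw [← this]
    congr 1; ext x; simp; ring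
  · refine (gint (MvPolynomial.X i * q)).neg.congr (Filter.Eventually.of_forall fun x => ?_)
    simp; ring

/-- radial moments -/
noncomputable def RR (m n : ℕ) : ℝ := ∫ r in Set.Ioi (0:ℝ), r ^ (m - 1 + n) * Real.exp (-(r^2/2))

lemma RR_eq (m n : ℕ) (hm : 1 ≤ m) :
    RR m n = 2 ^ (((m + n : ℕ) : ℝ) / 2 - 1) * Real.Gamma (((m + n : ℕ) : ℝ) / 2) := by
  have h := integral_rpow_mul_exp_neg_mul_rpow (p := 2) (q := ((m - 1 + n : ℕ) : ℝ)) (b := 1/2)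
    (by norm_num) (lt_of_lt_of_le (by norm_num) (Nat.cast_nonneg _)) (by norm_num)
  have e : (((m - 1 + n : ℕ) : ℝ) + 1) = ((m + n : ℕ) : ℝ) := by
    have : m - 1 + n + 1 = m + n := by omega
    exact_mod_cast this
  rw [e] at h
  unfold RR
  convert h using 1
  · apply setIntegral_congr_fun measurableSet_Ioi
    intro r hr
    simp only [Real.rpow_natCast, Real.rpow_ofNat]
    congr 2; ring
  · rw [one_div, Real.inv_rpow (by norm_num), ← Real.rpow_neg (by norm_num), neg_div, neg_neg,
      Real.rpow_sub (by norm_num)]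
    rw [Real.rpow_one]; ring

lemma RR_pos (m n : ℕ) (hm : 1 ≤ m) : 0 < RR m n := by
  rw [RR_eq m n hm]
  have : (0:ℝ) < ((m + n : ℕ) : ℝ) := by exact_mod_cast (by omega : 0 < m + n)
  exact mul_pos (Real.rpow_pos_of_pos (by norm_num) _) (Real.Gamma_pos_of_pos (by positivity))

lemma RR_succ (m n : ℕ) (hm : 1 ≤ m) : RR m (n+2) = (n + m) * RR m n := by
  rw [RR_eq m n hm, RR_eq m _ hm]
  have : (0:ℝ) < ((m + n : ℕ) : ℝ) := by exact_mod_cast (by omega : 0 < m + n)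
  have e : (((m + (n + 2) : ℕ) : ℝ) / 2) = ((m + n : ℕ) : ℝ) / 2 + 1 := by push_cast; ring
  rw [e, Real.Gamma_add_one (by positivity), add_sub_right_comm, Real.rpow_add_one (by norm_num)]
  push_cast; ring

lemma sint {m : ℕ} (q : MvPolynomial (Fin m) ℝ) :
    Integrable (fun ω : Metric.sphere (0 : EuclideanSpace ℝ (Fin m)) 1 =>
      MvPolynomial.eval (fun i => (ω : EuclideanSpace ℝ (Fin m)) i) q)
      ((volume : Measure (EuclideanSpace ℝ (Fin m))).toSphere) := by
  have hc : Continuous (fun ω : Metric.sphere (0 : EuclideanSpace ℝ (Fin m)) 1 =>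
      MvPolynomial.eval (fun i => (ω : EuclideanSpace ℝ (Fin m)) i) q) := by
    refine (MvPolynomial.continuous_eval q).comp ?_
    fun_prop
  exact hc.integrable_of_hasCompactSupport (HasCompactSupport.of_compactSpace _)

noncomputable def SS (m : ℕ) : MvPolynomial (Fin m) ℝ →ₗ[ℝ] ℝ where
  toFun q := ∫ ω : Metric.sphere (0 : EuclideanSpace ℝ (Fin m)) 1,
    MvPolynomial.eval (fun i => (ω : EuclideanSpace ℝ (Fin m)) i) q 
      ∂((volume : Measure (EuclideanSpace ℝ (Fin m))).toSphere)
  map_add' p q := by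
    rw [← integral_add (sint p) (sint q)]
    simp
  map_smul' a q := by
    simp [integral_const_mul]

lemma SS_apply {m : ℕ} (q : MvPolynomial (Fin m) ℝ) : SS m q =
   ∫ ω : Metric.sphere (0 : EuclideanSpace ℝ (Fin m)) 1,
    MvPolynomial.eval (fun i => (ω : EuclideanSpace ℝ (Fin m)) i) q 
      ∂((volume : Measure (EuclideanSpace ℝ (Fin m))).toSphere) := rfl

lemma hom_eval {m n : ℕ} {q : MvPolynomial (Fin m) ℝ} (hq : q.IsHomogeneous n) (r : ℝ)
    (y : Fin m → ℝ) :
    MvPolynomial.eval (fun i => r * y i) q = r ^ n * MvPolynomial.eval y q := by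
  rw [MvPolynomial.eval_eq, MvPolynomial.eval_eq, Finset.mul_sum]
  refine Finset.sum_congr rfl fun d hd => ?_
  have h := hq (MvPolynomial.mem_support_iff.1 hd)
  rw [← h]
  simp only [mul_pow, Finset.prod_mul_distrib, Finset.prod_pow_eq_pow_sum, Finsupp.weight_apply,
    Finsupp.sum, Pi.one_apply, smul_eq_mul, mul_one]
  ring

lemma polar {m : ℕ} (hm : 1 ≤ m) (n : ℕ) (q : MvPolynomial (Fin m) ℝ) (hq : q.IsHomogeneous n) :
    GG m q = SS m q * RR m n := by
  set μ : Measure (EuclideanSpace ℝ (Fin m)) := volume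
  have : Nontrivial (EuclideanSpace ℝ (Fin m)) := by
    have : Nonempty (Fin m) := ⟨⟨0, hm⟩⟩
    infer_instance
  have hR : RR m n = ∫ r : Set.Ioi (0:ℝ), (r:ℝ) ^ n * Real.exp (-((r:ℝ)^2/2)) ∂(Measure.volumeIoiPow (m - 1)) := by
    simp_rw [RR, Measure.volumeIoiPow, ENNReal.ofReal]
    rw [integral_withDensity_eq_integral_smul (by fun_prop), 
      integral_subtype_comap measurableSet_Ioi (fun a : ℝ ↦ Real.toNNReal (a ^ (m - 1)) • (a ^ n * Real.exp (-(a^2/2))))]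
    refine setIntegral_congr_fun measurableSet_Ioi fun x hx ↦ ?_
    rw [NNReal.smul_def, Real.coe_toNNReal _ (pow_nonneg hx.out.le _), smul_eq_mul, pow_add]
    ring
  rw [GG_apply, SS_apply, hR, ← integral_prod_mul]
  have h0 : ∫ x : EuclideanSpace ℝ (Fin m),
    MvPolynomial.eval (fun i => x i) q * Real.exp (-(‖x‖^2/2)) = 
     ∫ x : ({(0)}ᶜ : Set (EuclideanSpace ℝ (Fin m))), (MvPolynomial.eval (fun i => x.1 i) q * Real.exp (-(‖x.1‖^2/2))) ∂(μ.comap (↑)) := by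
    rw [integral_subtype_comap (measurableSet_singleton _).compl
      (fun x : EuclideanSpace ℝ (Fin m) => MvPolynomial.eval (fun i => x i) q * Real.exp (-(‖x‖^2/2))),
      restrict_compl_singleton]
  rw [h0]
  have h1 := μ.measurePreserving_homeomorphUnitSphereProd.integral_comp 
    (Homeomorph.measurableEmbedding _) (fun z => (MvPolynomial.eval (fun i => (z.1 : EuclideanSpace ℝ (Fin m)) i) q) * 
      ((z.2:ℝ) ^ n * Real.exp (-((z.2:ℝ)^2/2))))
  simp only [finrank_euclideanSpace, Fintype.card_fin] at h1
  rw [← h1]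
  congr 1
  ext x
  have hx : 0 < ‖x.1‖ := norm_pos_iff.2 x.2
  simp only [homeomorphUnitSphereProd_apply_snd_coe, homeomorphUnitSphereProd_apply_fst_coe]
  rw [← mul_assoc]
  congr 1
  have : (fun i => x.1 i) = fun i => ‖x.1‖ * (‖x.1‖⁻¹ • x.1) i := by
    ext i; simp; field_simp
  rw [this, hom_eval hq, mul_comm]

section alg
open MvPolynomial

noncomputable def cc {m : ℕ} (w : Fin m → ℝ) : MvPolynomial (Fin m) ℝ := ∑ i, C (w i) * X i

noncomputable def DD {m : ℕ} (w : Fin m → ℝ) (q : MvPolynomial (Fin m) ℝ) :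
    MvPolynomial (Fin m) ℝ := ∑ i, C (w i) * pderiv i q

noncomputable def LL {m : ℕ} (q : MvPolynomial (Fin m) ℝ) :
    MvPolynomial (Fin m) ℝ := ∑ i, pderiv i (pderiv i q)

lemma pderiv_cc {m : ℕ} (w : Fin m → ℝ) (j : Fin m) : pderiv j (cc w) = C (w j) := by
  classical
  unfold cc
  simp [Derivation.leibniz, pderiv_X, Pi.single_apply]

lemma cc_hom {m : ℕ} (w : Fin m → ℝ) : (cc w).IsHomogeneous 1 := by
  refine IsHomogeneous.sum _ _ _ fun i _ => ?_
  simpa using (isHomogeneous_C _ (w i)).mul (isHomogeneous_X ℝ i)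

lemma ccpow_hom {m l : ℕ} (w : Fin m → ℝ) (j : ℕ) {p : MvPolynomial (Fin m) ℝ}
    (hp : p.IsHomogeneous l) : (cc w ^ j * p).IsHomogeneous (j + l) := by
  simpa using ((cc_hom w).pow j).mul hp

lemma DD_hom {m l : ℕ} (w : Fin m → ℝ) {p : MvPolynomial (Fin m) ℝ}
    (hp : p.IsHomogeneous l) : (DD w p).IsHomogeneous (l - 1) := by
  refine IsHomogeneous.sum _ _ _ fun i _ => ?_
  simpa using (isHomogeneous_C _ (w i)).mul (hp.pderiv (i := i))

lemma pderiv_comm' {m : ℕ} (i j : Fin m) (p : MvPolynomial (Fin m) ℝ) :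
    pderiv i (pderiv j p) = pderiv j (pderiv i p) := by
  induction p using MvPolynomial.induction_on with
  | C a => simp
  | add p q hp hq => simp [hp, hq]
  | mul_X p k hp =>
    classical
    simp only [Derivation.leibniz, map_add, hp, pderiv_X, smul_eq_mul, Pi.single_apply]
    split_ifs <;> simp <;> ring

lemma DD_harm {m : ℕ} (w : Fin m → ℝ) {p : MvPolynomial (Fin m) ℝ}
    (hp : LL p = 0) : LL (DD w p) = 0 := by
  have : LL (DD w p) = DD w (LL p) := by
    unfold LL DD
    simp only [map_sum, pderiv_C_mul, Finset.mul_sum]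
    rw [Finset.sum_comm]
    refine Finset.sum_congr rfl fun i _ => Finset.sum_congr rfl fun j _ => ?_
    congr 1
    rw [pderiv_comm' i j, pderiv_comm' i j]
  rw [this, hp]; simp [DD]

lemma stein_cc {m : ℕ} (w : Fin m → ℝ) (q : MvPolynomial (Fin m) ℝ) :
    GG m (cc w * q) = GG m (DD w q) := by
  unfold cc DD
  simp only [Finset.sum_mul, map_sum, C_mul', smul_mul_assoc, map_smul, stein]

lemma euler_GG {m n : ℕ} {q : MvPolynomial (Fin m) ℝ} (hq : q.IsHomogeneous n) :
    n * GG m q = GG m (LL q) := by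
  have := congrArg (GG m) hq.sum_X_mul_pderiv
  simp only [map_sum, stein, map_nsmul] at this
  simp [LL, this]

lemma DD_ccpow {m : ℕ} (w : Fin m → ℝ) (hw : ∑ i, w i ^ 2 = 1) (j : ℕ)
    (p : MvPolynomial (Fin m) ℝ) :
    DD w (cc w ^ j * p) = (j : MvPolynomial (Fin m) ℝ) * (cc w ^ (j - 1) * p) + cc w ^ j * DD w p := by
  have h : (∑ i, C (w i) * C (w i) : MvPolynomial (Fin m) ℝ) = 1 := by
    simp only [← C_mul, ← map_sum, ← pow_two]
    rw [← C_1, ← hw, map_sum]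
    simp
  unfold DD
  simp only [Derivation.leibniz, Derivation.leibniz_pow, pderiv_cc, smul_eq_mul, nsmul_eq_mul]
  calc _ = (∑ i, C (w i) * C (w i)) * ((j : MvPolynomial (Fin m) ℝ) * (cc w ^ (j - 1) * p)) +
        cc w ^ j * ∑ i, C (w i) * pderiv i p := by
        rw [Finset.sum_mul, Finset.mul_sum, ← Finset.sum_add_distrib]
        exact Finset.sum_congr rfl fun i _ => by ring
    _ = _ := by rw [h, one_mul]

lemma LL_ccpow {m : ℕ} (w : Fin m → ℝ) (hw : ∑ i, w i ^ 2 = 1) (j : ℕ)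
    (p : MvPolynomial (Fin m) ℝ) :
    LL (cc w ^ j * p) = (j : MvPolynomial (Fin m) ℝ) * ((j - 1 : ℕ) * (cc w ^ (j - 2) * p)) +
      2 * j * (cc w ^ (j - 1) * DD w p) + cc w ^ j * LL p := by
  have h : (∑ i, C (w i) * C (w i) : MvPolynomial (Fin m) ℝ) = 1 := by
    simp only [← C_mul, ← map_sum, ← pow_two]
    rw [← C_1, ← hw, map_sum]
    simp
  unfold LL DD
  simp only [Derivation.leibniz, Derivation.leibniz_pow, pderiv_cc, smul_eq_mul, nsmul_eq_mul, map_add,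
    Derivation.map_natCast, pderiv_C, Nat.sub_sub]
  calc _ = (∑ i, C (w i) * C (w i)) * ((j : MvPolynomial (Fin m) ℝ) * ((j - 1 : ℕ) * (cc w ^ (j - 2) * p))) +
        2 * j * (cc w ^ (j - 1) * ∑ i, C (w i) * pderiv i p) + cc w ^ j * ∑ i, pderiv i (pderiv i p) := by
        rw [Finset.sum_mul, Finset.mul_sum, Finset.mul_sum, Finset.mul_sum, ← Finset.sum_add_distrib,
          ← Finset.sum_add_distrib]
        exact Finset.sum_congr rfl fun i _ => by ring
    _ = _ := by rw [h, one_mul]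

lemma GG_nat_mul {m : ℕ} (n : ℕ) (q : MvPolynomial (Fin m) ℝ) :
    GG m ((n : MvPolynomial (Fin m) ℝ) * q) = n * GG m q := by
  rw [← nsmul_eq_mul, map_nsmul, nsmul_eq_mul]

lemma GG_step {m : ℕ} (w : Fin m → ℝ) (hw : ∑ i, w i ^ 2 = 1) (j : ℕ)
    (p : MvPolynomial (Fin m) ℝ) :
    GG m (cc w ^ (j+1) * p) = j * GG m (cc w ^ (j-1) * p) + GG m (cc w ^ j * DD w p) := by
  rw [pow_succ', mul_assoc, stein_cc, DD_ccpow w hw, map_add, GG_nat_mul]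

lemma GG_rec {m l : ℕ} (w : Fin m → ℝ) (hw : ∑ i, w i ^ 2 = 1) (j : ℕ)
    {p : MvPolynomial (Fin m) ℝ} (hp : p.IsHomogeneous l) (hh : LL p = 0) :
    ((j:ℝ) - l) * GG m (cc w ^ j * p) = j * (j - 1) * GG m (cc w ^ (j - 2) * p) := by
  have h1 := euler_GG (ccpow_hom w j hp)
  rw [LL_ccpow w hw, hh, mul_zero, add_zero, map_add, mul_assoc, GG_nat_mul, GG_nat_mul,
    show (2 : MvPolynomial (Fin m) ℝ) = ((2:ℕ) : MvPolynomial (Fin m) ℝ) by norm_num,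
    GG_nat_mul, GG_nat_mul] at h1
  rcases j with _ | j
  · simp at h1 ⊢
    tauto
  · have h2 := GG_step w hw j p
    simp only [Nat.add_sub_cancel, show j + 1 - 2 = j - 1 by omega] at h1 h2 ⊢
    push_cast at h1 ⊢
    have : GG m (cc w ^ j * DD w p) = GG m (cc w ^ (j+1) * p) - j * GG m (cc w ^ (j-1) * p) := by
      linarith
    rw [this] at h1
    linarith

lemma GG_lt {m l : ℕ} (w : Fin m → ℝ) (hw : ∑ i, w i ^ 2 = 1)
    {p : MvPolynomial (Fin m) ℝ} (hp : p.IsHomogeneous l) (hh : LL p = 0) (j : ℕ) (hj : j < l) :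
    GG m (cc w ^ j * p) = 0 := by
  induction j using Nat.strong_induction_on with
  | _ j ih =>
    have h := GG_rec w hw j hp hh
    have hne : ((j:ℝ) - l) ≠ 0 := by
      have : (j:ℝ) < l := by exact_mod_cast hj
      linarith
    have h0 : (j:ℝ) * (j - 1) * GG m (cc w ^ (j - 2) * p) = 0 := by
      rcases j with _ | _ | j
      · simp
      · simp
      · rw [ih (j+2-2) (by omega) (by omega)]; simp
    rw [h0] at h
    exact (mul_eq_zero.1 h).resolve_left hne

lemma eval_DD {m l : ℕ} (w : Fin m → ℝ) {p : MvPolynomial (Fin m) ℝ} (hp : p.IsHomogeneous l) :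
    eval w (DD w p) = l * eval w p := by
  have := congrArg (eval w) hp.sum_X_mul_pderiv
  simpa [DD] using this

lemma GG_eq {m : ℕ} (w : Fin m → ℝ) (hw : ∑ i, w i ^ 2 = 1) (l : ℕ)
    {p : MvPolynomial (Fin m) ℝ} (hp : p.IsHomogeneous l) (hh : LL p = 0) :
    GG m (cc w ^ l * p) = l.factorial * (Real.sqrt (2 * Real.pi)) ^ m * eval w p := by
  induction l generalizing p with
  | zero =>
    rw [← totalDegree_zero_iff_isHomogeneous, totalDegree_eq_zero_iff_eq_C] at hp
    rw [hp]
    simp only [pow_zero, one_mul, eval_C]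
    rw [← mul_one (C _), C_mul', map_smul, GG_one]
    simp [mul_comm]
  | succ l ih =>
    have h1 := ih (by simpa using DD_hom w hp) (DD_harm w hh)
    rw [GG_step w hw, GG_lt w hw hp hh (l-1) (by omega), h1, eval_DD w hp, Nat.factorial_succ]
    push_cast; ring

/-- sphere moments -/
lemma SS_rec {m l : ℕ} (hm : 3 ≤ m) (w : Fin m → ℝ) (hw : ∑ i, w i ^ 2 = 1) (j : ℕ)
    {p : MvPolynomial (Fin m) ℝ} (hp : p.IsHomogeneous l) (hh : LL p = 0) :
    ((j:ℝ) - l) * (j + l + m - 2) * SS m (cc w ^ j * p) = j * (j - 1) * SS m (cc w ^ (j - 2) * p) := by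
  have h := GG_rec w hw j hp hh
  rw [polar (by omega) _ _ (ccpow_hom w j hp), polar (by omega) _ _ (ccpow_hom w (j-2) hp)] at h
  rcases j with _ | _ | j
  · have := (RR_pos m l (by omega)).ne'
    simp at h ⊢
    tauto
  · have := (RR_pos m (1 + l) (by omega)).ne'
    simp [this] at h ⊢
    tauto
  · have hpos := (RR_pos m (j + l) (by omega)).ne'
    simp only [show j + 1 + 1 - 2 = j by omega, show j + 1 + 1 + l = (j + l) + 2 by omega,
      RR_succ m (j + l) (by omega)] at h ⊢
    apply mul_right_cancel₀ hpos
    push_cast at h ⊢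
    linarith

lemma SS_lt {m l : ℕ} (hm : 3 ≤ m) (w : Fin m → ℝ) (hw : ∑ i, w i ^ 2 = 1)
    {p : MvPolynomial (Fin m) ℝ} (hp : p.IsHomogeneous l) (hh : LL p = 0) (j : ℕ) (hj : j < l) :
    SS m (cc w ^ j * p) = 0 := by
  have h := GG_lt w hw hp hh j hj
  rw [polar (by omega) _ _ (ccpow_hom w j hp)] at h
  exact (mul_eq_zero.1 h).resolve_right (RR_pos m _ (by omega)).ne'

lemma SS_eq {m : ℕ} (hm : 3 ≤ m) (w : Fin m → ℝ) (hw : ∑ i, w i ^ 2 = 1) (l : ℕ)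
    {p : MvPolynomial (Fin m) ℝ} (hp : p.IsHomogeneous l) (hh : LL p = 0) :
    SS m (cc w ^ l * p) * RR m (l + l) = l.factorial * (Real.sqrt (2 * Real.pi)) ^ m * eval w p := by
  rw [← GG_eq w hw l hp hh, polar (by omega) _ _ (ccpow_hom w l hp)]

/-- functional on one variable polynomials -/
noncomputable def FF {m : ℕ} (w : Fin m → ℝ) (p : MvPolynomial (Fin m) ℝ) : Polynomial ℝ →ₗ[ℝ] ℝ :=
  (SS m).comp ((LinearMap.mulRight ℝ p).comp (Polynomial.aeval (cc w)).toLinearMap)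

lemma FF_apply {m : ℕ} (w : Fin m → ℝ) (p : MvPolynomial (Fin m) ℝ) (q : Polynomial ℝ) :
    FF w p q = SS m (Polynomial.aeval (cc w) q * p) := rfl

lemma FF_lap {m l : ℕ} (hm : 3 ≤ m) (w : Fin m → ℝ) (hw : ∑ i, w i ^ 2 = 1)
    {p : MvPolynomial (Fin m) ℝ} (hp : p.IsHomogeneous l) (hh : LL p = 0) (q : Polynomial ℝ) :
    FF w p ((1 - Polynomial.X^2) * Polynomial.derivative (Polynomial.derivative q)
      - Polynomial.C ((m:ℝ) - 1) * (Polynomial.X * Polynomial.derivative q)) = - (l * (l + m - 2)) * FF w p q := by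
  induction q using Polynomial.induction_on' with
  | add a b ha hb =>
    rw [map_add (FF w p) a b, mul_add, ← ha, ← hb, ← map_add]
    congr 1
    simp only [Polynomial.derivative_add]
    ring
  | monomial j a =>
    have hr := SS_rec hm w hw j hp hh
    have hF : ∀ n, FF w p (Polynomial.X ^ n) = SS m (cc w ^ n * p) := by
      intro n; simp [FF_apply]
    rw [← hF, ← hF] at hr
    have e : (1 - Polynomial.X^2) * Polynomial.derivative (Polynomial.derivative (Polynomial.monomial j a))
      - Polynomial.C ((m:ℝ) - 1) * (Polynomial.X * Polynomial.derivative (Polynomial.monomial j a)) =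
      (a * j * (j - 1)) • Polynomial.X ^ (j-2) - (a * (j * (j - 1) + (m - 1) * j)) • Polynomial.X ^ j := by
      simp only [← Polynomial.C_mul_X_pow_eq_monomial, Polynomial.derivative_C_mul,
        Polynomial.derivative_X_pow, Polynomial.smul_eq_C_mul, Polynomial.derivative_mul]
      rcases j with _ | _ | j
      · simp
      · simp
        ring
      · simp
        ring
    rw [e, map_sub, map_smul, map_smul, ← Polynomial.C_mul_X_pow_eq_monomial, ← Polynomial.smul_eq_C_mul,
      map_smul]
    simp only [smul_eq_mul]
    linear_combination (-a) * hr

lemma lam_rec {m l : ℕ} (hm : 3 ≤ m) (w : Fin m → ℝ) (hw : ∑ i, w i ^ 2 = 1)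
    {p : MvPolynomial (Fin m) ℝ} (hp : p.IsHomogeneous l) (hh : LL p = 0) (k : ℕ) :
    ((k:ℝ) + 1 - l) * (k + 1 + l + m - 2) * SS m ((1 + cc w) ^ (k+1) * p) =
      (k + 1) * (2 * k + m - 1) * SS m ((1 + cc w) ^ k * p) := by
  have h := FF_lap hm w hw hp hh ((1 + Polynomial.X) ^ (k+1))
  have e : (1 - Polynomial.X^2) * Polynomial.derivative (Polynomial.derivative ((1 + Polynomial.X) ^ (k+1)))
      - Polynomial.C ((m:ℝ) - 1) * (Polynomial.X * Polynomial.derivative ((1 + Polynomial.X) ^ (k+1))) =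
      (((k:ℝ)+1) * (2 * k + m - 1)) • (1 + Polynomial.X) ^ k -
        (((k:ℝ)+1) * (k + m - 1)) • (1 + Polynomial.X) ^ (k + 1) := by
    have c2 : Polynomial.C (2:ℝ) = 2 := map_ofNat Polynomial.C 2
    rcases k with _ | k
    · simp [Polynomial.smul_eq_C_mul]
    · simp [c2, Polynomial.smul_eq_C_mul, Polynomial.derivative_pow]
      ring
  have hF : ∀ n, FF w p ((1 + Polynomial.X) ^ n) = SS m ((1 + cc w) ^ n * p) := by
    intro n; simp [FF_apply]
  rw [e, map_sub, map_smul, map_smul, hF, hF] at h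
  simp only [smul_eq_mul] at h
  linear_combination -h

lemma lam_binom {m : ℕ} (w : Fin m → ℝ) (p : MvPolynomial (Fin m) ℝ) (k : ℕ) :
    SS m ((1 + cc w) ^ k * p) = ∑ j ∈ Finset.range (k+1), (k.choose j) * SS m (cc w ^ j * p) := by
  rw [add_comm, add_pow, Finset.sum_mul, map_sum]
  refine Finset.sum_congr rfl fun j _ => ?_
  rw [← nsmul_eq_mul, ← map_nsmul, nsmul_eq_mul]
  congr 1; ring

lemma lam_lt {m l : ℕ} (hm : 3 ≤ m) (w : Fin m → ℝ) (hw : ∑ i, w i ^ 2 = 1)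
    {p : MvPolynomial (Fin m) ℝ} (hp : p.IsHomogeneous l) (hh : LL p = 0) (k : ℕ) (hk : k < l) :
    SS m ((1 + cc w) ^ k * p) = 0 := by
  rw [lam_binom]
  refine Finset.sum_eq_zero fun j hj => ?_
  rw [SS_lt hm w hw hp hh j (by simp at hj; omega), mul_zero]

lemma lam_self {m l : ℕ} (hm : 3 ≤ m) (w : Fin m → ℝ) (hw : ∑ i, w i ^ 2 = 1)
    {p : MvPolynomial (Fin m) ℝ} (hp : p.IsHomogeneous l) (hh : LL p = 0) :
    SS m ((1 + cc w) ^ l * p) = SS m (cc w ^ l * p) := by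
  rw [lam_binom, Finset.sum_range_succ, Finset.sum_eq_zero, zero_add]
  · simp
  intro j hj
  rw [SS_lt hm w hw hp hh j (by simpa using hj), mul_zero]

lemma lam_closed {m l : ℕ} (hm : 3 ≤ m) (w : Fin m → ℝ) (hw : ∑ i, w i ^ 2 = 1)
    {p : MvPolynomial (Fin m) ℝ} (hp : p.IsHomogeneous l) (hh : LL p = 0) (n : ℕ) :
    SS m ((1 + cc w) ^ (l + n) * p) / ((l+n).factorial * Real.Gamma (((m:ℝ) - 3)/2 + (l + n : ℕ) + 1)) =
     Real.pi ^ (((m:ℝ)-1)/2) * 2 ^ (l + m - 1 + n) / (n.factorial * Real.Gamma (((m:ℝ) - 2 + 2 * l) + n + 1))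
      * eval w p := by
  have hm' : (3:ℝ) ≤ m := by exact_mod_cast hm
  induction n with
  | zero =>
    simp only [add_zero, lam_self hm w hw hp hh]
    have hS := SS_eq hm w hw l hp hh
    have hR := RR_pos m (l + l) (by omega)
    rw [RR_eq _ _ (by omega)] at hS hR
    have hG := Real.Gamma_mul_Gamma_add_half (l + ((m:ℝ)-1)/2)
    have e1 : ((m + (l + l) : ℕ) : ℝ) / 2 = l + (m:ℝ)/2 := by push_cast; ring
    have e2 : (l + ((m:ℝ)-1)/2) + 1/2 = l + (m:ℝ)/2 := by ring
    have e3 : 2 * (l + ((m:ℝ)-1)/2) = (m:ℝ) - 2 + 2 * l + 1 := by ring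
    have e4 : ((m:ℝ) - 3)/2 + l + 1 = l + ((m:ℝ)-1)/2 := by ring
    rw [e1] at hS hR
    rw [e2, e3] at hG
    simp only [Nat.cast_zero, add_zero]
    rw [e4]
    have g1 : 0 < Real.Gamma (l + (m:ℝ)/2) := Real.Gamma_pos_of_pos (by positivity)
    have g2 : 0 < Real.Gamma (l + ((m:ℝ)-1)/2) := Real.Gamma_pos_of_pos (by
      have : (0:ℝ) ≤ l := l.cast_nonneg
      linarith)
    have g3 : 0 < Real.Gamma ((m:ℝ) - 2 + 2 * l + 1) := Real.Gamma_pos_of_pos (by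
      have : (0:ℝ) ≤ l := l.cast_nonneg
      linarith)
    have hf : (0:ℝ) < l.factorial := by exact_mod_cast l.factorial_pos
    have hS' : SS m (cc w ^ l * p) = l.factorial * (Real.sqrt (2 * Real.pi)) ^ m * eval w p / 
      (2 ^ ((l:ℝ) + m / 2 - 1) * Real.Gamma (l + m / 2)) := by
      rw [eq_div_iff hR.ne', hS]
    have hsq : Real.sqrt (2 * Real.pi) ^ m = 2 ^ ((m:ℝ)/2) * (Real.pi ^ (((m:ℝ)-1)/2) * Real.sqrt Real.pi) := by
      rw [Real.sqrt_eq_rpow, Real.sqrt_eq_rpow, ← Real.rpow_add Real.pi_pos, ← Real.rpow_natCast, ← Real.rpow_mul (by positivity),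
        Real.mul_rpow (by norm_num) Real.pi_pos.le]
      congr 2 <;> ring
    have h2 : (2:ℝ) ^ ((m:ℝ)/2) = 2 ^ (l + m - 1) * 2 ^ ((l:ℝ) + m / 2 - 1) * 2 ^ (1 - ((m:ℝ) - 2 + 2 * l + 1)) := by
      rw [← Real.rpow_natCast, ← Real.rpow_add (by norm_num), ← Real.rpow_add (by norm_num)]
      congr 1
      rw [Nat.cast_sub (by omega)]
      push_cast; ring
    rw [hS', hsq, h2, Nat.factorial_zero, Nat.cast_one, one_mul, div_div, div_mul_eq_mul_div, div_eq_div_iff (by positivity) (by positivity)]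
    linear_combination (-(l.factorial:ℝ) * 2 ^ (l + m - 1) * 2 ^ ((l:ℝ) + m / 2 - 1) * Real.pi ^ (((m:ℝ)-1)/2) * eval w p) * hG
  | succ n ih =>
    have h := lam_rec hm w hw hp hh (l + n)
    have hl : (0:ℝ) ≤ l := l.cast_nonneg
    have hn : (0:ℝ) ≤ n := n.cast_nonneg
    rw [← add_assoc] at *
    have q1 : ((m:ℝ) - 3)/2 + (l + n + 1 : ℕ) + 1 = (((m:ℝ) - 3)/2 + (l + n : ℕ) + 1) + 1 := by push_cast; ring
    have q2 : ((m:ℝ) - 2 + 2 * l) + (n + 1 : ℕ) + 1 = (((m:ℝ) - 2 + 2 * l) + n + 1) + 1 := by push_cast; ring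
    have p1 : 0 < ((m:ℝ) - 3)/2 + (l + n : ℕ) + 1 := by push_cast; linarith
    have p2 : 0 < ((m:ℝ) - 2 + 2 * l) + n + 1 := by linarith
    have g1 := Real.Gamma_pos_of_pos p1
    have g2 := Real.Gamma_pos_of_pos p2
    rw [q1, q2, Real.Gamma_add_one p1.ne', Real.Gamma_add_one p2.ne', Nat.factorial_succ, Nat.factorial_succ, ← add_assoc (l + m - 1) n 1, pow_succ (2:ℝ)]
    have f1 : (0:ℝ) < (l+n).factorial := by exact_mod_cast (l+n).factorial_pos
    have f2 : (0:ℝ) < n.factorial := by exact_mod_cast n.factorial_pos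
    set A := SS m ((1 + cc w) ^ (l + n + 1) * p)
    set B := SS m ((1 + cc w) ^ (l + n) * p)
    set u := Real.Gamma (((m:ℝ) - 3)/2 + (l + n : ℕ) + 1)
    set v := Real.Gamma (((m:ℝ) - 2 + 2 * l) + n + 1)
    have hA : A = ((l + n + 1) * (2 * (l + n) + m - 1)) / ((n + 1) * (((m:ℝ) - 2 + 2 * l) + n + 1)) * B := by
      rw [div_mul_eq_mul_div, eq_div_iff (by positivity)]
      push_cast at h
      linear_combination h
    have hB : B = (Real.pi ^ (((m:ℝ)-1)/2) * 2 ^ (l + m - 1 + n) / (n.factorial * v) * eval w p) * ((l+n).factorial * u) := by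
      rw [← ih, div_mul_cancel₀]; positivity
    rw [hA, hB]
    push_cast at p1 ⊢
    have p3 : 0 < ((m:ℝ) - 3)/2 + (l + n) + 1 := p1
    have p4 : (2 * ((l:ℝ) + n) + m - 1) = 2 * (((m:ℝ) - 3)/2 + (l + n) + 1) := by ring
    rw [p4]
    generalize ((m:ℝ) - 3)/2 + (l + n) + 1 = a at *
    generalize ((m:ℝ) - 2 + 2 * l) + n + 1 = b at *
    field_simp

lemma isHom_of {m l : ℕ} (P : MvPolynomial (Fin m) ℝ)
    (hhom : ∀ lam : ℝ, 0 < lam → ∀ x : EuclideanSpace ℝ (Fin m),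
      MvPolynomial.eval (fun i => lam * x i) P =
        lam ^ l * MvPolynomial.eval (fun i => x i) P) : P.IsHomogeneous l := by
  classical
  set Q : MvPolynomial (Fin m) ℝ :=
    ∑ d ∈ P.support, monomial d (2 ^ (Finsupp.weight 1 d) * coeff d P) with hQ
  have h1 : Q = C (2 ^ l) * P := by
    apply MvPolynomial.funext
    intro y
    have := hhom 2 (by norm_num) (WithLp.toLp 2 y)
    simp only at this
    rw [map_mul, eval_C, ← this, hQ, map_sum, eval_eq']
    refine Finset.sum_congr rfl fun d _ => ?_
    rw [eval_monomial, Finsupp.prod_fintype _ _ (by simp)]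
    simp only [mul_pow, Finset.prod_mul_distrib, Finset.prod_pow_eq_pow_sum]
    rw [Finsupp.weight_apply, Finsupp.sum_fintype _ _ (by simp)]
    simp
    ring
  intro d hd
  have h2 := congrArg (coeff d) h1
  rw [hQ, coeff_sum, coeff_C_mul] at h2
  simp only [coeff_monomial] at h2
  rw [Finset.sum_ite_eq' P.support d, if_pos (mem_support_iff.2 hd)] at h2
  have h3 := mul_right_cancel₀ hd h2
  exact pow_right_injective₀ (by norm_num : (0:ℝ) < 2) (by norm_num) h3
end alg

lemma hw_of {m : ℕ} (ω : Metric.sphere (0 : EuclideanSpace ℝ (Fin m)) 1) :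
    ∑ i, (ω : EuclideanSpace ℝ (Fin m)) i ^ 2 = 1 := by
  have h := EuclideanSpace.norm_sq_eq (ω : EuclideanSpace ℝ (Fin m))
  rw [norm_eq_of_mem_sphere ω] at h
  simpa using h.symm

lemma eval_cc {m : ℕ} (x y : EuclideanSpace ℝ (Fin m)) :
    MvPolynomial.eval (fun i => y i) (cc (fun i => x i)) = ⟪x, y⟫ := by
  simp [cc, PiLp.inner_apply, mul_comm]

lemma Gamma_cast (ν : ℝ) (k : ℕ) :
    Complex.Gamma ((ν : ℂ) + k + 1) = ((Real.Gamma (ν + k + 1) : ℝ) : ℂ) := by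
  rw [← Complex.Gamma_ofReal]; push_cast; rfl

lemma Gamma_lower (ν : ℝ) (hν : 0 ≤ ν) (k : ℕ) : Real.Gamma (ν + 1) ≤ Real.Gamma (ν + k + 1) := by
  induction k with
  | zero => simp
  | succ k ih =>
    have hk : (0:ℝ) ≤ k := k.cast_nonneg
    have e : ν + (k + 1 : ℕ) + 1 = (ν + k + 1) + 1 := by push_cast; ring
    rw [e, Real.Gamma_add_one (s := ν + k + 1) (by positivity)]
    have := Real.Gamma_pos_of_pos (s := ν + k + 1) (by positivity)
    nlinarith

lemma sq_aux (s : ℂ) (y : ℝ) (k : ℕ) (hy : 0 ≤ y) :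
    ((((2 * Real.sqrt (2 * y) : ℝ) : ℂ) / s) / 2) ^ (2 * k) = (2 * y / s ^ 2 : ℂ) ^ k := by
  rw [pow_mul]
  congr 1
  have h : (((Real.sqrt (2 * y) : ℝ) : ℂ)) ^ 2 = 2 * y := by
    rw [← Complex.ofReal_pow, Real.sq_sqrt (by positivity)]; push_cast; rfl
  push_cast
  rw [show (2 * ((Real.sqrt (2 * y) : ℝ) : ℂ) / s / 2) = ((Real.sqrt (2 * y) : ℝ) : ℂ) / s by ring,
    div_pow, h]

theorem sphere_integral_Kplus (m l : ℕ) (hm : 3 ≤ m) (t : ℂ) (ht : InOmega t)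
    (P : MvPolynomial (Fin m) ℝ)
    (hharm : ∑ j, MvPolynomial.pderiv j (MvPolynomial.pderiv j P) = 0)
    (hhom : ∀ lam : ℝ, 0 < lam → ∀ x : EuclideanSpace ℝ (Fin m),
      MvPolynomial.eval (fun i => lam * x i) P =
        lam ^ l * MvPolynomial.eval (fun i => x i) P) :
    ∀ r r' : ℝ, 0 < r → 0 < r' →
      ∀ ω : Metric.sphere (0 : EuclideanSpace ℝ (Fin m)) 1,
        (1/2 : ℂ) * ∫ ω' : Metric.sphere (0 : EuclideanSpace ℝ (Fin m)) 1,
            Kplus m t (r • (ω : EuclideanSpace ℝ (Fin m)))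
                (r' • (ω' : EuclideanSpace ℝ (Fin m))) *
              (MvPolynomial.eval (fun i => (ω' : EuclideanSpace ℝ (Fin m)) i) P : ℂ)
            ∂((volume : Measure (EuclideanSpace ℝ (Fin m))).toSphere) =
          Kl m l t r r' *
            (MvPolynomial.eval (fun i => (ω : EuclideanSpace ℝ (Fin m)) i) P : ℂ) := by
  intro r r' hr hr' ω
  have hP : P.IsHomogeneous l := isHom_of P hhom
  have hL : LL P = 0 := hharm
  set w : Fin m → ℝ := fun i => (ω : EuclideanSpace ℝ (Fin m)) i with hwdef
  have hw : ∑ i, w i ^ 2 = 1 := hw_of ω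
  have hm' : (3:ℝ) ≤ m := by exact_mod_cast hm
  set s := Complex.sinh (t/2) with hs
  set ν : ℝ := ((m:ℝ) - 3)/2 with hνdef
  have hν : 0 ≤ ν := by rw [hνdef]; linarith
  set z : ℂ := 2 * (r * r' : ℝ) / s ^ 2 with hz
  set σ := (volume : Measure (EuclideanSpace ℝ (Fin m))).toSphere with hσ
  set A : ℂ := 2 * Complex.exp (-2 * (r + r' : ℝ) * (Complex.cosh (t/2) / s)) /
    (((Real.pi ^ (((m : ℝ) - 1) / 2) : ℝ) : ℂ) * s ^ (m - 1)) with hA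
  let q : ℕ → Metric.sphere (0 : EuclideanSpace ℝ (Fin m)) 1 → ℝ := fun k ω' =>
    MvPolynomial.eval (fun i => (ω' : EuclideanSpace ℝ (Fin m)) i) ((1 + cc w) ^ k * P)
  let co : ℕ → ℂ := fun k => z ^ k / ((Nat.factorial k : ℂ) * ((Real.Gamma (ν + k + 1) : ℝ) : ℂ))
  let T : ℕ → Metric.sphere (0 : EuclideanSpace ℝ (Fin m)) 1 → ℂ := fun k ω' => co k * (q k ω' : ℂ)
  have hin : ∀ ω' : Metric.sphere (0 : EuclideanSpace ℝ (Fin m)) 1,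
      |⟪(ω : EuclideanSpace ℝ (Fin m)), (ω' : EuclideanSpace ℝ (Fin m))⟫| ≤ 1 := by
    intro ω'
    have := abs_real_inner_le_norm (ω : EuclideanSpace ℝ (Fin m)) (ω' : EuclideanSpace ℝ (Fin m))
    simpa using this
  have hqe : ∀ k ω', q k ω' = (1 + ⟪(ω : EuclideanSpace ℝ (Fin m)), (ω' : EuclideanSpace ℝ (Fin m))⟫) ^ k *
      MvPolynomial.eval (fun i => (ω' : EuclideanSpace ℝ (Fin m)) i) P := by
    intro k ω'
    simp only [q, map_mul, map_pow, map_add, map_one]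
    rw [eval_cc]
  -- pointwise expansion
  have hpt : ∀ ω' : Metric.sphere (0 : EuclideanSpace ℝ (Fin m)) 1,
      Kplus m t (r • (ω : EuclideanSpace ℝ (Fin m))) (r' • (ω' : EuclideanSpace ℝ (Fin m))) *
        (MvPolynomial.eval (fun i => (ω' : EuclideanSpace ℝ (Fin m)) i) P : ℂ) =
      A * ∑' k, T k ω' := by
    intro ω'
    have n1 : ‖r • (ω : EuclideanSpace ℝ (Fin m))‖ = r := by
      rw [norm_smul, norm_eq_of_mem_sphere ω, mul_one, Real.norm_of_nonneg hr.le]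
    have n2 : ‖r' • (ω' : EuclideanSpace ℝ (Fin m))‖ = r' := by
      rw [norm_smul, norm_eq_of_mem_sphere ω', mul_one, Real.norm_of_nonneg hr'.le]
    have hc := abs_le.1 (hin ω')
    have hψ : psiK (r • (ω : EuclideanSpace ℝ (Fin m))) (r' • (ω' : EuclideanSpace ℝ (Fin m))) =
        2 * Real.sqrt (2 * (r * r' * (1 + ⟪(ω : EuclideanSpace ℝ (Fin m)), (ω' : EuclideanSpace ℝ (Fin m))⟫))) := by
      rw [psiK, n1, n2, real_inner_smul_left, real_inner_smul_right]
      congr 3; ring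
    have hI : ItildeC ν (((psiK (r • (ω : EuclideanSpace ℝ (Fin m))) (r' • (ω' : EuclideanSpace ℝ (Fin m))) : ℝ) : ℂ) / s) *
        (MvPolynomial.eval (fun i => (ω' : EuclideanSpace ℝ (Fin m)) i) P : ℂ) = ∑' k, T k ω' := by
      rw [ItildeC, ← tsum_mul_right]
      congr 1
      ext k
      rw [hψ, sq_aux s _ k (mul_nonneg (by positivity) (by linarith)), Gamma_cast]
      simp only [T, co, hqe, hz]
      push_cast
      rw [show (2 * ((r:ℂ) * r' * (1 + (⟪(ω : EuclideanSpace ℝ (Fin m)), (ω' : EuclideanSpace ℝ (Fin m))⟫ : ℝ))) / s ^ 2) =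
        (2 * ((r:ℂ) * r') / s ^ 2) * (1 + (⟪(ω : EuclideanSpace ℝ (Fin m)), (ω' : EuclideanSpace ℝ (Fin m))⟫ : ℝ)) by ring, mul_pow]
      ring
    rw [← hI, Kplus, n1, n2, hA]
    ring
  have hTint : ∀ k, Integrable (T k) σ := by
    intro k
    exact ((sint ((1 + cc w) ^ k * P)).ofReal).const_mul _
  have hTval : ∀ k, ∫ ω', T k ω' ∂σ = co k * ((SS m ((1 + cc w) ^ k * P) : ℝ) : ℂ) := by
    intro k
    simp only [T]
    rw [integral_const_mul, integral_complex_ofReal]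
    rfl
  have hTsum : Summable fun k => ∫ ω', ‖T k ω'‖ ∂σ := by
    have hg := Real.Gamma_pos_of_pos (s := ν + 1) (by positivity)
    set B := ∫ ω', |MvPolynomial.eval (fun i => (ω' : EuclideanSpace ℝ (Fin m)) i) P| ∂σ with hB
    have hs1 := (Real.summable_pow_div_factorial (2 * ‖z‖)).mul_right (B / Real.Gamma (ν + 1))
    refine Summable.of_nonneg_of_le (fun k => integral_nonneg fun _ => norm_nonneg _) (fun k => ?_) hs1
    have hB0 : 0 ≤ B := integral_nonneg fun _ => abs_nonneg _
    have h1 : ∫ ω', ‖T k ω'‖ ∂σ ≤ ∫ ω', ‖co k‖ * (2 ^ k * |MvPolynomial.eval (fun i => (ω' : EuclideanSpace ℝ (Fin m)) i) P|) ∂σ := by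
      refine integral_mono (hTint k).norm (((sint P).abs.const_mul _).const_mul _) fun ω' => ?_
      have hc := abs_le.1 (hin ω')
      simp only [T, norm_mul, Complex.norm_real, Real.norm_eq_abs, hqe, abs_mul, abs_pow]
      gcongr
      rw [abs_of_nonneg (by linarith)]; linarith
    refine h1.trans ?_
    rw [integral_const_mul, integral_const_mul, ← hB]
    have hgk := Gamma_lower ν hν k
    have hco : ‖co k‖ ≤ ‖z‖ ^ k / (k.factorial * Real.Gamma (ν + 1)) := by
      simp only [co, norm_div, norm_pow, norm_mul, Complex.norm_real, Complex.norm_natCast, Real.norm_eq_abs]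
      rw [abs_of_pos (hg.trans_le hgk)]
      have : (0:ℝ) < k.factorial := by exact_mod_cast k.factorial_pos
      gcongr
    calc ‖co k‖ * (2 ^ k * B) ≤ ‖z‖ ^ k / (k.factorial * Real.Gamma (ν + 1)) * (2 ^ k * B) := by gcongr
      _ = _ := by rw [mul_pow]; field_simp
  have hHS := hasSum_integral_of_summable_integral_norm hTint hTsum
  simp_rw [hpt]
  rw [integral_const_mul, ← hHS.tsum_eq, ← hHS.summable.sum_add_tsum_nat_add l,
    Finset.sum_eq_zero (fun k hk => by
      rw [hTval, lam_lt hm w hw hP hL k (by simpa using hk)]; simp), zero_add]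
  have hterm : ∀ n : ℕ, ∫ ω', T (n + l) ω' ∂σ =
      ((Real.pi ^ (((m : ℝ) - 1) / 2) : ℝ) : ℂ) * 2 ^ (l + m - 1) * z ^ l *
        (MvPolynomial.eval w P : ℂ) *
      ((((4 * Real.sqrt (r * r') : ℝ) : ℂ) / s / 2) ^ (2 * n) / ((Nat.factorial n : ℂ) *
        Complex.Gamma ((((m : ℝ) - 2 + 2 * l : ℝ) : ℂ) + n + 1))) := by
    intro n
    have h := congrArg (fun x : ℝ => (x : ℂ)) (lam_closed hm w hw hP hL n)
    have e4 : (4 * Real.sqrt (r * r') : ℝ) = 2 * Real.sqrt (2 * (2 * (r * r'))) := by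
      rw [show 2 * (2 * (r * r')) = 2 ^ 2 * (r * r') by ring, 
        Real.sqrt_mul (by norm_num : (0:ℝ) ≤ 2 ^ 2) (r * r'),
        Real.sqrt_sq (by norm_num : (0:ℝ) ≤ 2)]; ring
    rw [hTval, e4, sq_aux s _ n (by positivity), Gamma_cast, add_comm n l]
    rw [show ((2 * (2 * (r * r') : ℝ) / s ^ 2 : ℂ)) = 2 * z by rw [hz]; push_cast; ring, mul_pow]
    simp only [co]
    rw [div_mul_eq_mul_div, mul_div_assoc]
    rw [Complex.ofReal_div, Complex.ofReal_mul, Complex.ofReal_natCast] at h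
    rw [h]
    push_cast
    ring
  simp_rw [hterm]
  rw [tsum_mul_left, Kl, hA, hz, ← hs]
  change _ = _ * ItildeC ((m : ℝ) - 2 + 2 * l) _ / _ * _
  rw [ItildeC]
  generalize (∑' (k : ℕ), _ : ℂ) = S
  have hpi : (((Real.pi ^ (((m : ℝ) - 1) / 2) : ℝ) : ℂ)) ≠ 0 := by
    exact_mod_cast (Real.rpow_pos_of_pos Real.pi_pos _).ne'
  by_cases h0 : s = 0
  · have : m - 1 ≠ 0 := by omega
    simp [h0, this]
  · rw [show l + m - 1 = m - 1 + l by omega, pow_add, pow_add, pow_add s, pow_mul, pow_mul, div_pow, mul_pow]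
    push_cast
    field_simp
    have h4 : (4:ℂ) ^ l = 2 ^ (l * 2) := by
      rw [mul_comm l 2, pow_mul]; norm_num
    rw [show (2:ℂ)^2 = 2 * 2 by norm_num, mul_pow]
    ring_nf
    rw [h4]
end
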